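/- Let a, b ∈ ℂ with Re a > 0 and Re b > 0, let g(x) = 1/(e^{ax} + e^{-bx}), let α > 0, and let Λ ⊂ ℝ be a separated set. Then the following three statements are equivalent: (1) the Gabor system G(g, Λ × αℤ) is a frame in L²(ℝ); (2) the Gabor system G(g, αℤ × Λ) is a frame in L²(ℝ); (3) D⁻(Λ) > α. -/

import Mathlib

open MeasureTheory Filter Metric Complex

noncomputable section

/-- A set `Λ ⊆ ℝ` is separated. -/
def Separated (Λ : Set ℝ) : Prop :=
  ∃ δ : ℝ, 0 < δ ∧ ∀ x ∈ Λ, ∀ y ∈ Λ, x ≠ y → δ ≤ |x - y|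

/-- Lower Beurling density. -/
def lowerDensity (Λ : Set ℝ) : ℝ :=
  liminf (fun r : ℝ => ⨅ x : ℝ, ((Λ ∩ Set.Icc x (x + r)).ncard : ℝ) / r) atTop

def upperDensity (Λ : Set ℝ) : ℝ :=
  limsup (fun r : ℝ => ⨆ x : ℝ, ((Λ ∩ Set.Icc x (x + r)).ncard : ℝ) / r) atTop

/-- Gabor coefficient. -/
def gaborCoef (g f : ℝ → ℂ) (p : ℝ × ℝ) : ℂ :=
  ∫ t : ℝ, f t * (starRingEnd ℂ) (Complex.exp (-2 * Real.pi * Complex.I * p.2 * t) * g (p.1 - t))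

def IsGaborFrame (g : ℝ → ℂ) (S : Set (ℝ × ℝ)) : Prop :=
  ∃ A B : ℝ, 0 < A ∧ 0 < B ∧ ∀ f : ℝ → ℂ, MemLp f 2 (volume : Measure ℝ) →
    A * (∫ t : ℝ, ‖f t‖ ^ 2) ≤ (∑' p : S, ‖gaborCoef g f p‖ ^ 2) ∧
    (∑' p : S, ‖gaborCoef g f p‖ ^ 2) ≤ B * (∫ t : ℝ, ‖f t‖ ^ 2)

/-- membership in shift invariant space -/
def InV2 (g : ℝ → ℂ) (f : ℝ → ℂ) : Prop :=
  ∃ c : ℤ → ℂ, Memℓp c 2 ∧ ∀ x : ℝ, HasSum (fun n : ℤ => c n * g (x - n)) (f x)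

def IsSamplingSet (g : ℝ → ℂ) (Λ : Set ℝ) : Prop :=
  ∃ A B : ℝ, 0 < A ∧ 0 < B ∧ ∀ f : ℝ → ℂ, InV2 g f →
    A * (∫ t : ℝ, ‖f t‖ ^ 2) ≤ (∑' l : Λ, ‖f l‖ ^ 2) ∧
    (∑' l : Λ, ‖f l‖ ^ 2) ≤ B * (∫ t : ℝ, ‖f t‖ ^ 2)

def IsInterpolatingSet (g : ℝ → ℂ) (Λ : Set ℝ) : Prop :=
  ∀ a : Λ → ℂ, Memℓp a 2 → ∃ f : ℝ → ℂ, InV2 g f ∧ ∀ l : Λ, f l = a l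

def IsSamplingSeqV (g : ℝ → ℂ) (lam : ℤ → ℝ) : Prop :=
  ∃ A B : ℝ, 0 < A ∧ 0 < B ∧ ∀ f : ℝ → ℂ, InV2 g f →
    A * (∫ t : ℝ, ‖f t‖ ^ 2) ≤ (∑' m : ℤ, ‖f (lam m)‖ ^ 2) ∧
    (∑' m : ℤ, ‖f (lam m)‖ ^ 2) ≤ B * (∫ t : ℝ, ‖f t‖ ^ 2)

/-- Fock weight function φ. -/
def phiF (β γ : ℝ) (z : ℂ) : ℝ :=
  β * (Real.log ‖z‖) ^ 2 + γ * Real.log ‖z‖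

def MemFock (β γ : ℝ) (F : ℂ → ℂ) : Prop :=
  DifferentiableOn ℂ F {(0 : ℂ)}ᶜ ∧
    Integrable (fun z : ℂ => ‖F z‖ ^ 2 * Real.exp (-2 * phiF β γ z)) volume

def fockNormSq (β γ : ℝ) (F : ℂ → ℂ) : ℝ :=
  (1 / Real.pi) * ∫ z : ℂ, ‖F z‖ ^ 2 * Real.exp (-2 * phiF β γ z)

def fockWeight (β γ : ℝ) (w : ℂ) : ℝ :=
  (1 + ‖w‖ ^ 2) * Real.exp (-2 * phiF β γ w)

def IsFockSamplingSeq (β γ : ℝ) (u : ℤ → ℂ) : Prop :=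
  ∃ A B : ℝ, 0 < A ∧ 0 < B ∧ ∀ F : ℂ → ℂ, MemFock β γ F →
    A * fockNormSq β γ F ≤ (∑' m : ℤ, fockWeight β γ (u m) * ‖F (u m)‖ ^ 2) ∧
    (∑' m : ℤ, fockWeight β γ (u m) * ‖F (u m)‖ ^ 2) ≤ B * fockNormSq β γ F

def IsFockInterpolatingSeq (β γ : ℝ) (u : ℤ → ℂ) : Prop :=
  ∀ a : ℤ → ℂ, Summable (fun m : ℤ => fockWeight β γ (u m) * ‖a m‖ ^ 2) →
    ∃ F : ℂ → ℂ, MemFock β γ F ∧ ∀ m : ℤ, F (u m) = a m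

def IsFockSamplingSet (β γ : ℝ) (Λ : Set ℂ) : Prop :=
  ∃ A B : ℝ, 0 < A ∧ 0 < B ∧ ∀ F : ℂ → ℂ, MemFock β γ F →
    A * fockNormSq β γ F ≤ (∑' w : Λ, fockWeight β γ w * ‖F w‖ ^ 2) ∧
    (∑' w : Λ, fockWeight β γ w * ‖F w‖ ^ 2) ≤ B * fockNormSq β γ F

def IsFockInterpolatingSet (β γ : ℝ) (Λ : Set ℂ) : Prop :=
  ∀ a : Λ → ℂ, Summable (fun w : Λ => fockWeight β γ (w : ℂ) * ‖a w‖ ^ 2) →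
    ∃ F : ℂ → ℂ, MemFock β γ F ∧ ∀ w : Λ, F w = a w

/-- the canonical product A(z) -/
def Afun (a b : ℂ) (z : ℂ) : ℂ :=
  ∏' n : ℕ, (1 + z * Complex.exp (-(a + b) * (n + 1)))

def Gfun (a b : ℂ) (z : ℂ) : ℂ := (1 + z) * Afun a b z * Afun a b (1 / z)

/-- the discrete Cauchy transform G(z) Σ c_n e^{an}/(z+e^{(a+b)n}) -/
def cauchyT (a b : ℂ) (c : ℤ → ℂ) (z : ℂ) : ℂ :=
  Gfun a b z * ∑' n : ℤ, c n * Complex.exp (a * n) / (z + Complex.exp ((a + b) * n))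

/-- norm of the evaluation functional at `w` on `H_{a,b}` -/
def Hnorm (a b : ℂ) (w : ℂ) : ℝ :=
  sSup {r : ℝ | ∃ c : ℤ → ℂ, Memℓp c 2 ∧ (∑' n : ℤ, ‖c n‖ ^ 2) ≤ 1 ∧ r = ‖cauchyT a b c w‖}

def IsSamplingSeqH (a b : ℂ) (u : ℤ → ℂ) : Prop :=
  ∃ A B : ℝ, 0 < A ∧ 0 < B ∧ ∀ c : ℤ → ℂ, Memℓp c 2 →
    A * (∑' n : ℤ, ‖c n‖ ^ 2) ≤ (∑' m : ℤ, ((Hnorm a b (u m)) ^ 2)⁻¹ * ‖cauchyT a b c (u m)‖ ^ 2) ∧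
    (∑' m : ℤ, ((Hnorm a b (u m)) ^ 2)⁻¹ * ‖cauchyT a b c (u m)‖ ^ 2) ≤ B * (∑' n : ℤ, ‖c n‖ ^ 2)

section GaborDensity

open scoped ENNReal NNReal Topology FourierTransform

/-! ### Schur-type estimates over separated families -/

/-- A family of reals whose members are pairwise at distance at least `δ`. -/
def SeparatedFamily {ι : Type} (δ : ℝ) (u : ι → ℝ) : Prop :=
  ∀ i j, i ≠ j → δ ≤ |u i - u j|

lemma SeparatedFamily.sub_const {ι : Type} {δ : ℝ} {u : ι → ℝ} (hu : SeparatedFamily δ u)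
    (s : ℝ) : SeparatedFamily δ (fun i => u i - s) := by
  intro i j hij
  simpa using hu i j hij

lemma SeparatedFamily.injective {ι : Type} {δ : ℝ} {u : ι → ℝ} (hu : SeparatedFamily δ u)
    (hδ : 0 < δ) : Function.Injective u := by
  intro i j hij
  by_contra hne
  have := hu i j hne
  rw [hij, sub_self, abs_zero] at this
  linarith

lemma summable_int_exp_neg_mul_abs {σ : ℝ} (hσ : 0 < σ) :
    Summable (fun n : ℤ => Real.exp (-σ * |(n : ℝ)|)) := by
  have h : Summable (fun n : ℕ => Real.exp (-σ * n)) := by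
    have := summable_geometric_of_lt_one (Real.exp_pos (-σ)).le (by simpa using hσ)
    refine this.congr fun n => ?_
    rw [← Real.exp_nat_mul, mul_comm]
  refine Summable.of_nat_of_neg ?_ ?_ <;> simpa using h

lemma SeparatedFamily.floor_injective {ι : Type} {δ : ℝ} {u : ι → ℝ}
    (hu : SeparatedFamily δ u) (hδ : 0 < δ) :
    Function.Injective fun i => ⌊u i / δ⌋ := by
  intro i j hij
  by_contra hne
  have h := hu i j hne
  have h1 := Int.abs_sub_lt_one_of_floor_eq_floor hij
  rw [← sub_div, abs_div, abs_of_pos hδ, div_lt_one hδ] at h1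
  linarith

/-- Exponential sums over `δ`-separated families are bounded uniformly in the family. -/
lemma exists_tsum_exp_neg_abs_le {σ δ : ℝ} (hσ : 0 < σ) (hδ : 0 < δ) :
    ∃ K : ℝ≥0, ∀ (ι : Type) (u : ι → ℝ), SeparatedFamily δ u → ∀ y : ℝ,
      ∑' i, ENNReal.ofReal (Real.exp (-σ * |u i - y|)) ≤ K := by
  have hs := summable_int_exp_neg_mul_abs (mul_pos hσ hδ)
  set Z : ℝ≥0∞ := ∑' n : ℤ, ENNReal.ofReal (Real.exp (-(σ * δ) * |(n : ℝ)|)) with hZ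
  have hZtop : Z ≠ ⊤ := by
    rw [hZ, ← ENNReal.ofReal_tsum_of_nonneg (fun _ => (Real.exp_pos _).le) hs]
    exact ENNReal.ofReal_ne_top
  refine ⟨(ENNReal.ofReal (Real.exp (σ * δ)) * Z).toNNReal, fun ι u hu y => ?_⟩
  rw [ENNReal.coe_toNNReal (ENNReal.mul_ne_top ENNReal.ofReal_ne_top hZtop)]
  have key : ∀ i, ENNReal.ofReal (Real.exp (-σ * |u i - y|)) ≤
      ENNReal.ofReal (Real.exp (σ * δ)) *
        ENNReal.ofReal (Real.exp (-(σ * δ) * |((⌊u i / δ⌋ - ⌊y / δ⌋ : ℤ) : ℝ)|)) := by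
    intro i
    rw [← ENNReal.ofReal_mul (Real.exp_pos _).le, ← Real.exp_add]
    refine ENNReal.ofReal_le_ofReal (Real.exp_le_exp.2 ?_)
    have h1 := Int.floor_le (u i / δ)
    have h2 := Int.lt_floor_add_one (u i / δ)
    have h3 := Int.floor_le (y / δ)
    have h4 := Int.lt_floor_add_one (y / δ)
    have h5 : |((⌊u i / δ⌋ - ⌊y / δ⌋ : ℤ) : ℝ)| ≤ |u i / δ - y / δ| + 1 := by
      push_cast
      have h6 : |((⌊u i / δ⌋ : ℝ) - ⌊y / δ⌋) - (u i / δ - y / δ)| ≤ 1 := by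
        rw [abs_le]; constructor <;> linarith
      have := abs_sub_abs_le_abs_sub ((⌊u i / δ⌋ : ℝ) - ⌊y / δ⌋) (u i / δ - y / δ)
      linarith
    rw [← sub_div, abs_div, abs_of_pos hδ, ← sub_le_iff_le_add, le_div_iff₀ hδ] at h5
    nlinarith
  calc ∑' i, ENNReal.ofReal (Real.exp (-σ * |u i - y|))
      ≤ ∑' i, ENNReal.ofReal (Real.exp (σ * δ)) *
        ENNReal.ofReal (Real.exp (-(σ * δ) * |((⌊u i / δ⌋ - ⌊y / δ⌋ : ℤ) : ℝ)|)) :=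
        ENNReal.tsum_le_tsum key
    _ = ENNReal.ofReal (Real.exp (σ * δ)) * ∑' i,
        ENNReal.ofReal (Real.exp (-(σ * δ) * |((⌊u i / δ⌋ - ⌊y / δ⌋ : ℤ) : ℝ)|)) :=
        ENNReal.tsum_mul_left
    _ ≤ _ := by
        gcongr
        exact ENNReal.tsum_comp_le_tsum_of_injective
          (f := fun i => ⌊u i / δ⌋ - ⌊y / δ⌋)
          (fun i j hij => hu.floor_injective hδ (by simpa using hij))
          (fun n : ℤ => ENNReal.ofReal (Real.exp (-(σ * δ) * |(n : ℝ)|)))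

lemma separatedFamily_progression {τ : ℝ} (hτ : 0 < τ) (s : ℝ) :
    SeparatedFamily τ (fun n : ℤ => s + τ * n) := by
  intro i j hij
  have : (1 : ℝ) ≤ |(i : ℝ) - j| := by
    exact_mod_cast Int.one_le_abs (sub_ne_zero.2 hij)
  have e : s + τ * i - (s + τ * j) = τ * ((i : ℝ) - j) := by ring
  rw [e, abs_mul, abs_of_pos hτ]
  nlinarith

lemma ENNReal.two_mul_mul_le_sq_add_sq (a b : ℝ≥0∞) : 2 * (a * b) ≤ a ^ 2 + b ^ 2 := by
  rcases eq_or_ne a ⊤ with rfl | ha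
  · simp
  rcases eq_or_ne b ⊤ with rfl | hb
  · simp
  lift a to ℝ≥0 using ha
  lift b to ℝ≥0 using hb
  have : 2 * (a * b) ≤ a ^ 2 + b ^ 2 := by
    rw [← mul_assoc]; exact two_mul_le_add_sq a b
  exact_mod_cast this

lemma ENNReal.add_sq_le (a b : ℝ≥0∞) : (a + b) ^ 2 ≤ 2 * (a ^ 2 + b ^ 2) := by
  have := ENNReal.two_mul_mul_le_sq_add_sq a b
  calc (a + b) ^ 2 = a ^ 2 + b ^ 2 + 2 * (a * b) := by ring
    _ ≤ a ^ 2 + b ^ 2 + (a ^ 2 + b ^ 2) := by gcongr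
    _ = _ := by ring

/-- Weighted Cauchy-Schwarz inequality for sums in `ℝ≥0∞`. -/
lemma ENNReal.tsum_mul_sq_le {ι : Type} (k x : ι → ℝ≥0∞) :
    (∑' j, k j * x j) ^ 2 ≤ (∑' j, k j) * ∑' j, k j * x j ^ 2 := by
  have h2 : 2 * (∑' j, k j * x j) ^ 2 ≤ 2 * ((∑' j, k j) * ∑' j, k j * x j ^ 2) := by
    calc 2 * (∑' j, k j * x j) ^ 2 = ∑' i, ∑' j, k i * k j * (2 * (x i * x j)) := by
          rw [sq, ← ENNReal.tsum_mul_right, ← ENNReal.tsum_mul_left]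
          refine tsum_congr fun i => ?_
          rw [← ENNReal.tsum_mul_left, ← ENNReal.tsum_mul_left]
          exact tsum_congr fun j => by ring
      _ ≤ ∑' i, ∑' j, (k i * x i ^ 2 * k j + k i * (k j * x j ^ 2)) := by
          refine ENNReal.tsum_le_tsum fun i => ENNReal.tsum_le_tsum fun j => ?_
          calc k i * k j * (2 * (x i * x j)) ≤ k i * k j * (x i ^ 2 + x j ^ 2) := by
                gcongr; exact ENNReal.two_mul_mul_le_sq_add_sq _ _
            _ = _ := by ring
      _ = _ := by
          simp_rw [ENNReal.tsum_add, ENNReal.tsum_mul_left, ENNReal.tsum_mul_right]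
          ring
  exact (ENNReal.mul_le_mul_iff_right two_ne_zero ENNReal.ofNat_ne_top).1 h2

/-- Schur's test in `ℓ²`. -/
lemma ENNReal.tsum_sq_tsum_mul_le {ι κ : Type} (k : ι → κ → ℝ≥0∞) (x : κ → ℝ≥0∞)
    {R C : ℝ≥0∞} (hR : ∀ i, ∑' j, k i j ≤ R) (hC : ∀ j, ∑' i, k i j ≤ C) :
    ∑' i, (∑' j, k i j * x j) ^ 2 ≤ R * C * ∑' j, x j ^ 2 := by
  calc ∑' i, (∑' j, k i j * x j) ^ 2 ≤ ∑' i, R * ∑' j, k i j * x j ^ 2 :=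
        ENNReal.tsum_le_tsum fun i => (ENNReal.tsum_mul_sq_le _ _).trans (by gcongr; exact hR i)
    _ = R * ∑' j, (∑' i, k i j) * x j ^ 2 := by
        rw [ENNReal.tsum_mul_left, ENNReal.tsum_comm]
        simp_rw [ENNReal.tsum_mul_right]
    _ ≤ R * ∑' j, C * x j ^ 2 := by gcongr with j; exact hC j
    _ = _ := by rw [ENNReal.tsum_mul_left, mul_assoc]

/-! ### Windows of hyperbolic secant type -/

/-- `h` is the window `x ↦ C / (e^{ax} + κ e^{-bx})` with no poles on the real line. -/
structure SechWindow (h : ℝ → ℂ) (C a b κ : ℂ) : Prop where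
  re_a_pos : 0 < a.re
  re_b_pos : 0 < b.re
  C_ne_zero : C ≠ 0
  κ_ne_zero : κ ≠ 0
  denom_ne_zero : ∀ x : ℝ, Complex.exp (a * x) + κ * Complex.exp (-b * x) ≠ 0
  apply_eq : ∀ x : ℝ, h x = C / (Complex.exp (a * x) + κ * Complex.exp (-b * x))

/-- Exponential decay of a window together with a matching Lipschitz estimate. -/
structure LocalizedWindow (h : ℝ → ℂ) (σ ρ K : ℝ) : Prop where
  σ_pos : 0 < σ
  ρ_pos : 0 < ρ
  K_pos : 0 < K
  continuous : Continuous h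
  norm_le : ∀ x, ‖h x‖ ≤ K * Real.exp (-σ * |x|)
  norm_sub_le : ∀ x y, ‖h x - h y‖ ≤
    K * (|x - y| * Real.exp (ρ * |x - y|)) * Real.exp (-σ * |y|)

lemma norm_exp_mul_ofReal (a : ℂ) (x : ℝ) : ‖Complex.exp (a * x)‖ = Real.exp (a.re * x) := by
  rw [Complex.norm_exp]; simp

lemma norm_exp_mul_ofReal_sub_le (a : ℂ) (x y : ℝ) :
    ‖Complex.exp (a * x) - Complex.exp (a * y)‖ ≤
      Real.exp (a.re * y) * (‖a‖ * |x - y| * Real.exp (‖a‖ * |x - y|)) := by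
  have e : Complex.exp (a * x) - Complex.exp (a * y) =
      Complex.exp (a * y) * (Complex.exp (a * ((x - y : ℝ) : ℂ)) - 1) := by
    rw [mul_sub, ← Complex.exp_add]; push_cast; ring_nf
  rw [e, norm_mul, norm_exp_mul_ofReal]
  gcongr
  have := Complex.norm_exp_sub_sum_le_norm_mul_exp (a * ((x - y : ℝ) : ℂ)) 1
  simpa only [Finset.range_one, Finset.sum_singleton, pow_zero, Nat.factorial_zero, Nat.cast_one,
    div_one, pow_one, norm_mul, Complex.norm_real, Real.norm_eq_abs] using this

namespace SechWindow

variable {h : ℝ → ℂ} {C a b κ : ℂ}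

lemma exists_le_norm_denom (w : SechWindow h C a b κ) :
    ∃ c : ℝ, 0 < c ∧ ∀ x : ℝ, c * (Real.exp (a.re * x) + Real.exp (-b.re * x)) ≤
      ‖Complex.exp (a * x) + κ * Complex.exp (-b * x)‖ := by
  have hκ : 0 < ‖κ‖ := norm_pos_iff.2 w.κ_ne_zero
  set S := a.re + b.re with hS
  have hSpos : 0 < S := add_pos w.re_a_pos w.re_b_pos
  set X := (2 * ‖κ‖ + 1 + 2 / ‖κ‖) / S with hX
  have hXpos : 0 < X := by positivity
  have hSX : S * X = 2 * ‖κ‖ + 1 + 2 / ‖κ‖ := by rw [hX]; field_simp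
  have n1 : ∀ x : ℝ, ‖Complex.exp (a * x)‖ = Real.exp (a.re * x) := norm_exp_mul_ofReal a
  have n2 : ∀ x : ℝ, ‖κ * Complex.exp (-b * x)‖ = ‖κ‖ * Real.exp (-b.re * x) := fun x => by
    rw [norm_mul, norm_exp_mul_ofReal]; simp
  have hcont : Continuous fun x : ℝ => ‖Complex.exp (a * x) + κ * Complex.exp (-b * x)‖ /
      (Real.exp (a.re * x) + Real.exp (-b.re * x)) := by
    refine Continuous.div (by fun_prop) (by fun_prop) fun x => by positivity
  obtain ⟨x₀, -, hx₀⟩ := (isCompact_Icc (a := -X) (b := X)).exists_isMinOn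
    ⟨0, by simp [hXpos.le]⟩ hcont.continuousOn
  set m := ‖Complex.exp (a * x₀) + κ * Complex.exp (-b * x₀)‖ /
      (Real.exp (a.re * x₀) + Real.exp (-b.re * x₀)) with hm
  have hmpos : 0 < m := div_pos (norm_pos_iff.2 (w.denom_ne_zero x₀)) (by positivity)
  refine ⟨min m (min (1 / 4) (‖κ‖ / (‖κ‖ + 2))), by positivity, fun x => ?_⟩
  have hE : 0 < Real.exp (a.re * x) + Real.exp (-b.re * x) := by positivity
  have habS : Real.exp (a.re * x) = Real.exp (S * x) * Real.exp (-b.re * x) := by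
    rw [← Real.exp_add]; congr 1; rw [hS]; ring
  have hbpos := Real.exp_pos (-b.re * x)
  have hapos := Real.exp_pos (a.re * x)
  rcases le_or_gt x X with hxX | hxX
  · rcases le_or_gt (-X) x with hxX' | hxX'
    · have := hx₀ (show x ∈ Set.Icc (-X) X from ⟨hxX', hxX⟩)
      simp only [Set.mem_ofPred_eq] at this
      rw [← hm, le_div_iff₀ hE] at this
      exact le_trans (by gcongr; exact min_le_left _ _) this
    · have h1 : Real.exp (S * x) * (2 / ‖κ‖) ≤ 1 := by
        have h2 : 2 / ‖κ‖ ≤ Real.exp (-(S * x)) := by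
          have := Real.add_one_le_exp (-(S * x))
          have h3 : S * X ≤ -(S * x) := by nlinarith
          linarith
        calc Real.exp (S * x) * (2 / ‖κ‖) ≤ Real.exp (S * x) * Real.exp (-(S * x)) := by gcongr
          _ = 1 := by rw [← Real.exp_add]; simp
      have h2 : Real.exp (a.re * x) * 2 ≤ ‖κ‖ * Real.exp (-b.re * x) := by
        rw [mul_div_assoc', div_le_one hκ] at h1
        rw [habS]; nlinarith
      have h3 : ‖κ‖ * Real.exp (-b.re * x) - Real.exp (a.re * x) ≤
          ‖Complex.exp (a * x) + κ * Complex.exp (-b * x)‖ := by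
        have := norm_sub_le_norm_add (κ * Complex.exp (-b * x)) (Complex.exp (a * x))
        rw [n1, n2, add_comm (κ * _)] at this
        exact this
      refine le_trans (b := ‖κ‖ / (‖κ‖ + 2) * (Real.exp (a.re * x) + Real.exp (-b.re * x))) ?_ ?_
      · gcongr; exact (min_le_right _ _).trans (min_le_right _ _)
      · refine le_trans ?_ h3
        rw [div_mul_eq_mul_div, div_le_iff₀ (by positivity)]
        nlinarith
  · have h1 : 2 * ‖κ‖ + 1 ≤ Real.exp (S * x) := by
      have := Real.add_one_le_exp (S * x)
      have h3 : S * X ≤ S * x := by nlinarith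
      have : 0 < 2 / ‖κ‖ := by positivity
      linarith
    have h2 : (2 * ‖κ‖ + 1) * Real.exp (-b.re * x) ≤ Real.exp (a.re * x) := by
      rw [habS]; gcongr
    have h3 : Real.exp (a.re * x) - ‖κ‖ * Real.exp (-b.re * x) ≤
        ‖Complex.exp (a * x) + κ * Complex.exp (-b * x)‖ := by
      have := norm_sub_le_norm_add (Complex.exp (a * x)) (κ * Complex.exp (-b * x))
      rw [n1, n2] at this
      exact this
    refine le_trans (b := 1 / 4 * (Real.exp (a.re * x) + Real.exp (-b.re * x))) ?_ ?_
    · gcongr; exact (min_le_right _ _).trans (min_le_left _ _)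
    · nlinarith

lemma exists_localized (w : SechWindow h C a b κ) : ∃ σ ρ K, LocalizedWindow h σ ρ K := by
  obtain ⟨c, hc, hD⟩ := w.exists_le_norm_denom
  set σ := min a.re b.re with hσ
  have hσpos : 0 < σ := lt_min w.re_a_pos w.re_b_pos
  have hexp : ∀ x : ℝ, Real.exp (σ * |x|) ≤ Real.exp (a.re * x) + Real.exp (-b.re * x) := by
    intro x
    rcases le_total 0 x with hx | hx
    · rw [abs_of_nonneg hx]
      have : Real.exp (σ * x) ≤ Real.exp (a.re * x) :=
        Real.exp_le_exp.2 (mul_le_mul_of_nonneg_right (min_le_left _ _) hx)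
      have := Real.exp_pos (-b.re * x)
      linarith
    · rw [abs_of_nonpos hx]
      have : Real.exp (σ * -x) ≤ Real.exp (-b.re * x) := by
        refine Real.exp_le_exp.2 ?_
        have := mul_le_mul_of_nonneg_right (min_le_right a.re b.re) (neg_nonneg.2 hx)
        linarith
      have := Real.exp_pos (a.re * x)
      linarith
  have hinv : ∀ x : ℝ, ‖C / (Complex.exp (a * x) + κ * Complex.exp (-b * x))‖ ≤
      ‖C‖ / c * Real.exp (-σ * |x|) := by
    intro x
    have hpos : 0 < ‖Complex.exp (a * x) + κ * Complex.exp (-b * x)‖ :=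
      norm_pos_iff.2 (w.denom_ne_zero x)
    rw [norm_div, neg_mul σ, Real.exp_neg, ← div_eq_mul_inv, div_div]
    gcongr
    exact le_trans (by gcongr; exact hexp x) (hD x)
  set M := ‖a‖ + ‖b‖ with hM
  have hMpos : 0 < M := by
    have : 0 < ‖a‖ := norm_pos_iff.2 fun h0 => by simpa [h0] using w.re_a_pos
    positivity
  have hcont : Continuous h := by
    rw [show h = fun x : ℝ => C / (Complex.exp (a * x) + κ * Complex.exp (-b * x)) from
      funext w.apply_eq]
    exact Continuous.div (by fun_prop) (by fun_prop) w.denom_ne_zero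
  have hCpos : 0 < ‖C‖ := norm_pos_iff.2 w.C_ne_zero
  refine ⟨σ, M, ‖C‖ / c * (1 + (1 + ‖κ‖) / c * M), hσpos, hMpos, by positivity, hcont,
    fun x => ?_, fun x y => ?_⟩
  · rw [w.apply_eq]
    refine (hinv x).trans ?_
    gcongr
    refine le_mul_of_one_le_right (by positivity) ?_
    have : 0 ≤ (1 + ‖κ‖) / c * M := by positivity
    linarith
  · set Dx := Complex.exp (a * x) + κ * Complex.exp (-b * x) with hDx
    set Dy := Complex.exp (a * y) + κ * Complex.exp (-b * y) with hDy
    have hxne : Dx ≠ 0 := w.denom_ne_zero x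
    have hyne : Dy ≠ 0 := w.denom_ne_zero y
    have e : h x - h y = (C / Dy) * ((Dy - Dx) / Dx) := by
      rw [w.apply_eq, w.apply_eq, ← hDx, ← hDy]; field_simp
    set t := |x - y| with ht
    have h1 : ‖Dy - Dx‖ ≤ (Real.exp (a.re * x) + ‖κ‖ * Real.exp (-b.re * x)) *
        (M * t * Real.exp (M * t)) := by
      have e2 : Dy - Dx = (Complex.exp (a * y) - Complex.exp (a * x)) +
          κ * (Complex.exp (-b * y) - Complex.exp (-b * x)) := by rw [hDx, hDy]; ring
      have b1 := norm_exp_mul_ofReal_sub_le a y x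
      have b2 := norm_exp_mul_ofReal_sub_le (-b) y x
      rw [abs_sub_comm, ← ht] at b1 b2
      rw [norm_neg, Complex.neg_re] at b2
      have ha : ‖a‖ ≤ M := by rw [hM]; linarith [norm_nonneg b]
      have hb : ‖b‖ ≤ M := by rw [hM]; linarith [norm_nonneg a]
      have ht0 : 0 ≤ t := abs_nonneg _
      calc ‖Dy - Dx‖ ≤ ‖Complex.exp (a * y) - Complex.exp (a * x)‖ +
            ‖κ‖ * ‖Complex.exp (-b * y) - Complex.exp (-b * x)‖ := by
            rw [e2, ← norm_mul]; exact norm_add_le _ _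
        _ ≤ Real.exp (a.re * x) * (M * t * Real.exp (M * t)) +
            ‖κ‖ * (Real.exp (-b.re * x) * (M * t * Real.exp (M * t))) := by
            gcongr
            · exact b1.trans (by gcongr)
            · exact b2.trans (by gcongr)
        _ = _ := by ring
    have h2 : ‖(Dy - Dx) / Dx‖ ≤ (1 + ‖κ‖) / c * M * (t * Real.exp (M * t)) := by
      rw [norm_div, div_le_iff₀ (norm_pos_iff.2 hxne)]
      have hDx' := hD x
      rw [← hDx] at hDx'
      have ht0 : 0 ≤ t := abs_nonneg _
      calc ‖Dy - Dx‖ ≤ (Real.exp (a.re * x) + ‖κ‖ * Real.exp (-b.re * x)) *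
            (M * t * Real.exp (M * t)) := h1
        _ ≤ ((1 + ‖κ‖) * (Real.exp (a.re * x) + Real.exp (-b.re * x))) *
            (M * t * Real.exp (M * t)) := by
            gcongr
            nlinarith [Real.exp_pos (a.re * x), Real.exp_pos (-b.re * x), norm_nonneg κ,
              mul_nonneg (norm_nonneg κ) (Real.exp_pos (a.re * x)).le]
        _ = (1 + ‖κ‖) / c * M * (t * Real.exp (M * t)) *
            (c * (Real.exp (a.re * x) + Real.exp (-b.re * x))) := by field_simp
        _ ≤ _ := by gcongr
    rw [e, norm_mul]
    calc ‖C / Dy‖ * ‖(Dy - Dx) / Dx‖ ≤ (‖C‖ / c * Real.exp (-σ * |y|)) *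
          ((1 + ‖κ‖) / c * M * (t * Real.exp (M * t))) := by
          gcongr
          exact hinv y
      _ = ‖C‖ / c * ((1 + ‖κ‖) / c * M) * (t * Real.exp (M * t)) * Real.exp (-σ * |y|) := by ring
      _ ≤ _ := by
          have ht0 : 0 ≤ t := abs_nonneg _
          gcongr
          linarith

end SechWindow

/-! ### Approximate dual functionals from Cauchy matrices -/

/-- The logarithmic spiral `x ↦ e^{sx}`. -/
def spiral (s : ℂ) (x : ℝ) : ℂ := Complex.exp (s * x)

lemma norm_spiral (s : ℂ) (x : ℝ) : ‖spiral s x‖ = Real.exp (s.re * x) :=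
  norm_exp_mul_ofReal s x

lemma spiral_zero (s : ℂ) : spiral s 0 = 1 := by simp [spiral]

lemma spiral_ne_zero (s : ℂ) (x : ℝ) : spiral s x ≠ 0 := Complex.exp_ne_zero _

lemma le_norm_spiral_sub_spiral {s : ℂ} (hs : 0 < s.re) {x y δ R : ℝ} (hxy : δ ≤ |x - y|)
    (hx : -R ≤ x) (hy : -R ≤ y) :
    Real.exp (-(s.re * R)) * (s.re * δ) ≤ ‖spiral s x - spiral s y‖ := by
  wlog h : y ≤ x generalizing x y
  · rw [norm_sub_rev]
    exact this (by rwa [abs_sub_comm]) hy hx (le_of_not_ge h)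
  rw [abs_of_nonneg (sub_nonneg.2 h)] at hxy
  have h1 := norm_sub_norm_le (spiral s x) (spiral s y)
  rw [norm_spiral, norm_spiral] at h1
  refine le_trans ?_ h1
  have h2 : Real.exp (s.re * x) = Real.exp (s.re * y) * Real.exp (s.re * (x - y)) := by
    rw [← Real.exp_add]; ring_nf
  have h3 := Real.add_one_le_exp (s.re * (x - y))
  have h4 : Real.exp (-(s.re * R)) ≤ Real.exp (s.re * y) := Real.exp_le_exp.2 (by nlinarith)
  have h5 : s.re * δ ≤ s.re * (x - y) := by gcongr
  have h6 : 0 ≤ s.re * (x - y) := mul_nonneg hs.le (sub_nonneg.2 h)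
  rw [h2]
  calc Real.exp (-(s.re * R)) * (s.re * δ) ≤ Real.exp (-(s.re * R)) * (s.re * (x - y)) := by gcongr
    _ ≤ Real.exp (s.re * y) * (s.re * (x - y)) := by gcongr
    _ ≤ Real.exp (s.re * y) * (Real.exp (s.re * (x - y)) - 1) := by gcongr; linarith
    _ = _ := by ring

lemma norm_spiral_int_sub_le {s : ℂ} (hs : 0 < s.re) (n : ℝ) {m : ℤ} (hm : m ≠ 0) :
    ‖spiral s n - spiral s m‖ ≤ 2 / (1 - Real.exp (-s.re)) *
      Real.exp (s.re * (max n m - max 0 (m : ℝ))) * ‖1 - spiral s m‖ := by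
  have hlt : Real.exp (-s.re) < 1 := by simpa using hs
  have hpos : 0 < 1 - Real.exp (-s.re) := by linarith
  have h1 : ‖spiral s n - spiral s m‖ ≤ 2 * Real.exp (s.re * max n m) := by
    have h0 := norm_sub_le (spiral s n) (spiral s m)
    rw [norm_spiral, norm_spiral] at h0
    have h2 : Real.exp (s.re * n) ≤ Real.exp (s.re * max n m) := by
      gcongr; exact le_max_left _ _
    have h3 : Real.exp (s.re * m) ≤ Real.exp (s.re * max n m) := by
      gcongr; exact le_max_right _ _
    linarith
  have h2 : (1 - Real.exp (-s.re)) * Real.exp (s.re * max 0 (m : ℝ)) ≤ ‖1 - spiral s m‖ := by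
    rcases lt_or_gt_of_ne hm with hm | hm
    · have hm' : (m : ℝ) ≤ -1 := by exact_mod_cast Int.le_sub_one_of_lt hm
      rw [max_eq_left (by linarith), mul_zero, Real.exp_zero, mul_one]
      have h0 := norm_sub_norm_le (1 : ℂ) (spiral s m)
      rw [norm_spiral, norm_one] at h0
      have : Real.exp (s.re * m) ≤ Real.exp (-s.re) := Real.exp_le_exp.2 (by nlinarith)
      linarith
    · have hm' : (1 : ℝ) ≤ m := by exact_mod_cast hm
      rw [max_eq_right (by linarith)]
      have h0 := norm_sub_norm_le (spiral s m) (1 : ℂ)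
      rw [norm_spiral, norm_one, norm_sub_rev] at h0
      have : 1 ≤ Real.exp (-s.re) * Real.exp (s.re * m) := by
        rw [← Real.exp_add, ← Real.exp_zero]
        exact Real.exp_le_exp.2 (by nlinarith)
      linarith
  calc ‖spiral s n - spiral s m‖ ≤ 2 * Real.exp (s.re * max n m) := h1
    _ = 2 / (1 - Real.exp (-s.re)) * Real.exp (s.re * (max n m - max 0 (m : ℝ))) *
        ((1 - Real.exp (-s.re)) * Real.exp (s.re * max 0 (m : ℝ))) := by
        rw [mul_sub, Real.exp_sub]; field_simp
    _ ≤ _ := by gcongr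

lemma sum_Ico_max_zero (J : ℕ) :
    ∑ i ∈ Finset.Ico (-(J : ℤ)) J, max (i : ℝ) 0 = J * (J - 1) / 2 := by
  induction J with
  | zero => simp
  | succ J ih =>
    have e : Finset.Ico (-((J + 1 : ℕ) : ℤ)) ((J + 1 : ℕ) : ℤ) =
        insert (-((J : ℤ) + 1)) (insert (J : ℤ) (Finset.Ico (-(J : ℤ)) J)) := by
      ext i; simp only [Finset.mem_Ico, Finset.mem_insert]; push_cast; omega
    rw [e, Finset.sum_insert (by simp), Finset.sum_insert (by simp), ih]
    have h1 : max ((-((J : ℤ) + 1) : ℤ) : ℝ) 0 = 0 := by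
      apply max_eq_right; push_cast
      have : (0 : ℝ) ≤ J := by positivity
      linarith
    have h2 : max (((J : ℤ)) : ℝ) 0 = J := by simp
    rw [h1, h2]; push_cast; ring

lemma sum_Ico_max_neg_zero (J : ℕ) :
    ∑ i ∈ Finset.Ico (-(J : ℤ)) J, max (-(i : ℝ)) 0 = J * (J + 1) / 2 := by
  induction J with
  | zero => simp
  | succ J ih =>
    have e : Finset.Ico (-((J + 1 : ℕ) : ℤ)) ((J + 1 : ℕ) : ℤ) =
        insert (-((J : ℤ) + 1)) (insert (J : ℤ) (Finset.Ico (-(J : ℤ)) J)) := by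
      ext i; simp only [Finset.mem_Ico, Finset.mem_insert]; push_cast; omega
    rw [e, Finset.sum_insert (by simp), Finset.sum_insert (by simp), ih]
    have hJ : (0 : ℝ) ≤ J := by positivity
    have h1 : max (-((-((J : ℤ) + 1) : ℤ) : ℝ)) 0 = J + 1 := by
      rw [max_eq_left] <;> push_cast <;> linarith
    have h2 : max (-(((J : ℤ)) : ℝ)) 0 = 0 := by
      apply max_eq_right; push_cast; linarith
    rw [h1, h2]; push_cast; ring

/-- The exponent balance behind the smallness of the dual functional: each block of length `M`
carries `M` nodes and `M + 1` sampling points. -/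
lemma block_exponent_le {J M : ℕ} (hM : 1 ≤ M) {n : ℤ} (hn : (J * M : ℤ) ≤ n ∨ n < -(J * M : ℤ))
    (x : ℤ × Fin (M + 1) → ℝ)
    (hx : ∀ p, x p ∈ Set.Ico ((p.1 : ℝ) * M) (((p.1 : ℝ) + 1) * M)) :
    (n : ℝ) * J + ∑ i ∈ Finset.Ico (-(J : ℤ)) J, (∑ l ∈ Finset.range M,
        (max (n : ℝ) ((i * M + l : ℤ) : ℝ) - max 0 ((i * M + l : ℤ) : ℝ)) +
      ∑ l : Fin (M + 1), (max 0 (x (i, l)) - max (n : ℝ) (x (i, l)))) ≤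
    -(|(n : ℝ)| * J / 2) + 2 * |(n : ℝ)| * (M + 1) := by
  have hM' : (1 : ℝ) ≤ M := by exact_mod_cast hM
  have hJ0 : (0 : ℝ) ≤ J := by positivity
  have hcard : ((Finset.Ico (-(J : ℤ)) J).card : ℝ) = 2 * J := by
    rw [Int.card_Ico]
    have : ((J : ℤ) - -(J : ℤ)).toNat = 2 * J := by omega
    rw [this]; push_cast; ring
  rcases hn with hn | hn
  · have hn' : (J : ℝ) * M ≤ n := by exact_mod_cast hn
    have hn0 : (0 : ℝ) ≤ n := le_trans (by positivity) hn'
    have key : ∀ i ∈ Finset.Ico (-(J : ℤ)) J, (∑ l ∈ Finset.range M,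
        (max (n : ℝ) ((i * M + l : ℤ) : ℝ) - max 0 ((i * M + l : ℤ) : ℝ)) +
      ∑ l : Fin (M + 1), (max 0 (x (i, l)) - max (n : ℝ) (x (i, l)))) ≤
        -(n : ℝ) + M * (M + 1) + M * max (i : ℝ) 0 := by
      intro i hi
      obtain ⟨hi1, hi2⟩ := Finset.mem_Ico.1 hi
      have hi2' : (i : ℝ) + 1 ≤ J := by exact_mod_cast hi2
      have b1 : ∑ l ∈ Finset.range M,
          (max (n : ℝ) ((i * M + l : ℤ) : ℝ) - max 0 ((i * M + l : ℤ) : ℝ)) ≤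
          ∑ l ∈ Finset.range M, ((n : ℝ) - M * max (i : ℝ) 0) := by
        refine Finset.sum_le_sum fun l hl => ?_
        have hl' : (l : ℝ) + 1 ≤ M := by exact_mod_cast Finset.mem_range.1 hl
        have hl0 : (0 : ℝ) ≤ l := by positivity
        push_cast
        have u1 : max (n : ℝ) ((i : ℝ) * M + l) = n := max_eq_left (by nlinarith)
        rw [u1]
        have : (M : ℝ) * max (i : ℝ) 0 ≤ max 0 ((i : ℝ) * M + l) := by
          rw [mul_max_of_nonneg _ _ (by positivity), mul_zero, max_comm]
          exact max_le_max le_rfl (by nlinarith)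
        linarith
      have b2 : ∑ l : Fin (M + 1), (max 0 (x (i, l)) - max (n : ℝ) (x (i, l))) ≤
          ∑ l : Fin (M + 1), (M * max (i : ℝ) 0 + M - n) := by
        refine Finset.sum_le_sum fun l _ => ?_
        obtain ⟨x1, x2⟩ := hx (i, l)
        simp only at x1 x2
        have u1 : (n : ℝ) ≤ max (n : ℝ) (x (i, l)) := le_max_left _ _
        have : max 0 (x (i, l)) ≤ M * max (i : ℝ) 0 + M := by
          have := le_max_left (i : ℝ) 0
          have := le_max_right (i : ℝ) 0
          refine max_le (by positivity) ?_
          nlinarith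
        linarith
      rw [Finset.sum_const, Finset.card_range, nsmul_eq_mul] at b1
      rw [Finset.sum_const, Finset.card_univ, Fintype.card_fin, nsmul_eq_mul] at b2
      push_cast at b2
      nlinarith
    have hsum := (Finset.sum_le_sum key).trans_eq (c := 2 * J * (-(n : ℝ) + M * (M + 1)) +
      M * (J * (J - 1) / 2)) (by
        rw [Finset.sum_add_distrib, Finset.sum_const, ← Finset.mul_sum, sum_Ico_max_zero,
          nsmul_eq_mul, hcard])
    rw [abs_of_nonneg hn0]
    have e1 : J * (J * M) ≤ (J : ℝ) * n := by gcongr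
    have e2 : (M + 1) * (J * M) ≤ ((M : ℝ) + 1) * n := by gcongr
    have e3 : 0 ≤ (M : ℝ) * J := by positivity
    nlinarith
  · have hn' : (n : ℝ) < -(J * M) := by exact_mod_cast hn
    have hJM : 0 ≤ (J : ℝ) * M := by positivity
    have hn0 : (n : ℝ) ≤ 0 := by linarith
    have key : ∀ i ∈ Finset.Ico (-(J : ℤ)) J, (∑ l ∈ Finset.range M,
        (max (n : ℝ) ((i * M + l : ℤ) : ℝ) - max 0 ((i * M + l : ℤ) : ℝ)) +
      ∑ l : Fin (M + 1), (max 0 (x (i, l)) - max (n : ℝ) (x (i, l)))) ≤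
        (M : ℝ) * M + M * max (-(i : ℝ)) 0 := by
      intro i hi
      obtain ⟨hi1, hi2⟩ := Finset.mem_Ico.1 hi
      have hi1' : -(J : ℝ) ≤ i := by exact_mod_cast hi1
      have mx : ∀ y : ℝ, y - max 0 y = - max (-y) 0 := by
        intro y
        rcases le_total 0 y with h | h
        · rw [max_eq_right h, max_eq_right (by linarith)]; ring
        · rw [max_eq_left h, max_eq_left (by linarith)]; ring
      have hmi := le_max_left (-(i : ℝ)) 0
      have hmi0 := le_max_right (-(i : ℝ)) 0
      have b1 : ∑ l ∈ Finset.range M,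
          (max (n : ℝ) ((i * M + l : ℤ) : ℝ) - max 0 ((i * M + l : ℤ) : ℝ)) ≤
          ∑ l ∈ Finset.range M, ((M : ℝ) - M * max (-(i : ℝ)) 0) := by
        refine Finset.sum_le_sum fun l hl => ?_
        have hl' : (l : ℝ) + 1 ≤ M := by exact_mod_cast Finset.mem_range.1 hl
        have hl0 : (0 : ℝ) ≤ l := by positivity
        push_cast
        have u1 : max (n : ℝ) ((i : ℝ) * M + l) = (i : ℝ) * M + l := max_eq_right (by nlinarith)
        rw [u1, mx]
        have : (M : ℝ) * max (-(i : ℝ)) 0 ≤ M + max (-((i : ℝ) * M + l)) 0 := by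
          rw [mul_max_of_nonneg _ _ (by positivity), mul_zero]
          refine max_le ?_ ?_
          · have := le_max_left (-((i : ℝ) * M + l)) 0
            nlinarith
          · have := le_max_right (-((i : ℝ) * M + l)) 0
            linarith
        linarith
      have b2 : ∑ l : Fin (M + 1), (max 0 (x (i, l)) - max (n : ℝ) (x (i, l))) ≤
          ∑ l : Fin (M + 1), (M * max (-(i : ℝ)) 0) := by
        refine Finset.sum_le_sum fun l _ => ?_
        obtain ⟨x1, x2⟩ := hx (i, l)
        simp only at x1 x2
        have u1 : max (n : ℝ) (x (i, l)) = x (i, l) := max_eq_right (by nlinarith)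
        have : max (-x (i, l)) 0 ≤ M * max (-(i : ℝ)) 0 := by
          refine max_le ?_ (by positivity)
          nlinarith
        rw [u1]
        linarith [mx (x (i, l))]
      rw [Finset.sum_const, Finset.card_range, nsmul_eq_mul] at b1
      rw [Finset.sum_const, Finset.card_univ, Fintype.card_fin, nsmul_eq_mul] at b2
      push_cast at b2
      nlinarith
    have hsum := (Finset.sum_le_sum key).trans_eq (c := 2 * J * ((M : ℝ) * M) +
      M * (J * (J + 1) / 2)) (by
        rw [Finset.sum_add_distrib, Finset.sum_const, ← Finset.mul_sum, sum_Ico_max_neg_zero,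
          nsmul_eq_mul, hcard])
    rw [abs_of_nonpos hn0]
    have e1 : J * (J * M) ≤ (J : ℝ) * -n := by gcongr; linarith
    have e2 : (M + 1) * (J * M) ≤ ((M : ℝ) + 1) * -n := by gcongr; linarith
    have e3 : 0 ≤ (M : ℝ) * J := by positivity
    nlinarith

/-- The polynomial vanishing to order `J` at the origin and at the nodes `κ e^{sm}` with
`-JM ≤ m < JM`, `m ≠ 0`. -/
def nodePoly (κ s : ℂ) (J M : ℕ) : Polynomial ℂ :=
  Polynomial.X ^ J * ∏ p ∈ (Finset.Ico (-(J : ℤ)) J ×ˢ Finset.range M).erase (0, 0),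
    (Polynomial.X - Polynomial.C (κ * spiral s ((p.1 * M + p.2 : ℤ) : ℝ)))

lemma eval_nodePoly (κ s : ℂ) (J M : ℕ) (y : ℂ) :
    (nodePoly κ s J M).eval y = y ^ J *
      ∏ p ∈ (Finset.Ico (-(J : ℤ)) J ×ˢ Finset.range M).erase (0, 0),
        (y - κ * spiral s ((p.1 * M + p.2 : ℤ) : ℝ)) := by
  simp [nodePoly, Polynomial.eval_prod]

lemma card_Ico_neg_product_range (J M : ℕ) :
    (Finset.Ico (-(J : ℤ)) J ×ˢ Finset.range M).card = 2 * J * M := by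
  rw [Finset.card_product, Int.card_Ico, Finset.card_range]
  congr 1; omega

lemma degree_nodePoly_lt (κ s : ℂ) {J : ℕ} (hJ : 0 < J) (M : ℕ) :
    (nodePoly κ s J M).degree <
      (Finset.Ico (-(J : ℤ)) J ×ˢ (Finset.univ : Finset (Fin (M + 1)))).card := by
  refine Polynomial.degree_le_natDegree.trans_lt ?_
  have h1 : (nodePoly κ s J M).natDegree ≤ J + 2 * J * M := by
    refine Polynomial.natDegree_mul_le.trans ?_
    rw [Polynomial.natDegree_X_pow, Polynomial.natDegree_finsetProd_X_sub_C_eq_card]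
    have := Finset.card_le_card (Finset.erase_subset ((0 : ℤ), 0)
      (Finset.Ico (-(J : ℤ)) J ×ˢ Finset.range M))
    rw [card_Ico_neg_product_range] at this
    omega
  have h2 : (Finset.Ico (-(J : ℤ)) J ×ˢ (Finset.univ : Finset (Fin (M + 1)))).card =
      2 * J * (M + 1) := by
    rw [Finset.card_product, Int.card_Ico, Finset.card_univ, Fintype.card_fin]
    congr 1; omega
  rw [h2]
  have : (nodePoly κ s J M).natDegree < 2 * J * (M + 1) := by nlinarith
  exact_mod_cast this

lemma block_index_ne_zero {M : ℕ} {p : ℤ × ℕ} (hp : p.2 < M) (h0 : p ≠ (0, 0)) :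
    (p.1 * M + p.2 : ℤ) ≠ 0 := by
  intro h
  apply h0
  have h1 : p.1 = 0 := by
    rcases lt_trichotomy p.1 0 with h' | h' | h'
    · nlinarith
    · exact h'
    · nlinarith
  ext
  · exact h1
  · rw [h1] at h; simpa using h

namespace SechWindow

variable {h : ℝ → ℂ} {C a b κ : ℂ}

lemma re_add_pos (w : SechWindow h C a b κ) : 0 < (a + b).re := by
  rw [Complex.add_re]; exact add_pos w.re_a_pos w.re_b_pos

lemma spiral_add_eq (x y : ℝ) : spiral (a + b) x + κ * spiral (a + b) y =
    Complex.exp (b * (x - y : ℝ)) * spiral (a + b) y *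
      (Complex.exp (a * (x - y : ℝ)) + κ * Complex.exp (-b * (x - y : ℝ))) := by
  simp only [spiral, mul_add]
  rw [mul_left_comm _ κ, ← Complex.exp_add, ← Complex.exp_add, ← Complex.exp_add]
  push_cast
  ring_nf

lemma spiral_add_ne_zero (w : SechWindow h C a b κ) (x y : ℝ) :
    spiral (a + b) x + κ * spiral (a + b) y ≠ 0 := by
  rw [spiral_add_eq]
  exact mul_ne_zero (mul_ne_zero (Complex.exp_ne_zero _) (spiral_ne_zero _ _))
    (w.denom_ne_zero _)

lemma apply_sub_int (w : SechWindow h C a b κ) (x : ℝ) (n : ℤ) :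
    h (x - n) = C * Complex.exp (b * x) * Complex.exp (a * n) /
      (spiral (a + b) x + κ * spiral (a + b) n) := by
  rw [w.apply_eq, spiral_add_eq, div_eq_div_iff (w.denom_ne_zero _)]
  · have : Complex.exp (b * x) * Complex.exp (a * n) =
        Complex.exp (b * (x - n : ℝ)) * spiral (a + b) n := by
      simp only [spiral]
      rw [← Complex.exp_add, ← Complex.exp_add]; push_cast; ring_nf
    linear_combination (-C * (Complex.exp (a * (x - n : ℝ)) +
      κ * Complex.exp (-b * (x - n : ℝ)))) * this
  · exact mul_ne_zero (mul_ne_zero (Complex.exp_ne_zero _) (spiral_ne_zero _ _))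
      (w.denom_ne_zero _)

lemma exists_le_norm_spiral_add (w : SechWindow h C a b κ) :
    ∃ c : ℝ, 0 < c ∧ ∀ x y : ℝ, c * Real.exp ((a + b).re * max y x) ≤
      ‖spiral (a + b) x + κ * spiral (a + b) y‖ := by
  obtain ⟨c, hc, hD⟩ := w.exists_le_norm_denom
  refine ⟨c, hc, fun x y => ?_⟩
  rw [spiral_add_eq, norm_mul, norm_mul, norm_exp_mul_ofReal, norm_spiral]
  refine le_trans ?_ (mul_le_mul_of_nonneg_left (hD (x - y)) (by positivity))
  have e : Real.exp (b.re * (x - y)) * Real.exp ((a + b).re * y) *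
      (c * (Real.exp (a.re * (x - y)) + Real.exp (-b.re * (x - y)))) =
      c * (Real.exp ((a + b).re * x) + Real.exp ((a + b).re * y)) := by
    have e1 : Real.exp (b.re * (x - y)) * Real.exp ((a + b).re * y) * Real.exp (a.re * (x - y)) =
        Real.exp ((a + b).re * x) := by
      rw [← Real.exp_add, ← Real.exp_add, Complex.add_re]; ring_nf
    have e2 : Real.exp (b.re * (x - y)) * Real.exp ((a + b).re * y) * Real.exp (-b.re * (x - y)) =
        Real.exp ((a + b).re * y) := by
      rw [← Real.exp_add, ← Real.exp_add, Complex.add_re]; ring_nf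
    linear_combination c * e1 + c * e2
  rw [e]
  gcongr
  have h1 := Real.exp_pos ((a + b).re * x)
  have h2 := Real.exp_pos ((a + b).re * y)
  rcases max_choice y x with h' | h' <;> rw [h'] <;> linarith

lemma exists_norm_spiral_add_le (w : SechWindow h C a b κ) :
    ∃ K : ℝ, 0 < K ∧ ∀ x n : ℝ, ‖spiral (a + b) x + κ‖ ≤
      K * Real.exp ((a + b).re * (max 0 x - max n x)) *
        ‖spiral (a + b) x + κ * spiral (a + b) n‖ := by
  obtain ⟨c, hc, hD⟩ := w.exists_le_norm_spiral_add
  have hS := w.re_add_pos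
  refine ⟨(1 + ‖κ‖) / c, by positivity, fun x n => ?_⟩
  have h1 : ‖spiral (a + b) x + κ‖ ≤ (1 + ‖κ‖) * Real.exp ((a + b).re * max 0 x) := by
    refine (norm_add_le _ _).trans ?_
    rw [norm_spiral]
    have h2 : Real.exp ((a + b).re * x) ≤ Real.exp ((a + b).re * max 0 x) := by
      gcongr; exact le_max_right _ _
    have h3 : 1 ≤ Real.exp ((a + b).re * max 0 x) :=
      Real.one_le_exp (mul_nonneg hS.le (le_max_left _ _))
    nlinarith [norm_nonneg κ]
  calc ‖spiral (a + b) x + κ‖ ≤ (1 + ‖κ‖) * Real.exp ((a + b).re * max 0 x) := h1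
    _ = (1 + ‖κ‖) / c * Real.exp ((a + b).re * (max 0 x - max n x)) *
        (c * Real.exp ((a + b).re * max n x)) := by
        rw [mul_sub, Real.exp_sub]; field_simp
    _ ≤ _ := by gcongr; exact hD x n

/-- Cauchy interpolation: the partial fraction expansion of `nodePoly / ∏ (z_p + ·)`. -/
lemma sum_nodalWeight_mul_apply (w : SechWindow h C a b κ) {J : ℕ} (hJ : 0 < J) (M : ℕ)
    {x : ℤ × Fin (M + 1) → ℝ} (hx : Function.Injective fun p => spiral (a + b) (x p)) (n : ℤ) :
    ∑ p ∈ Finset.Ico (-(J : ℤ)) J ×ˢ (Finset.univ : Finset (Fin (M + 1))),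
      Lagrange.nodalWeight (Finset.Ico (-(J : ℤ)) J ×ˢ Finset.univ)
        (fun p => -spiral (a + b) (x p)) p *
        (nodePoly κ (a + b) J M).eval (-spiral (a + b) (x p)) *
        (C * Complex.exp (b * x p))⁻¹ * h (x p - n) =
    Complex.exp (a * n) * ((nodePoly κ (a + b) J M).eval (κ * spiral (a + b) n) /
      ∏ p ∈ Finset.Ico (-(J : ℤ)) J ×ˢ (Finset.univ : Finset (Fin (M + 1))),
        (spiral (a + b) (x p) + κ * spiral (a + b) n)) := by
  set s := Finset.Ico (-(J : ℤ)) J ×ˢ (Finset.univ : Finset (Fin (M + 1))) with hs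
  set v : ℤ × Fin (M + 1) → ℂ := fun p => -spiral (a + b) (x p) with hv
  set P := nodePoly κ (a + b) J M with hP
  have hinj : Set.InjOn v s := fun p _ p' _ hpp => hx (by simpa [hv] using hpp)
  have hne : ∀ p ∈ s, κ * spiral (a + b) n ≠ v p := fun p _ hp =>
    w.spiral_add_ne_zero (x p) n (by rw [hp]; simp [hv])
  have h1 := Lagrange.eval_interpolate_not_at_node (s := s) (v := v) (x := κ * spiral (a + b) n)
    (fun p => P.eval (v p)) hne
  rw [← Lagrange.eq_interpolate hinj (degree_nodePoly_lt κ (a + b) hJ M), ← hP,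
    Lagrange.eval_nodal] at h1
  have e : ∏ p ∈ s, (spiral (a + b) (x p) + κ * spiral (a + b) n) =
      ∏ p ∈ s, (κ * spiral (a + b) n - v p) :=
    Finset.prod_congr rfl fun p _ => by simp only [hv]; ring
  have hprod : ∏ p ∈ s, (κ * spiral (a + b) n - v p) ≠ 0 :=
    Finset.prod_ne_zero_iff.2 fun p hp => sub_ne_zero.2 (hne p hp)
  rw [e, h1, mul_div_cancel_left₀ _ hprod, Finset.mul_sum]
  refine Finset.sum_congr rfl fun p hp => ?_
  rw [w.apply_sub_int]
  have hd := w.spiral_add_ne_zero (x p) n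
  have e2 : κ * spiral (a + b) n - v p = spiral (a + b) (x p) + κ * spiral (a + b) n := by
    simp only [hv]; ring
  rw [e2]
  have := w.C_ne_zero
  have := Complex.exp_ne_zero (b * x p)
  simp only [hv]
  field_simp

lemma eval_nodePoly_eq_zero {J M : ℕ} (hM : 1 ≤ M) (s : ℂ) {n : ℤ} (h0 : n ≠ 0)
    (h1 : -(J * M : ℤ) ≤ n) (h2 : n < J * M) :
    (nodePoly κ s J M).eval (κ * spiral s n) = 0 := by
  have hMpos : (0 : ℤ) < M := by exact_mod_cast hM
  rw [eval_nodePoly]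
  refine mul_eq_zero_of_right _ (Finset.prod_eq_zero (i := (n / M, (n % M).toNat)) ?_ ?_)
  · have hmod := Int.emod_nonneg n hMpos.ne'
    have hmod' := Int.emod_lt_of_pos n hMpos
    rw [Finset.mem_erase, Finset.mem_product, Finset.mem_Ico, Finset.mem_range]
    refine ⟨fun hc => h0 ?_, ⟨?_, ?_⟩, by omega⟩
    · rw [Prod.mk.injEq] at hc
      have := Int.mul_ediv_add_emod n M
      rw [hc.1] at this
      omega
    · exact Int.le_ediv_of_mul_le hMpos (by linarith)
    · exact Int.ediv_lt_of_lt_mul hMpos h2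
  · have hmod := Int.emod_nonneg n hMpos.ne'
    have e : (n / M * M + ((n % M).toNat : ℤ) : ℤ) = n := by
      rw [Int.toNat_of_nonneg hmod]; exact Int.ediv_mul_add_emod n M
    simp only [e, sub_self]

lemma eval_nodePoly_self_ne_zero (w : SechWindow h C a b κ) (J M : ℕ) :
    (nodePoly κ (a + b) J M).eval κ ≠ 0 := by
  rw [eval_nodePoly]
  refine mul_ne_zero (pow_ne_zero _ w.κ_ne_zero) (Finset.prod_ne_zero_iff.2 fun p hp => ?_)
  rw [Finset.mem_erase, Finset.mem_product, Finset.mem_range] at hp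
  have hm := block_index_ne_zero hp.2.2 hp.1
  intro hc
  have h1 : (1 : ℂ) - spiral (a + b) ((p.1 * M + p.2 : ℤ) : ℝ) = 0 := by
    have : κ * (1 - spiral (a + b) ((p.1 * M + p.2 : ℤ) : ℝ)) = 0 := by rw [← hc]; ring
    exact (mul_eq_zero.1 this).resolve_left w.κ_ne_zero
  have h2 : Real.exp ((a + b).re * ((p.1 * M + p.2 : ℤ) : ℝ)) = 1 := by
    rw [← norm_spiral, ← sub_eq_zero.1 h1, norm_one]
  rw [Real.exp_eq_one_iff, mul_eq_zero] at h2
  rcases h2 with h2 | h2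
  · exact w.re_add_pos.ne' h2
  · exact hm (by exact_mod_cast h2)

end SechWindow

namespace SechWindow

variable {h : ℝ → ℂ} {C a b κ : ℂ}

lemma exists_norm_dualError_le (w : SechWindow h C a b κ) :
    ∃ L : ℝ, 0 ≤ L ∧ ∀ (J M : ℕ) (_ : 1 ≤ M) (n : ℤ)
      (_ : (J * M : ℤ) ≤ n ∨ n < -(J * M : ℤ)) (x : ℤ × Fin (M + 1) → ℝ)
      (_ : ∀ p, x p ∈ Set.Ico ((p.1 : ℝ) * M) (((p.1 : ℝ) + 1) * M)),
      ‖Complex.exp (a * n) * ((nodePoly κ (a + b) J M).eval (κ * spiral (a + b) n) /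
        ∏ p ∈ Finset.Ico (-(J : ℤ)) J ×ˢ (Finset.univ : Finset (Fin (M + 1))),
          (spiral (a + b) (x p) + κ * spiral (a + b) n)) *
        ((∏ p ∈ Finset.Ico (-(J : ℤ)) J ×ˢ (Finset.univ : Finset (Fin (M + 1))),
          (spiral (a + b) (x p) + κ)) / (nodePoly κ (a + b) J M).eval κ)‖ ≤
      Real.exp (|(n : ℝ)| * (|a.re| + L + 2 * (a + b).re * (M + 1) - (a + b).re * J / 2)) := by
  obtain ⟨K₀, hK₀, hK⟩ := w.exists_norm_spiral_add_le
  set S := (a + b).re with hS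
  have hSpos : 0 < S := w.re_add_pos
  set L := max 0 (max (Real.log K₀) (Real.log (2 / (1 - Real.exp (-S))))) with hL
  have hL0 : 0 ≤ L := le_max_left _ _
  have hlt : Real.exp (-S) < 1 := by simpa using hSpos
  have hK1 : K₀ ≤ Real.exp L := by
    rw [← Real.exp_log hK₀]
    exact Real.exp_le_exp.2 ((le_max_left _ _).trans (le_max_right _ _))
  have hK2 : 2 / (1 - Real.exp (-S)) ≤ Real.exp L := by
    have : 0 < 2 / (1 - Real.exp (-S)) := div_pos two_pos (by linarith)
    rw [← Real.exp_log this]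
    exact Real.exp_le_exp.2 ((le_max_right _ _).trans (le_max_right _ _))
  refine ⟨6 * L, by positivity, fun J M hM n hn x hx => ?_⟩
  set s := Finset.Ico (-(J : ℤ)) J ×ˢ (Finset.univ : Finset (Fin (M + 1))) with hs
  set T := Finset.Ico (-(J : ℤ)) J ×ˢ Finset.range M with hT
  set t : ℤ × ℕ → ℝ := fun p =>
    max (n : ℝ) ((p.1 * M + p.2 : ℤ) : ℝ) - max 0 ((p.1 * M + p.2 : ℤ) : ℝ) with ht
  set t' : ℤ × Fin (M + 1) → ℝ := fun p => max 0 (x p) - max (n : ℝ) (x p) with ht'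
  have hN : ‖(nodePoly κ (a + b) J M).eval (κ * spiral (a + b) n)‖ ≤
      Real.exp (S * (n * J) + ∑ p ∈ T, (L + S * t p)) *
        ‖(nodePoly κ (a + b) J M).eval κ‖ := by
    rw [eval_nodePoly, eval_nodePoly, norm_mul, norm_mul, norm_prod, norm_prod, norm_pow,
      norm_mul, mul_pow, norm_spiral, ← Real.exp_nat_mul, norm_pow, Real.exp_add]
    have h1 : ∏ p ∈ T.erase (0, 0),
        ‖κ * spiral (a + b) n - κ * spiral (a + b) ((p.1 * M + p.2 : ℤ) : ℝ)‖ ≤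
        Real.exp (∑ p ∈ T, (L + S * t p)) *
          ∏ p ∈ T.erase (0, 0), ‖κ - κ * spiral (a + b) ((p.1 * M + p.2 : ℤ) : ℝ)‖ := by
      have h2 : ∏ p ∈ T.erase (0, 0),
          ‖κ * spiral (a + b) n - κ * spiral (a + b) ((p.1 * M + p.2 : ℤ) : ℝ)‖ ≤
          ∏ p ∈ T.erase (0, 0), (Real.exp (L + S * t p) *
            ‖κ - κ * spiral (a + b) ((p.1 * M + p.2 : ℤ) : ℝ)‖) := by
        refine Finset.prod_le_prod (fun _ _ => norm_nonneg _) fun p hp => ?_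
        rw [hT, Finset.mem_erase, Finset.mem_product, Finset.mem_range] at hp
        have h3 := norm_spiral_int_sub_le w.re_add_pos n (block_index_ne_zero hp.2.2 hp.1)
        have e : κ - κ * spiral (a + b) ((p.1 * M + p.2 : ℤ) : ℝ) =
          κ * (1 - spiral (a + b) ((p.1 * M + p.2 : ℤ) : ℝ)) := by ring
        rw [← mul_sub, e, norm_mul, norm_mul, mul_left_comm, Real.exp_add]
        refine mul_le_mul_of_nonneg_left (h3.trans ?_) (norm_nonneg _)
        gcongr
      refine h2.trans ?_
      rw [Finset.prod_mul_distrib, ← Real.exp_sum]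
      refine mul_le_mul_of_nonneg_right (Real.exp_le_exp.2 ?_)
        (Finset.prod_nonneg fun _ _ => norm_nonneg _)
      refine Finset.sum_le_sum_of_subset_of_nonneg (Finset.erase_subset _ _) fun p hp hp' => ?_
      have : p = (0, 0) := by
        by_contra hne
        exact hp' (Finset.mem_erase.2 ⟨hne, hp⟩)
      subst this
      have : 0 ≤ t (0, 0) := by simp [ht]
      positivity
    calc _ ≤ ‖κ‖ ^ J * Real.exp (J * (S * n)) * (Real.exp (∑ p ∈ T, (L + S * t p)) *
          ∏ p ∈ T.erase (0, 0), ‖κ - κ * spiral (a + b) ((p.1 * M + p.2 : ℤ) : ℝ)‖) := by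
          gcongr
      _ = _ := by
          rw [show (J : ℝ) * (S * n) = S * (n * J) by ring]; ring
  have hD : ‖∏ p ∈ s, (spiral (a + b) (x p) + κ)‖ ≤
      Real.exp (∑ p ∈ s, (L + S * t' p)) *
        ‖∏ p ∈ s, (spiral (a + b) (x p) + κ * spiral (a + b) n)‖ := by
    rw [norm_prod, norm_prod, Real.exp_sum, ← Finset.prod_mul_distrib]
    refine Finset.prod_le_prod (fun _ _ => norm_nonneg _) fun p hp => (hK (x p) n).trans ?_
    rw [Real.exp_add]
    gcongr
  have hP0 : 0 < ‖(nodePoly κ (a + b) J M).eval κ‖ :=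
    norm_pos_iff.2 (w.eval_nodePoly_self_ne_zero J M)
  have hQ0 : 0 < ‖∏ p ∈ s, (spiral (a + b) (x p) + κ * spiral (a + b) n)‖ :=
    norm_pos_iff.2 (Finset.prod_ne_zero_iff.2 fun p _ => w.spiral_add_ne_zero (x p) n)
  have hE := block_exponent_le hM hn x hx
  have hsumT : ∑ p ∈ T, t p + ∑ p ∈ s, t' p =
      ∑ i ∈ Finset.Ico (-(J : ℤ)) J, (∑ l ∈ Finset.range M, t (i, l) +
        ∑ l : Fin (M + 1), t' (i, l)) := by
    rw [hT, hs, Finset.sum_product, Finset.sum_product, Finset.sum_add_distrib]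
  have hcT : (T.card : ℝ) = 2 * J * M := by
    rw [hT, card_Ico_neg_product_range]; push_cast; ring
  have hcs : (s.card : ℝ) = 2 * J * (M + 1) := by
    have : s.card = 2 * J * (M + 1) := by
      rw [hs, Finset.card_product, Int.card_Ico, Finset.card_univ, Fintype.card_fin]
      congr 1; omega
    rw [this]; push_cast; ring
  have hM' : (1 : ℝ) ≤ M := by exact_mod_cast hM
  have hnJ : (J : ℝ) * M ≤ |(n : ℝ)| := by
    rcases hn with hn | hn
    · exact le_trans (by exact_mod_cast hn) (le_abs_self _)
    · refine le_trans ?_ (neg_le_abs _)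
      have : (n : ℝ) < -(J * M) := by exact_mod_cast hn
      linarith
  rw [norm_mul, norm_mul, norm_div, norm_div]
  have hexp : ‖Complex.exp (a * n)‖ = Real.exp (a.re * n) := by
    have := norm_exp_mul_ofReal a n
    push_cast at this; exact this
  rw [hexp]
  calc _ ≤ Real.exp (a.re * n) * ((Real.exp (S * (n * J) + ∑ p ∈ T, (L + S * t p)) *
        ‖(nodePoly κ (a + b) J M).eval κ‖) /
        ‖∏ p ∈ s, (spiral (a + b) (x p) + κ * spiral (a + b) n)‖) *
        ((Real.exp (∑ p ∈ s, (L + S * t' p)) *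
        ‖∏ p ∈ s, (spiral (a + b) (x p) + κ * spiral (a + b) n)‖) /
        ‖(nodePoly κ (a + b) J M).eval κ‖) := by
        gcongr
    _ = Real.exp (a.re * n + (S * (n * J) + ∑ p ∈ T, (L + S * t p)) +
        ∑ p ∈ s, (L + S * t' p)) := by
        rw [Real.exp_add (a.re * n + _), Real.exp_add (a.re * n)]
        field_simp
    _ ≤ _ := by
        refine Real.exp_le_exp.2 ?_
        rw [Finset.sum_add_distrib, Finset.sum_add_distrib, ← Finset.mul_sum, ← Finset.mul_sum,
          Finset.sum_const, Finset.sum_const, nsmul_eq_mul, nsmul_eq_mul, hcT, hcs]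
        have h1 : a.re * n ≤ |(n : ℝ)| * |a.re| := by
          rw [mul_comm, ← abs_mul]; exact le_abs_self _
        have h2 : S * (n * J + (∑ p ∈ T, t p + ∑ p ∈ s, t' p)) ≤
            S * (-(|(n : ℝ)| * J / 2) + 2 * |(n : ℝ)| * (M + 1)) := by
          rw [hsumT]; gcongr
        have h3 : (2 * J * M + 2 * J * (M + 1)) * L ≤ 6 * |(n : ℝ)| * L := by
          gcongr
          have : (0 : ℝ) ≤ J := by positivity
          nlinarith
        nlinarith

lemma spiral_injective {s : ℂ} (hs : 0 < s.re) : Function.Injective (spiral s) := by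
  intro x y hxy
  have : Real.exp (s.re * x) = Real.exp (s.re * y) := by rw [← norm_spiral, hxy, norm_spiral]
  exact mul_left_cancel₀ hs.ne' (Real.exp_injective this)

lemma exists_norm_dualCoeff_le (w : SechWindow h C a b κ) (J M : ℕ) {δ : ℝ} (hδ : 0 < δ) :
    ∃ B : ℝ, 0 ≤ B ∧ ∀ (x : ℤ × Fin (M + 1) → ℝ) (_ : SeparatedFamily δ x)
      (_ : ∀ p, x p ∈ Set.Ico ((p.1 : ℝ) * M) (((p.1 : ℝ) + 1) * M)),
      ∀ p ∈ Finset.Ico (-(J : ℤ)) J ×ˢ (Finset.univ : Finset (Fin (M + 1))),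
      ‖Lagrange.nodalWeight (Finset.Ico (-(J : ℤ)) J ×ˢ Finset.univ)
        (fun p => -spiral (a + b) (x p)) p *
        (nodePoly κ (a + b) J M).eval (-spiral (a + b) (x p)) *
        (C * Complex.exp (b * x p))⁻¹ *
        ((∏ p ∈ Finset.Ico (-(J : ℤ)) J ×ˢ (Finset.univ : Finset (Fin (M + 1))),
          (spiral (a + b) (x p) + κ)) / (nodePoly κ (a + b) J M).eval κ)‖ ≤ B := by
  set S := (a + b).re with hS
  have hSpos : 0 < S := w.re_add_pos
  set R : ℝ := J * M with hR
  set s := Finset.Ico (-(J : ℤ)) J ×ˢ (Finset.univ : Finset (Fin (M + 1))) with hs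
  set c := Real.exp (-(S * R)) * (S * δ) with hc
  have hcpos : 0 < c := by positivity
  obtain ⟨B₁, hB₁⟩ := (isCompact_closedBall (0 : ℂ) (Real.exp (S * R))).exists_bound_of_continuousOn
    (nodePoly κ (a + b) J M).continuous.continuousOn
  have hB₁0 : 0 ≤ B₁ := (norm_nonneg _).trans (hB₁ 0 (by simp; positivity))
  have hP0 : 0 < ‖(nodePoly κ (a + b) J M).eval κ‖ :=
    norm_pos_iff.2 (w.eval_nodePoly_self_ne_zero J M)
  have hC : 0 < ‖C‖ := norm_pos_iff.2 w.C_ne_zero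
  refine ⟨max 1 c⁻¹ ^ s.card * B₁ * (‖C‖⁻¹ * Real.exp (b.re * R)) *
    ((Real.exp (S * R) + ‖κ‖) ^ s.card / ‖(nodePoly κ (a + b) J M).eval κ‖), by positivity,
    fun x hsep hx p hp => ?_⟩
  have hxR : ∀ p ∈ s, -R ≤ x p ∧ x p ≤ R := by
    intro p hp
    rw [hs, Finset.mem_product, Finset.mem_Ico] at hp
    have h1 : -(J : ℝ) ≤ p.1 := by exact_mod_cast hp.1.1
    have h2 : (p.1 : ℝ) + 1 ≤ J := by exact_mod_cast hp.1.2
    have hM0 : (0 : ℝ) ≤ M := by positivity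
    obtain ⟨h3, h4⟩ := hx p
    constructor <;> simp only [hR] <;> nlinarith
  have hsp : ∀ p ∈ s, ‖spiral (a + b) (x p)‖ ≤ Real.exp (S * R) := by
    intro p hp
    rw [norm_spiral]
    exact Real.exp_le_exp.2 (by have := (hxR p hp).2; gcongr)
  rw [norm_mul, norm_mul, norm_mul, norm_div]
  gcongr
  · rw [Lagrange.nodalWeight, norm_prod]
    refine (Finset.prod_le_prod (fun _ _ => norm_nonneg _) (g := fun _ => max 1 c⁻¹)
      fun q hq => ?_).trans ?_
    · rw [Finset.mem_erase] at hq
      rw [norm_inv]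
      refine le_trans (inv_anti₀ hcpos ?_) (le_max_right _ _)
      rw [neg_sub_neg, norm_sub_rev]
      exact le_norm_spiral_sub_spiral w.re_add_pos (hsep _ _ hq.1.symm) (hxR p hp).1 (hxR q hq.2).1
    · rw [Finset.prod_const]
      exact pow_le_pow_right₀ (le_max_left _ _) (Finset.card_le_card (Finset.erase_subset _ _))
  · exact hB₁ _ (by rw [mem_closedBall_zero_iff, norm_neg]; exact hsp p hp)
  · rw [norm_inv, norm_mul, norm_exp_mul_ofReal, mul_inv, ← Real.exp_neg]
    gcongr
    have := (hxR p hp).1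
    have := w.re_b_pos
    nlinarith
  · rw [norm_prod, ← Finset.prod_const]
    refine Finset.prod_le_prod (fun _ _ => norm_nonneg _) fun q hq => ?_
    exact (norm_add_le _ _).trans (by gcongr; exact hsp q hq)

/-- Approximate dual functionals: a window shift at the origin can be isolated, up to a small
exponentially localized error, by finitely many samples with uniformly bounded coefficients. -/
theorem exists_dual (w : SechWindow h C a b κ) {M : ℕ} (hM : 1 ≤ M) {δ η : ℝ} (hδ : 0 < δ)
    (hη : 0 < η) :
    ∃ (J : ℕ) (B : ℝ), 0 ≤ B ∧ ∀ x : ℤ × Fin (M + 1) → ℝ, SeparatedFamily δ x →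
      (∀ p, x p ∈ Set.Ico ((p.1 : ℝ) * M) (((p.1 : ℝ) + 1) * M)) →
      ∃ d : ℤ × Fin (M + 1) → ℂ,
        (∀ p ∈ Finset.Ico (-(J : ℤ)) J ×ˢ (Finset.univ : Finset (Fin (M + 1))), ‖d p‖ ≤ B) ∧
        ∀ n : ℤ, ‖(∑ p ∈ Finset.Ico (-(J : ℤ)) J ×ˢ (Finset.univ : Finset (Fin (M + 1))),
          d p * h (x p - n)) - (if n = 0 then 1 else 0)‖ ≤ η * Real.exp (-|(n : ℝ)|) := by
  obtain ⟨L, hL, hE⟩ := w.exists_norm_dualError_le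
  set S := (a + b).re with hS
  have hSpos : 0 < S := w.re_add_pos
  set l := max 0 (-Real.log η) with hl
  obtain ⟨J₀, hJ₀⟩ := exists_nat_gt ((|a.re| + L + 2 * S * (M + 1) + 1 + l) / (S / 2))
  rw [div_lt_iff₀ (by positivity)] at hJ₀
  set J := J₀ + 1 with hJ
  have hJpos : 0 < J := Nat.succ_pos _
  obtain ⟨B, hB, hdB⟩ := w.exists_norm_dualCoeff_le J M hδ
  refine ⟨J, B, hB, fun x hsep hx => ⟨fun p => _, hdB x hsep hx, fun n => ?_⟩⟩
  have hinj : Function.Injective fun p => spiral (a + b) (x p) :=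
    (spiral_injective w.re_add_pos).comp (hsep.injective hδ)
  have hsum := w.sum_nodalWeight_mul_apply hJpos M hinj n
  have hP0 := w.eval_nodePoly_self_ne_zero J M
  have hQ0 : ∏ p ∈ Finset.Ico (-(J : ℤ)) J ×ˢ (Finset.univ : Finset (Fin (M + 1))),
      (spiral (a + b) (x p) + κ) ≠ 0 := by
    refine Finset.prod_ne_zero_iff.2 fun p _ => ?_
    have := w.spiral_add_ne_zero (x p) 0
    rwa [spiral_zero, mul_one] at this
  simp only [mul_right_comm _ (_ / _) (h _)]
  rw [← Finset.sum_mul, hsum]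
  by_cases h0 : n = 0
  · subst h0
    simp only [Int.cast_zero, mul_zero, Complex.exp_zero, spiral_zero, mul_one, one_mul, if_true]
    rw [div_mul_div_comm, mul_comm, div_self (mul_ne_zero hQ0 hP0), sub_self, norm_zero]
    positivity
  rw [if_neg h0, sub_zero]
  by_cases hn : (J * M : ℤ) ≤ n ∨ n < -(J * M : ℤ)
  · refine (hE J M hM n hn x hx).trans ?_
    have hn1 : (1 : ℝ) ≤ |(n : ℝ)| := by exact_mod_cast Int.one_le_abs h0
    have hη' : Real.exp (-l) ≤ η := by
      rw [← Real.exp_log hη]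
      refine Real.exp_le_exp.2 ?_
      have := le_max_right 0 (-Real.log η)
      linarith
    refine le_trans ?_ (mul_le_mul_of_nonneg_right hη' (Real.exp_pos _).le)
    rw [← Real.exp_add]
    refine Real.exp_le_exp.2 ?_
    have hl0 : 0 ≤ l := le_max_left _ _
    have hJc : (J : ℝ) = J₀ + 1 := by rw [hJ]; push_cast; ring
    have h1 : |a.re| + L + 2 * S * (M + 1) - S * J / 2 ≤ -(1 + l) := by
      rw [hJc]; nlinarith
    nlinarith
  · push Not at hn
    rw [eval_nodePoly_eq_zero hM (a + b) h0 hn.2 hn.1]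
    simp only [zero_div, mul_zero, zero_mul, norm_zero]
    positivity

end SechWindow

/-! ### Fiber sampling estimates -/

lemma summable_of_tsum_enorm_ne_top {ι : Type} {f : ι → ℂ} (hf : ∑' i, ‖f i‖ₑ ≠ ⊤) :
    Summable f := by
  have : Summable fun i => ‖f i‖₊ := ENNReal.tsum_coe_ne_top_iff_summable.1 hf
  exact Summable.of_norm (NNReal.summable_coe.2 this)

namespace LocalizedWindow

variable {h : ℝ → ℂ} {σ ρ K : ℝ}

lemma enorm_le (w : LocalizedWindow h σ ρ K) (x : ℝ) :
    ‖h x‖ₑ ≤ ENNReal.ofReal K * ENNReal.ofReal (Real.exp (-σ * |x|)) := by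
  rw [← ENNReal.ofReal_mul w.K_pos.le, ← ofReal_norm]
  exact ENNReal.ofReal_le_ofReal (w.norm_le x)

/-- Schur bounds for the kernel `h (u i - v j)` over two separated families. -/
lemma exists_tsum_enorm_le (w : LocalizedWindow h σ ρ K) {δ : ℝ} (hδ : 0 < δ) :
    ∃ R : ℝ≥0, ∀ (ι : Type) (u : ι → ℝ), SeparatedFamily δ u → ∀ y : ℝ,
      ∑' i, ‖h (u i - y)‖ₑ ≤ R ∧ ∑' i, ‖h (y - u i)‖ₑ ≤ R := by
  obtain ⟨R, hR⟩ := exists_tsum_exp_neg_abs_le w.σ_pos hδ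
  refine ⟨K.toNNReal * R, fun ι u hu y => ⟨?_, ?_⟩⟩
  · calc ∑' i, ‖h (u i - y)‖ₑ
        ≤ ∑' i, ENNReal.ofReal K * ENNReal.ofReal (Real.exp (-σ * |u i - y|)) :=
          ENNReal.tsum_le_tsum fun i => w.enorm_le _
      _ ≤ ENNReal.ofReal K * R := by rw [ENNReal.tsum_mul_left]; gcongr; exact hR ι u hu y
      _ = _ := by push_cast; rfl
  · calc ∑' i, ‖h (y - u i)‖ₑ
        ≤ ∑' i, ENNReal.ofReal K * ENNReal.ofReal (Real.exp (-σ * |u i - y|)) :=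
          ENNReal.tsum_le_tsum fun i => by rw [abs_sub_comm]; exact w.enorm_le _
      _ ≤ ENNReal.ofReal K * R := by rw [ENNReal.tsum_mul_left]; gcongr; exact hR ι u hu y
      _ = _ := by push_cast; rfl

lemma summable_mul (w : LocalizedWindow h σ ρ K) {c : ℤ → ℂ} (hc : ∑' n, ‖c n‖ₑ ^ 2 ≠ ⊤)
    (y : ℝ) : Summable fun n : ℤ => c n * h (y - n) := by
  obtain ⟨R, hR⟩ := w.exists_tsum_enorm_le one_pos
  have hsep : SeparatedFamily 1 (fun n : ℤ => (n : ℝ)) := by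
    simpa using separatedFamily_progression one_pos 0
  refine summable_of_tsum_enorm_ne_top fun htop => ?_
  have h1 := ENNReal.tsum_sq_tsum_mul_le (ι := Unit) (fun _ (n : ℤ) => ‖h (y - n)‖ₑ)
    (fun n => ‖c n‖ₑ) (R := R) (C := R) (fun _ => (hR _ _ hsep y).2) (fun n => by
      simp only [tsum_fintype, Finset.univ_unique, Finset.sum_const, Finset.card_singleton,
        one_smul]
      exact (ENNReal.le_tsum n).trans (hR _ _ hsep y).2)
  simp only [tsum_fintype, Finset.univ_unique, Finset.sum_const, Finset.card_singleton,
        one_smul] at h1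
  have h2 : ∑' n : ℤ, ‖h (y - n)‖ₑ * ‖c n‖ₑ = ⊤ := by
    rw [← htop]; exact tsum_congr fun n => by rw [enorm_mul, mul_comm]
  rw [h2] at h1
  have h3 : (R : ℝ≥0∞) * R * ∑' n, ‖c n‖ₑ ^ 2 ≠ ⊤ :=
    ENNReal.mul_ne_top (ENNReal.mul_ne_top ENNReal.coe_ne_top ENNReal.coe_ne_top) hc
  simp at h1
  exact h3 h1

/-- Upper sampling bound, uniform over fibers. -/
lemma exists_tsum_enorm_sq_le (w : LocalizedWindow h σ ρ K) {δ τ : ℝ} (hδ : 0 < δ) (hτ : 0 < τ) :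
    ∃ B : ℝ≥0, ∀ (ι : Type) (u : ι → ℝ), SeparatedFamily δ u → ∀ (s : ℝ) (c : ℤ → ℂ),
      ∑' i, ‖∑' n : ℤ, c n * h (u i - s - τ * n)‖ₑ ^ 2 ≤ B * ∑' n, ‖c n‖ₑ ^ 2 := by
  obtain ⟨R, hR⟩ := w.exists_tsum_enorm_le hτ
  obtain ⟨R', hR'⟩ := w.exists_tsum_enorm_le hδ
  refine ⟨R * R', fun ι u hu s c => ?_⟩
  have hsep : SeparatedFamily τ (fun n : ℤ => τ * n) := by
    simpa using separatedFamily_progression hτ 0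
  push_cast
  refine le_trans (ENNReal.tsum_le_tsum fun i => ?_)
    (ENNReal.tsum_sq_tsum_mul_le (fun i (n : ℤ) => ‖h (u i - s - τ * n)‖ₑ) (fun n => ‖c n‖ₑ)
      (fun i => (hR _ _ hsep _).2) (fun n => (hR' _ _ (hu.sub_const s) _).1))
  gcongr
  refine enorm_tsum_le_tsum_enorm.trans (le_of_eq (tsum_congr fun n => ?_))
  rw [enorm_mul, mul_comm]

end LocalizedWindow

lemma ENNReal.le_two_mul_of_le_add_half {x a : ℝ≥0∞} (hx : x ≠ ⊤) (h : x ≤ a + 2⁻¹ * x) :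
    x ≤ 2 * a := by
  have h1 : 2⁻¹ * x ≠ ⊤ := ENNReal.mul_ne_top (by simp) hx
  have h2 : x = 2⁻¹ * x + 2⁻¹ * x := by
    rw [← add_mul, ENNReal.inv_two_add_inv_two, one_mul]
  have h3 : 2⁻¹ * x ≤ a := by
    have : 2⁻¹ * x + 2⁻¹ * x ≤ a + 2⁻¹ * x := by rwa [← h2]
    exact (ENNReal.add_le_add_iff_right h1).1 this
  calc x = 2 * (2⁻¹ * x) := by
        rw [← mul_assoc, ENNReal.mul_inv_cancel two_ne_zero ENNReal.ofNat_ne_top, one_mul]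
    _ ≤ 2 * a := by gcongr

/-- Block-wise enumeration of a family with `M + 1` points in every interval of length `M`. -/
lemma exists_block_enumeration {ι : Type} {u : ι → ℝ} {M : ℕ}
    (hu : ∀ y : ℝ, ∃ F : Finset ι, F.card = M + 1 ∧ ∀ i ∈ F, u i ∈ Set.Ico y (y + M)) (s : ℝ) :
    ∃ e : ℤ × Fin (M + 1) → ι, Function.Injective e ∧
      ∀ p, u (e p) - s ∈ Set.Ico ((p.1 : ℝ) * M) (((p.1 : ℝ) + 1) * M) := by
  choose F hF hFu using fun i : ℤ => hu (s + i * M)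
  have hmem : ∀ p : ℤ × Fin (M + 1), u ((F p.1).equivFinOfCardEq (hF p.1) |>.symm p.2) - s ∈
      Set.Ico ((p.1 : ℝ) * M) (((p.1 : ℝ) + 1) * M) := by
    intro p
    obtain ⟨h1, h2⟩ := hFu p.1 _ ((F p.1).equivFinOfCardEq (hF p.1) |>.symm p.2).2
    constructor <;> linarith
  refine ⟨fun p => ((F p.1).equivFinOfCardEq (hF p.1)).symm p.2, ?_, hmem⟩
  rintro ⟨i, l⟩ ⟨j, m⟩ hij
  have key : ∀ i j : ℤ, ∀ y : ℝ, y ∈ Set.Ico ((i : ℝ) * M) (((i : ℝ) + 1) * M) →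
      y ∈ Set.Ico ((j : ℝ) * M) (((j : ℝ) + 1) * M) → ¬ i < j := by
    intro i j y h1 h2 hlt
    have h3 : (i : ℝ) + 1 ≤ j := by exact_mod_cast hlt
    have h4 : (0 : ℝ) ≤ M := by positivity
    have := h1.2
    have := h2.1
    nlinarith
  have h1 := hmem (i, l)
  have h2 := hmem (j, m)
  simp only at hij h1 h2
  rw [← hij] at h2
  have hi : i = j := le_antisymm (not_lt.1 (key _ _ _ h2 h1)) (not_lt.1 (key _ _ _ h1 h2))
  subst hi
  have := ((F i).equivFinOfCardEq (hF i)).symm.injective (Subtype.ext hij)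
  rw [this]

namespace SechWindow

variable {h : ℝ → ℂ} {C a b κ : ℂ}

lemma exists_enorm_coeff_le (w : SechWindow h C a b κ) {M : ℕ} (hM : 1 ≤ M) {δ η : ℝ}
    (hδ : 0 < δ) (hη : 0 < η) :
    ∃ B : ℝ, 0 ≤ B ∧ ∀ (ι : Type) (u : ι → ℝ), SeparatedFamily δ u →
      (∀ y : ℝ, ∃ F : Finset ι, F.card = M + 1 ∧ ∀ i ∈ F, u i ∈ Set.Ico y (y + M)) →
      ∀ (s : ℝ) (c : ℤ → ℂ), ∑' n, ‖c n‖ₑ ^ 2 ≠ ⊤ → ∀ j : ℤ,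
      ‖c j‖ₑ ≤ ∑' i, ENNReal.ofReal B * ENNReal.ofReal (Real.exp (-1 * |u i - (s + j)|)) *
          ‖∑' n : ℤ, c n * h (u i - s - n)‖ₑ +
        ∑' n : ℤ, ENNReal.ofReal η * ENNReal.ofReal (Real.exp (-1 * |(n : ℝ) - j|)) *
          ‖c n‖ₑ := by
  obtain ⟨J, B, hB, hdual⟩ := w.exists_dual hM hδ hη
  obtain ⟨σ, ρ, K, wl⟩ := w.exists_localized
  refine ⟨B * Real.exp (J * M), by positivity, fun ι u hsep hu s c hc j => ?_⟩
  obtain ⟨e, he, heu⟩ := exists_block_enumeration hu (s + j)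
  obtain ⟨d, hdB, hd⟩ := hdual (fun p => u (e p) - (s + j))
    (fun p q hpq => by
      have := hsep _ _ (he.ne hpq)
      simpa using this) heu
  set S := Finset.Ico (-(J : ℤ)) J ×ˢ (Finset.univ : Finset (Fin (M + 1))) with hS
  set y : ι → ℂ := fun i => ∑' n : ℤ, c n * h (u i - s - n) with hy
  have hsum : ∀ i, HasSum (fun n : ℤ => c n * h (u i - s - n)) (y i) :=
    fun i => (wl.summable_mul hc (u i - s)).hasSum
  have hS1 : HasSum (fun n : ℤ => ∑ p ∈ S, d p * (c n * h (u (e p) - s - n)))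
      (∑ p ∈ S, d p * y (e p)) :=
    hasSum_sum fun p _ => (hsum (e p)).mul_left (d p)
  have hS2 : HasSum (fun n : ℤ => if n = j then c j else 0) (c j) := by
    simpa using hasSum_ite_eq j (c j)
  have hS3 := hS1.sub hS2
  have herr : ∀ n : ℤ, ‖∑ p ∈ S, d p * (c n * h (u (e p) - s - n)) -
      (if n = j then c j else 0)‖ₑ ≤
      ENNReal.ofReal η * ENNReal.ofReal (Real.exp (-1 * |(n : ℝ) - j|)) * ‖c n‖ₑ := by
    intro n
    have h1 := hd (n - j)
    have e1 : ∑ p ∈ S, d p * (c n * h (u (e p) - s - n)) - (if n = j then c j else 0) =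
        c n * ((∑ p ∈ S, d p * h (u (e p) - (s + j) - ((n - j : ℤ) : ℝ))) -
          (if n - j = 0 then 1 else 0)) := by
      rw [mul_sub, Finset.mul_sum]
      congr 1
      · refine Finset.sum_congr rfl fun p _ => ?_
        have : u (e p) - (s + j) - ((n - j : ℤ) : ℝ) = u (e p) - s - n := by push_cast; ring
        rw [this]; ring
      · by_cases hnj : n = j
        · simp [hnj]
        · simp [hnj, sub_eq_zero]
    rw [e1, enorm_mul, mul_comm, ← ENNReal.ofReal_mul hη.le]
    gcongr
    rw [← ofReal_norm]
    refine ENNReal.ofReal_le_ofReal (h1.trans_eq ?_)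
    push_cast; ring_nf
  have hmain : ‖c j‖ₑ ≤ ‖∑ p ∈ S, d p * y (e p)‖ₑ +
      ‖(∑ p ∈ S, d p * y (e p)) - c j‖ₑ := by
    calc ‖c j‖ₑ = ‖(∑ p ∈ S, d p * y (e p)) - ((∑ p ∈ S, d p * y (e p)) - c j)‖ₑ := by
          rw [sub_sub_cancel]
      _ ≤ _ := enorm_sub_le
  refine hmain.trans (add_le_add ?_ ?_)
  · calc ‖∑ p ∈ S, d p * y (e p)‖ₑ ≤ ∑ p ∈ S, ‖d p * y (e p)‖ₑ := enorm_sum_le _ _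
      _ ≤ ∑ p ∈ S, ENNReal.ofReal (B * Real.exp (J * M)) *
          ENNReal.ofReal (Real.exp (-1 * |u (e p) - (s + j)|)) * ‖y (e p)‖ₑ := by
          refine Finset.sum_le_sum fun p hp => ?_
          rw [enorm_mul, ← ENNReal.ofReal_mul (by positivity), ← ofReal_norm (d p)]
          gcongr
          refine (hdB p hp).trans ?_
          rw [mul_assoc, ← Real.exp_add]
          refine le_mul_of_one_le_right hB (Real.one_le_exp ?_)
          obtain ⟨h1, h2⟩ := heu p
          rw [hS, Finset.mem_product, Finset.mem_Ico] at hp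
          have h3 : -(J : ℝ) ≤ p.1 := by exact_mod_cast hp.1.1
          have h4 : (p.1 : ℝ) + 1 ≤ J := by exact_mod_cast hp.1.2
          have hM0 : (0 : ℝ) ≤ M := by positivity
          have : |u (e p) - (s + j)| ≤ J * M := by
            rw [abs_le]; constructor <;> nlinarith
          linarith
      _ = ∑ i ∈ S.map ⟨e, he⟩, ENNReal.ofReal (B * Real.exp (J * M)) *
          ENNReal.ofReal (Real.exp (-1 * |u i - (s + j)|)) * ‖y i‖ₑ := by
          rw [Finset.sum_map]; rfl
      _ ≤ _ := ENNReal.sum_le_tsum _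
  · rw [← hS3.tsum_eq]
    exact enorm_tsum_le_tsum_enorm.trans (ENNReal.tsum_le_tsum herr)

/-- Lower sampling bound, uniform over fibers, for point families with at least `M + 1` points in
every interval of length `M`. -/
theorem exists_tsum_enorm_sq_coeff_le (w : SechWindow h C a b κ) {M : ℕ} (hM : 1 ≤ M) {δ : ℝ}
    (hδ : 0 < δ) :
    ∃ A : ℝ≥0, ∀ (ι : Type) (u : ι → ℝ), SeparatedFamily δ u →
      (∀ y : ℝ, ∃ F : Finset ι, F.card = M + 1 ∧ ∀ i ∈ F, u i ∈ Set.Ico y (y + M)) →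
      ∀ (s : ℝ) (c : ℤ → ℂ), ∑' n, ‖c n‖ₑ ^ 2 ≠ ⊤ →
      ∑' n, ‖c n‖ₑ ^ 2 ≤ A * ∑' i, ‖∑' n : ℤ, c n * h (u i - s - n)‖ₑ ^ 2 := by
  obtain ⟨K₁, hK₁⟩ := exists_tsum_exp_neg_abs_le one_pos one_pos
  obtain ⟨K₂, hK₂⟩ := exists_tsum_exp_neg_abs_le one_pos hδ
  set η : ℝ := (2 * (K₁ + 1))⁻¹ with hη
  have hηpos : 0 < η := by positivity
  obtain ⟨B, hB, hcoef⟩ := w.exists_enorm_coeff_le hM hδ hηpos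
  have hprog : ∀ s : ℝ, SeparatedFamily 1 (fun n : ℤ => s + n) := by
    intro s; simpa using separatedFamily_progression one_pos s
  refine ⟨2 * (2 * (B.toNNReal * K₂ * (B.toNNReal * K₁))), fun ι u hsep hu s c hc => ?_⟩
  have h1 := hcoef ι u hsep hu s c hc
  set y : ι → ℝ≥0∞ := fun i => ‖∑' n : ℤ, c n * h (u i - s - n)‖ₑ with hy
  have hA : ∑' j : ℤ, (∑' i, ENNReal.ofReal B *
      ENNReal.ofReal (Real.exp (-1 * |u i - (s + j)|)) * y i) ^ 2 ≤
      ENNReal.ofReal B * K₂ * (ENNReal.ofReal B * K₁) * ∑' i, y i ^ 2 := by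
    refine ENNReal.tsum_sq_tsum_mul_le _ _ (fun j => ?_) (fun i => ?_)
    · rw [ENNReal.tsum_mul_left]; gcongr; exact hK₂ ι u hsep _
    · rw [ENNReal.tsum_mul_left]; gcongr
      simp_rw [abs_sub_comm (u i)]
      exact hK₁ ℤ _ (hprog s) _
  have hE : ∑' j : ℤ, (∑' n : ℤ, ENNReal.ofReal η *
      ENNReal.ofReal (Real.exp (-1 * |(n : ℝ) - j|)) * ‖c n‖ₑ) ^ 2 ≤
      ENNReal.ofReal η * K₁ * (ENNReal.ofReal η * K₁) * ∑' n, ‖c n‖ₑ ^ 2 := by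
    have hp0 : SeparatedFamily 1 (fun n : ℤ => (n : ℝ)) := by simpa using hprog 0
    refine ENNReal.tsum_sq_tsum_mul_le _ _ (fun j => ?_) (fun i => ?_)
    · rw [ENNReal.tsum_mul_left]; gcongr; exact hK₁ ℤ _ hp0 _
    · rw [ENNReal.tsum_mul_left]; gcongr
      simp_rw [abs_sub_comm (i : ℝ)]
      exact hK₁ ℤ _ hp0 _
  have hηK : 2 * (ENNReal.ofReal η * K₁ * (ENNReal.ofReal η * K₁)) ≤ (2 : ℝ≥0∞)⁻¹ := by
    have h2 : ENNReal.ofReal η * K₁ ≤ 2⁻¹ := by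
      rw [← ENNReal.ofReal_coe_nnreal, ← ENNReal.ofReal_mul hηpos.le,
        ← ENNReal.ofReal_ofNat 2, ← ENNReal.ofReal_inv_of_pos two_pos]
      refine ENNReal.ofReal_le_ofReal ?_
      rw [hη, mul_inv, mul_assoc]
      refine mul_le_of_le_one_right (by positivity) ?_
      rw [inv_mul_le_iff₀ (by positivity)]
      linarith
    calc 2 * (ENNReal.ofReal η * K₁ * (ENNReal.ofReal η * K₁)) ≤ 2 * (2⁻¹ * 2⁻¹) := by gcongr
      _ = 2⁻¹ := by
          rw [← mul_assoc, ENNReal.mul_inv_cancel two_ne_zero ENNReal.ofNat_ne_top, one_mul]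
  have hfin : ∑' n, ‖c n‖ₑ ^ 2 ≤ 2 * (ENNReal.ofReal B * K₂ * (ENNReal.ofReal B * K₁)) *
      ∑' i, y i ^ 2 + 2⁻¹ * ∑' n, ‖c n‖ₑ ^ 2 := by
    calc ∑' n, ‖c n‖ₑ ^ 2 ≤ ∑' j : ℤ, 2 * ((∑' i, ENNReal.ofReal B *
          ENNReal.ofReal (Real.exp (-1 * |u i - (s + j)|)) * y i) ^ 2 +
          (∑' n : ℤ, ENNReal.ofReal η *
          ENNReal.ofReal (Real.exp (-1 * |(n : ℝ) - j|)) * ‖c n‖ₑ) ^ 2) := by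
          refine ENNReal.tsum_le_tsum fun j => le_trans ?_ (ENNReal.add_sq_le _ _)
          gcongr
          exact h1 j
      _ ≤ 2 * (ENNReal.ofReal B * K₂ * (ENNReal.ofReal B * K₁) * ∑' i, y i ^ 2 +
          ENNReal.ofReal η * K₁ * (ENNReal.ofReal η * K₁) * ∑' n, ‖c n‖ₑ ^ 2) := by
          rw [ENNReal.tsum_mul_left, ENNReal.tsum_add]
          gcongr
      _ = 2 * (ENNReal.ofReal B * K₂ * (ENNReal.ofReal B * K₁)) * ∑' i, y i ^ 2 +
          2 * (ENNReal.ofReal η * K₁ * (ENNReal.ofReal η * K₁)) * ∑' n, ‖c n‖ₑ ^ 2 := by ring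
      _ ≤ _ := by gcongr
  refine (ENNReal.le_two_mul_of_le_add_half hc hfin).trans_eq ?_
  push_cast
  rw [← mul_assoc]
  rfl

end SechWindow

/-! ### Necessity: stability of the sampling inequality under dilation of the nodes -/

lemma SeparatedFamily.mono {ι : Type} {δ δ' : ℝ} {u : ι → ℝ} (hu : SeparatedFamily δ u)
    (h : δ' ≤ δ) : SeparatedFamily δ' u := fun i j hij => h.trans (hu i j hij)

lemma exists_pos_ofReal_sq_mul_le_half (Q : ℝ≥0) :
    ∃ θ₀ : ℝ, 0 < θ₀ ∧ ∀ θ, 0 ≤ θ → θ ≤ θ₀ → ENNReal.ofReal θ ^ 2 * Q ≤ 2⁻¹ := by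
  refine ⟨(1 + 2 * (Q : ℝ))⁻¹, by positivity, fun θ h0 hθ => ?_⟩
  have hQ : (0 : ℝ) ≤ Q := Q.2
  rw [← ENNReal.ofReal_coe_nnreal, ← ENNReal.ofReal_pow h0, ← ENNReal.ofReal_mul (by positivity),
    ← ENNReal.ofReal_ofNat 2, ← ENNReal.ofReal_inv_of_pos two_pos]
  refine ENNReal.ofReal_le_ofReal ?_
  have h1 : θ * (1 + 2 * (Q : ℝ)) ≤ 1 := by
    rwa [← le_div_iff₀ (by positivity), one_div]
  have h2 : θ ≤ 1 := by nlinarith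
  nlinarith [mul_nonneg h0 hQ]

lemma abs_exp_neg_abs_sub_le {θ : ℝ} (hθ : 0 ≤ θ) (n j p : ℝ) :
    |Real.exp (-θ * |n - j|) - Real.exp (-θ * |p - j|)| ≤
      Real.exp (-θ * |n - j|) * (θ * |p - n| * Real.exp (θ * |p - n|)) := by
  have h1 : |n - j| ≤ |p - j| + |p - n| := by
    have := abs_sub_le n p j
    rw [abs_sub_comm n p] at this
    linarith
  have h2 : |p - j| ≤ |p - n| + |n - j| := abs_sub_le p n j
  have h3 : Real.exp (θ * |p - n|) - 1 ≤ θ * |p - n| * Real.exp (θ * |p - n|) := by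
    have h4 := Real.add_one_le_exp (-(θ * |p - n|))
    have h5 : Real.exp (-(θ * |p - n|)) * Real.exp (θ * |p - n|) = 1 := by
      rw [← Real.exp_add]; simp
    nlinarith [Real.exp_pos (θ * |p - n|)]
  have hw := Real.exp_pos (-θ * |n - j|)
  refine le_trans ?_ (mul_le_mul_of_nonneg_left h3 hw.le)
  have hE : 1 ≤ Real.exp (θ * |p - n|) := Real.one_le_exp (by positivity)
  rw [abs_le]
  constructor
  · have : Real.exp (-θ * |p - j|) ≤ Real.exp (-θ * |n - j|) * Real.exp (θ * |p - n|) := by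
      rw [← Real.exp_add]; exact Real.exp_le_exp.2 (by nlinarith)
    linarith
  · have : Real.exp (-θ * |n - j|) ≤ Real.exp (-θ * |p - j|) * Real.exp (θ * |p - n|) := by
      rw [← Real.exp_add]; exact Real.exp_le_exp.2 (by nlinarith)
    have h5 : Real.exp (-θ * |p - j|) ≤ Real.exp (-θ * |n - j|) * Real.exp (θ * |p - n|) := by
      rw [← Real.exp_add]; exact Real.exp_le_exp.2 (by nlinarith)
    have h6 : Real.exp (-θ * |n - j|) * Real.exp (-(θ * |p - n|)) ≤ Real.exp (-θ * |p - j|) := by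
      rw [← Real.exp_add]; exact Real.exp_le_exp.2 (by nlinarith)
    have h7 : 2 ≤ Real.exp (-(θ * |p - n|)) + Real.exp (θ * |p - n|) := by
      have := Real.add_one_le_exp (-(θ * |p - n|))
      have := Real.add_one_le_exp (θ * |p - n|)
      linarith
    nlinarith

namespace LocalizedWindow

variable {h : ℝ → ℂ} {σ ρ K : ℝ}

lemma commutator_le (w : LocalizedWindow h σ ρ K) {θ τ : ℝ} (hθ : 0 ≤ θ) (hθσ : 8 * θ ≤ σ)
    (hτ : 1 / 2 ≤ τ) (n j u : ℝ) :
    |Real.exp (-θ * |n - j|) - Real.exp (-θ * |u / τ - j|)| * ‖h (u - τ * n)‖ ≤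
      θ * (8 * K / σ) * Real.exp (-(σ / 2) * |u - τ * n|) * Real.exp (-θ * |n - j|) := by
  have hσ := w.σ_pos
  have hK := w.K_pos
  have hτ0 : 0 < τ := by linarith
  set x := |u - τ * n| with hx
  have hx0 : 0 ≤ x := abs_nonneg _
  have hp : |u / τ - n| ≤ 2 * x := by
    have e : u / τ - n = (u - τ * n) / τ := by field_simp
    rw [e, abs_div, abs_of_pos hτ0, div_le_iff₀ hτ0]
    nlinarith
  have h1 : θ * |u / τ - n| * Real.exp (θ * |u / τ - n|) ≤
      θ * (2 * x) * Real.exp (σ / 4 * x) := by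
    have h0 : θ * |u / τ - n| ≤ σ / 4 * x := by nlinarith
    gcongr
  have h2 : x ≤ 4 / σ * Real.exp (σ / 4 * x) := by
    have := Real.add_one_le_exp (σ / 4 * x)
    calc x = 4 / σ * (σ / 4 * x) := by field_simp
      _ ≤ _ := by gcongr; linarith
  have h3 : θ * (2 * x) * Real.exp (σ / 4 * x) * (K * Real.exp (-σ * x)) ≤
      θ * (8 * K / σ) * Real.exp (-(σ / 2) * x) := by
    calc θ * (2 * x) * Real.exp (σ / 4 * x) * (K * Real.exp (-σ * x))
        ≤ θ * (2 * (4 / σ * Real.exp (σ / 4 * x))) * Real.exp (σ / 4 * x) *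
          (K * Real.exp (-σ * x)) := by gcongr
      _ = θ * (8 * K / σ) * (Real.exp (σ / 4 * x) * Real.exp (σ / 4 * x) *
          Real.exp (-σ * x)) := by ring
      _ = _ := by rw [← Real.exp_add, ← Real.exp_add]; ring_nf
  calc |Real.exp (-θ * |n - j|) - Real.exp (-θ * |u / τ - j|)| * ‖h (u - τ * n)‖
      ≤ (Real.exp (-θ * |n - j|) * (θ * (2 * x) * Real.exp (σ / 4 * x))) *
        (K * Real.exp (-σ * x)) := by
        refine mul_le_mul ((abs_exp_neg_abs_sub_le hθ n j _).trans ?_) (w.norm_le _)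
          (norm_nonneg _) (by positivity)
        gcongr
    _ = Real.exp (-θ * |n - j|) * (θ * (2 * x) * Real.exp (σ / 4 * x) *
        (K * Real.exp (-σ * x))) := by ring
    _ ≤ Real.exp (-θ * |n - j|) * (θ * (8 * K / σ) * Real.exp (-(σ / 2) * x)) := by gcongr
    _ = _ := by ring

lemma shift_error_le (w : LocalizedWindow h σ ρ K) {θ ε : ℝ} (hθ : 0 < θ) (hε : 0 < ε)
    (hερ : 4 * (ρ * ε) ≤ θ) {p q m : ℝ} (hm : 0 ≤ m) (hpq : |p - q| ≤ ε * (m + 1)) :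
    Real.exp (-θ * m) * ‖h p - h q‖ ≤
      ε * (K * (1 + 4 / θ) * Real.exp (θ / 4)) * Real.exp (-(σ / 2) * |q|) *
        Real.exp (-(θ / 2) * m) := by
  have hσ := w.σ_pos
  have hK := w.K_pos
  have hρ := w.ρ_pos
  have h1 : ‖h p - h q‖ ≤ K * (ε * (m + 1) * Real.exp (θ / 4 * (m + 1))) *
      Real.exp (-(σ / 2) * |q|) := by
    refine (w.norm_sub_le p q).trans ?_
    have h0 : ρ * |p - q| ≤ θ / 4 * (m + 1) := by nlinarith
    have h0' : -σ * |q| ≤ -(σ / 2) * |q| := by nlinarith [abs_nonneg q]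
    gcongr
  have h2 : m + 1 ≤ (1 + 4 / θ) * Real.exp (θ / 4 * m) := by
    have h3 := Real.add_one_le_exp (θ / 4 * m)
    have h4 : m ≤ 4 / θ * Real.exp (θ / 4 * m) := by
      calc m = 4 / θ * (θ / 4 * m) := by field_simp
        _ ≤ _ := by gcongr; linarith
    have h5 : 1 ≤ Real.exp (θ / 4 * m) := Real.one_le_exp (by positivity)
    linarith
  calc Real.exp (-θ * m) * ‖h p - h q‖
      ≤ Real.exp (-θ * m) * (K * (ε * ((1 + 4 / θ) * Real.exp (θ / 4 * m)) *
        Real.exp (θ / 4 * (m + 1))) * Real.exp (-(σ / 2) * |q|)) := by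
        gcongr
        refine h1.trans ?_
        gcongr
    _ = ε * (K * (1 + 4 / θ)) * Real.exp (-(σ / 2) * |q|) *
        (Real.exp (-θ * m) * Real.exp (θ / 4 * m) * Real.exp (θ / 4 * (m + 1))) := by ring
    _ = ε * (K * (1 + 4 / θ)) * Real.exp (-(σ / 2) * |q|) *
        (Real.exp (θ / 4) * Real.exp (-(θ / 2) * m)) := by
        rw [← Real.exp_add, ← Real.exp_add, ← Real.exp_add]; ring_nf
    _ = _ := by ring

/-- Comparison of the weighted fiber sum with nodes `s + n` and the fiber sum with nodes `τ n`. -/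
lemma enorm_weighted_tsum_le (w : LocalizedWindow h σ ρ K) {θ ε : ℝ} (hθ : 0 < θ)
    (hθσ : 8 * θ ≤ σ) (hε : 0 < ε) (hε2 : ε ≤ 1 / 2) (hερ : 4 * (ρ * ε) ≤ θ) {c : ℤ → ℂ}
    (hc : c.support.Finite) (j : ℤ) {s : ℝ} (hs : s ∈ Set.Ico (-ε * j) (-ε * j + ε)) (u : ℝ) :
    ‖∑' n : ℤ, (Real.exp (-θ * |(n : ℝ) - j|) * c n) * h (u - s - n)‖ₑ ≤
      ENNReal.ofReal (Real.exp (-θ * |u / (1 - ε) - j|)) *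
        ‖∑' n : ℤ, c n * h (u - (1 - ε) * n)‖ₑ +
      (∑' n : ℤ, ENNReal.ofReal (θ * (8 * K / σ)) *
          ENNReal.ofReal (Real.exp (-(σ / 2) * |u - (1 - ε) * n|)) *
          ‖(Real.exp (-θ * |(n : ℝ) - j|) * c n : ℂ)‖ₑ +
        ∑' n : ℤ, ENNReal.ofReal (ε * (K * (1 + 4 / θ) * Real.exp (θ / 4))) *
          ENNReal.ofReal (Real.exp (-(σ / 2) * |u - (1 - ε) * n|)) *
          (ENNReal.ofReal (Real.exp (-(θ / 2) * |(n : ℝ) - j|)) * ‖c n‖ₑ)) := by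
  have hσ := w.σ_pos
  have hK := w.K_pos
  have hfin : ∀ f : ℤ → ℂ, Summable fun n => c n * f n := fun f =>
    summable_of_hasFiniteSupport (hc.subset fun n hn => left_ne_zero_of_mul hn)
  set W : ℝ := Real.exp (-θ * |u / (1 - ε) - j|) with hW
  set v : ℤ → ℝ := fun n => Real.exp (-θ * |(n : ℝ) - j|) with hv
  have e : ∑' n : ℤ, (v n * c n) * h (u - s - n) =
      W * (∑' n : ℤ, c n * h (u - (1 - ε) * n)) +
      (∑' n : ℤ, c n * ((v n - W) * h (u - (1 - ε) * n)) +
        ∑' n : ℤ, c n * (v n * (h (u - s - n) - h (u - (1 - ε) * n)))) := by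
    rw [← tsum_mul_left, ← (hfin _).tsum_add (hfin _), ← Summable.tsum_add]
    · exact tsum_congr fun n => by ring
    · exact (hfin _).mul_left _
    · exact (hfin _).add (hfin _)
  rw [e]
  refine (enorm_add_le _ _).trans (add_le_add ?_ ((enorm_add_le _ _).trans (add_le_add ?_ ?_)))
  · rw [enorm_mul, ← ofReal_norm (W : ℂ), Complex.norm_real, Real.norm_of_nonneg (Real.exp_pos _).le]
  · refine enorm_tsum_le_tsum_enorm.trans (ENNReal.tsum_le_tsum fun n => ?_)
    have h1 := w.commutator_le hθ.le hθσ (τ := 1 - ε) (by linarith) n j u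
    rw [enorm_mul, enorm_mul (Real.exp _ : ℂ), mul_comm, ← mul_assoc]
    refine mul_le_mul_left ?_ _
    rw [← ofReal_norm, ← ofReal_norm, ← ENNReal.ofReal_mul (by positivity),
      ← ENNReal.ofReal_mul (by positivity), norm_mul]
    refine ENNReal.ofReal_le_ofReal ?_
    rw [← Complex.ofReal_sub, Complex.norm_real, Complex.norm_real, Real.norm_eq_abs,
      Real.norm_of_nonneg (Real.exp_pos _).le]
    exact h1
  · refine enorm_tsum_le_tsum_enorm.trans (ENNReal.tsum_le_tsum fun n => ?_)
    have h1 := w.shift_error_le hθ hε hερ (p := u - s - n) (q := u - (1 - ε) * n)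
      (abs_nonneg ((n : ℝ) - j)) (by
        have e : u - s - n - (u - (1 - ε) * n) = -ε * ((n : ℝ) - j) - (s + ε * j) := by ring
        rw [e]
        refine (abs_sub _ _).trans ?_
        rw [abs_mul, abs_neg, abs_of_pos hε, mul_add, mul_one]
        gcongr
        rw [abs_le]
        constructor <;> linarith [hs.1, hs.2])
    rw [enorm_mul, mul_comm, ← mul_assoc]
    refine mul_le_mul_left ?_ _
    rw [← ofReal_norm, ← ENNReal.ofReal_mul (by positivity),
      ← ENNReal.ofReal_mul (by positivity), norm_mul]
    refine ENNReal.ofReal_le_ofReal ?_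
    rw [Complex.norm_real, Real.norm_of_nonneg (Real.exp_pos _).le]
    exact h1

end LocalizedWindow

namespace LocalizedWindow

variable {h : ℝ → ℂ} {σ ρ K : ℝ}

/-- If the sampling inequality holds on (a dense set of) fibers, it survives a slight contraction
of the nodes. -/
theorem exists_contracted_lower_bound (w : LocalizedWindow h σ ρ K) {ι : Type} {u : ι → ℝ} {δ : ℝ}
    (hδ : 0 < δ) (hu : SeparatedFamily δ u) {A : ℝ≥0}
    (hA : ∀ c : ℤ → ℂ, c.support.Finite → ∀ t ε : ℝ, 0 < ε → ∃ s ∈ Set.Ico t (t + ε),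
      ∑' n, ‖c n‖ₑ ^ 2 ≤ A * ∑' i, ‖∑' n : ℤ, c n * h (u i - s - n)‖ₑ ^ 2) :
    ∃ (τ : ℝ) (A' : ℝ≥0), 0 < τ ∧ τ < 1 ∧ ∀ c : ℤ → ℂ, c.support.Finite →
      ∑' n, ‖c n‖ₑ ^ 2 ≤ A' * ∑' i, ‖∑' n : ℤ, c n * h (u i - τ * n)‖ₑ ^ 2 := by
  have hσ := w.σ_pos
  have hK := w.K_pos
  have hρ := w.ρ_pos
  obtain ⟨R₁, hR₁⟩ := exists_tsum_exp_neg_abs_le (half_pos hσ) (half_pos one_pos)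
  obtain ⟨R₂, hR₂⟩ := exists_tsum_exp_neg_abs_le (half_pos hσ) hδ
  obtain ⟨θ₀, hθ₀, hθ₀A⟩ :=
    exists_pos_ofReal_sq_mul_le_half (A * (4 * ((8 * K / σ).toNNReal ^ 2 * (R₁ * R₂))))
  set θ := min θ₀ (σ / 8) with hθdef
  have hθ : 0 < θ := lt_min hθ₀ (by positivity)
  have hθσ : 8 * θ ≤ σ := by have := min_le_right θ₀ (σ / 8); linarith
  obtain ⟨K₁, hK₁⟩ := exists_tsum_exp_neg_abs_le hθ one_pos
  set κ := K * (1 + 4 / θ) * Real.exp (θ / 4) with hκ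
  obtain ⟨ε₀, hε₀, hε₀A⟩ :=
    exists_pos_ofReal_sq_mul_le_half (2 * (A * (4 * (κ.toNNReal ^ 2 * (R₁ * R₂)))) * K₁)
  set ε := min ε₀ (min (1 / 2) (θ / (4 * ρ))) with hεdef
  have hε : 0 < ε := lt_min hε₀ (lt_min (by norm_num) (by positivity))
  have hε2 : ε ≤ 1 / 2 := (min_le_right _ _).trans (min_le_left _ _)
  have hερ : 4 * (ρ * ε) ≤ θ := by
    have h1 : ε ≤ θ / (4 * ρ) := (min_le_right _ _).trans (min_le_right _ _)
    rw [le_div_iff₀ (by positivity)] at h1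
    linarith
  refine ⟨1 - ε, 2 * (2 * (A * 2) * K₁), by linarith, by linarith, fun c hc => ?_⟩
  have hprog : SeparatedFamily 1 (fun n : ℤ => (n : ℝ)) := by
    simpa using separatedFamily_progression one_pos 0
  have hnode : SeparatedFamily (1 / 2) (fun n : ℤ => (1 - ε) * (n : ℝ)) := by
    have : SeparatedFamily (1 - ε) (fun n : ℤ => (1 - ε) * (n : ℝ)) := by
      simpa using separatedFamily_progression (show 0 < 1 - ε by linarith) 0
    exact this.mono (by linarith)
  set y : ι → ℝ≥0∞ := fun i => ‖∑' n : ℤ, c n * h (u i - (1 - ε) * n)‖ₑ with hy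
  set E : ι → ℤ → ℝ≥0∞ := fun i n =>
    ENNReal.ofReal (Real.exp (-(σ / 2) * |u i - (1 - ε) * n|)) with hE
  have hErow : ∀ i, ∑' n, E i n ≤ R₁ := fun i => by
    simp only [hE, abs_sub_comm (u i)]
    exact hR₁ ℤ _ hnode (u i)
  have hEcol : ∀ n, ∑' i, E i n ≤ R₂ := fun n => hR₂ ι u hu _
  have hSchur : ∀ (q : ℝ) (z : ℤ → ℝ≥0∞), ∑' i, (∑' n, ENNReal.ofReal q * E i n * z n) ^ 2 ≤
      ENNReal.ofReal q ^ 2 * (R₁ * R₂) * ∑' n, z n ^ 2 := by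
    intro q z
    refine (ENNReal.tsum_sq_tsum_mul_le (fun i n => ENNReal.ofReal q * E i n) z
      (R := ENNReal.ofReal q * R₁) (C := ENNReal.ofReal q * R₂) (fun i => ?_) (fun n => ?_)).trans
      (le_of_eq (by ring))
    · rw [ENNReal.tsum_mul_left]; gcongr; exact hErow i
    · rw [ENNReal.tsum_mul_left]; gcongr; exact hEcol n
  have hj : ∀ j : ℤ, ‖c j‖ₑ ^ 2 ≤
      2 * (A * 2) * ∑' i, ENNReal.ofReal (Real.exp (-θ * |u i / (1 - ε) - j|)) * y i ^ 2 +
      ENNReal.ofReal ε ^ 2 * (2 * (A * (4 * (ENNReal.ofReal κ ^ 2 * (R₁ * R₂))))) *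
        ∑' n : ℤ, ENNReal.ofReal (Real.exp (-θ * |(n : ℝ) - j|)) * ‖c n‖ₑ ^ 2 := by
    intro j
    set b : ℤ → ℂ := fun n => Real.exp (-θ * |(n : ℝ) - j|) * c n with hb
    have hbs : b.support.Finite := hc.subset fun n hn => right_ne_zero_of_mul hn
    obtain ⟨s, hs, hsA⟩ := hA b hbs (-ε * j) ε hε
    have hbfin : ∑' n, ‖b n‖ₑ ^ 2 ≠ ⊤ := by
      rw [tsum_eq_sum (s := hbs.toFinset) (fun n hn => by
        have : b n = 0 := by simpa using hn
        simp [this])]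
      exact ENNReal.sum_ne_top.2 fun n _ => ENNReal.pow_ne_top enorm_ne_top
    have hpt : ∀ i, ‖∑' n : ℤ, b n * h (u i - s - n)‖ₑ ^ 2 ≤
        2 * (ENNReal.ofReal (Real.exp (-θ * |u i / (1 - ε) - j|)) * y i ^ 2) +
        (4 * (∑' n, ENNReal.ofReal (θ * (8 * K / σ)) * E i n * ‖b n‖ₑ) ^ 2 +
        4 * (∑' n : ℤ, ENNReal.ofReal (ε * κ) * E i n *
          (ENNReal.ofReal (Real.exp (-(θ / 2) * |(n : ℝ) - j|)) * ‖c n‖ₑ)) ^ 2) := by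
      intro i
      have h1 := w.enorm_weighted_tsum_le hθ hθσ hε hε2 hερ hc j hs (u i)
      have hW : ENNReal.ofReal (Real.exp (-θ * |u i / (1 - ε) - j|)) ^ 2 ≤
          ENNReal.ofReal (Real.exp (-θ * |u i / (1 - ε) - j|)) := by
        rw [sq]
        refine mul_le_of_le_one_right' ?_
        rw [ENNReal.ofReal_le_one]
        exact Real.exp_le_one_iff.2 (by nlinarith [abs_nonneg (u i / (1 - ε) - j)])
      calc ‖∑' n : ℤ, b n * h (u i - s - n)‖ₑ ^ 2 ≤ _ := pow_le_pow_left₀ (zero_le) h1 2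
        _ ≤ _ := ENNReal.add_sq_le _ _
        _ ≤ 2 * ((ENNReal.ofReal (Real.exp (-θ * |u i / (1 - ε) - j|)) * y i) ^ 2 +
            2 * ((∑' n, ENNReal.ofReal (θ * (8 * K / σ)) * E i n * ‖b n‖ₑ) ^ 2 +
            (∑' n : ℤ, ENNReal.ofReal (ε * κ) * E i n *
            (ENNReal.ofReal (Real.exp (-(θ / 2) * |(n : ℝ) - j|)) * ‖c n‖ₑ)) ^ 2)) := by
            refine mul_le_mul_right (add_le_add le_rfl ?_) _
            exact ENNReal.add_sq_le _ _
        _ ≤ 2 * (ENNReal.ofReal (Real.exp (-θ * |u i / (1 - ε) - j|)) * y i ^ 2 +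
            2 * ((∑' n, ENNReal.ofReal (θ * (8 * K / σ)) * E i n * ‖b n‖ₑ) ^ 2 +
            (∑' n : ℤ, ENNReal.ofReal (ε * κ) * E i n *
            (ENNReal.ofReal (Real.exp (-(θ / 2) * |(n : ℝ) - j|)) * ‖c n‖ₑ)) ^ 2)) := by
            rw [mul_pow]; gcongr
        _ = _ := by ring
    have hg : ∀ n : ℤ, (ENNReal.ofReal (Real.exp (-(θ / 2) * |(n : ℝ) - j|)) * ‖c n‖ₑ) ^ 2 =
        ENNReal.ofReal (Real.exp (-θ * |(n : ℝ) - j|)) * ‖c n‖ₑ ^ 2 := by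
      intro n
      rw [mul_pow, ← ENNReal.ofReal_pow (Real.exp_pos _).le, ← Real.exp_nat_mul]
      push_cast; ring_nf
    have hX : ∑' n, ‖b n‖ₑ ^ 2 ≤
        (A * 2 * ∑' i, ENNReal.ofReal (Real.exp (-θ * |u i / (1 - ε) - j|)) * y i ^ 2 +
        A * 4 * (ENNReal.ofReal (ε * κ) ^ 2 * (R₁ * R₂)) *
          ∑' n : ℤ, ENNReal.ofReal (Real.exp (-θ * |(n : ℝ) - j|)) * ‖c n‖ₑ ^ 2) +
        2⁻¹ * ∑' n, ‖b n‖ₑ ^ 2 := by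
      have hθA := hθ₀A θ hθ.le (min_le_left _ _)
      calc ∑' n, ‖b n‖ₑ ^ 2 ≤ A * ∑' i, ‖∑' n : ℤ, b n * h (u i - s - n)‖ₑ ^ 2 := hsA
        _ ≤ A * (2 * ∑' i, ENNReal.ofReal (Real.exp (-θ * |u i / (1 - ε) - j|)) * y i ^ 2 +
            (4 * (ENNReal.ofReal (θ * (8 * K / σ)) ^ 2 * (R₁ * R₂) * ∑' n, ‖b n‖ₑ ^ 2) +
            4 * (ENNReal.ofReal (ε * κ) ^ 2 * (R₁ * R₂) *
              ∑' n : ℤ, ENNReal.ofReal (Real.exp (-θ * |(n : ℝ) - j|)) * ‖c n‖ₑ ^ 2))) := by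
            refine mul_le_mul_right ((ENNReal.tsum_le_tsum hpt).trans ?_) _
            rw [ENNReal.tsum_add, ENNReal.tsum_add, ENNReal.tsum_mul_left, ENNReal.tsum_mul_left,
              ENNReal.tsum_mul_left]
            have h2 := hSchur (ε * κ)
              (fun n => ENNReal.ofReal (Real.exp (-(θ / 2) * |(n : ℝ) - j|)) * ‖c n‖ₑ)
            simp only [hg] at h2
            gcongr
            exact hSchur _ _
        _ = (A * 2 * ∑' i, ENNReal.ofReal (Real.exp (-θ * |u i / (1 - ε) - j|)) * y i ^ 2 +
            A * 4 * (ENNReal.ofReal (ε * κ) ^ 2 * (R₁ * R₂)) *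
              ∑' n : ℤ, ENNReal.ofReal (Real.exp (-θ * |(n : ℝ) - j|)) * ‖c n‖ₑ ^ 2) +
            (ENNReal.ofReal θ ^ 2 * (A * (4 * (ENNReal.ofReal (8 * K / σ) ^ 2 * (R₁ * R₂))))) *
              ∑' n, ‖b n‖ₑ ^ 2 := by
            rw [ENNReal.ofReal_mul hθ.le]; ring
        _ ≤ _ := by
            gcongr
            push_cast at hθA
            exact hθA
    have h3 : ‖c j‖ₑ ^ 2 ≤ ∑' n, ‖b n‖ₑ ^ 2 := by
      refine le_trans (le_of_eq ?_) (ENNReal.le_tsum j)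
      simp [hb]
    refine (h3.trans (ENNReal.le_two_mul_of_le_add_half hbfin hX)).trans_eq ?_
    rw [ENNReal.ofReal_mul hε.le]
    ring
  have hcfin : ∑' n, ‖c n‖ₑ ^ 2 ≠ ⊤ := by
    rw [tsum_eq_sum (s := hc.toFinset) (fun n hn => by
      have : c n = 0 := by simpa using hn
      simp [this])]
    exact ENNReal.sum_ne_top.2 fun n _ => ENNReal.pow_ne_top enorm_ne_top
  have hcol : ∀ p : ℝ, ∑' j : ℤ, ENNReal.ofReal (Real.exp (-θ * |p - j|)) ≤ K₁ := by
    intro p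
    simp only [abs_sub_comm p]
    exact hK₁ ℤ _ hprog p
  have hsum : ∑' n, ‖c n‖ₑ ^ 2 ≤ 2 * (A * 2) * K₁ * ∑' i, y i ^ 2 +
      2⁻¹ * ∑' n, ‖c n‖ₑ ^ 2 := by
    have hεA := hε₀A ε hε.le (min_le_left _ _)
    calc ∑' n, ‖c n‖ₑ ^ 2 ≤ _ := ENNReal.tsum_le_tsum hj
      _ = 2 * (A * 2) * ∑' i, (∑' j : ℤ, ENNReal.ofReal (Real.exp (-θ * |u i / (1 - ε) - j|))) *
            y i ^ 2 +
          ENNReal.ofReal ε ^ 2 * (2 * (A * (4 * (ENNReal.ofReal κ ^ 2 * (R₁ * R₂))))) *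
          ∑' n : ℤ, (∑' j : ℤ, ENNReal.ofReal (Real.exp (-θ * |(n : ℝ) - j|))) * ‖c n‖ₑ ^ 2 := by
          rw [ENNReal.tsum_add, ENNReal.tsum_mul_left, ENNReal.tsum_mul_left, ENNReal.tsum_comm]
          congr 2
          · simp_rw [ENNReal.tsum_mul_right]
          · rw [ENNReal.tsum_comm]; simp_rw [ENNReal.tsum_mul_right]
      _ ≤ 2 * (A * 2) * ∑' i, K₁ * y i ^ 2 +
          ENNReal.ofReal ε ^ 2 * (2 * (A * (4 * (ENNReal.ofReal κ ^ 2 * (R₁ * R₂))))) *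
          ∑' n : ℤ, K₁ * ‖c n‖ₑ ^ 2 := by
          gcongr
          · exact hcol _
          · exact hcol _
      _ = 2 * (A * 2) * K₁ * ∑' i, y i ^ 2 +
          ENNReal.ofReal ε ^ 2 * (2 * (A * (4 * (ENNReal.ofReal κ ^ 2 * (R₁ * R₂)))) * K₁) *
          ∑' n : ℤ, ‖c n‖ₑ ^ 2 := by
          rw [ENNReal.tsum_mul_left, ENNReal.tsum_mul_left]; ring
      _ ≤ _ := by
          gcongr
          push_cast at hεA
          exact hεA
  refine (ENNReal.le_two_mul_of_le_add_half hcfin hsum).trans_eq ?_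
  push_cast
  ring

end LocalizedWindow

lemma SeparatedFamily.finite_preimage_Icc {ι : Type} {u : ι → ℝ} {δ : ℝ} (hδ : 0 < δ)
    (hu : SeparatedFamily δ u) (x y : ℝ) : {i | u i ∈ Set.Icc x y}.Finite := by
  refine Set.Finite.of_finite_image ((Set.finite_Icc ⌊x / δ⌋ ⌊y / δ⌋).subset ?_)
    (hu.floor_injective hδ).injOn
  rintro _ ⟨i, hi, rfl⟩
  exact ⟨Int.floor_le_floor (by have := hi.1; gcongr), Int.floor_le_floor (by have := hi.2; gcongr)⟩

/-- A homogeneous linear system with more unknowns than equations has a nonzero solution. -/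
lemma exists_ne_zero_forall_sum_eq_zero {ι κ : Type} (N : Finset κ) (I : Finset ι)
    (hIN : I.card < N.card) (m : ι → κ → ℂ) :
    ∃ c : κ → ℂ, Function.support c ⊆ N ∧ c ≠ 0 ∧ ∀ i ∈ I, ∑ n ∈ N, c n * m i n = 0 := by
  classical
  let f : (N → ℂ) →ₗ[ℂ] (I → ℂ) := Matrix.toLin' (Matrix.of fun (i : I) (n : N) => m i n)
  have hker : f.ker ≠ ⊥ := LinearMap.ker_ne_bot_of_finrank_lt (by simpa using hIN)
  obtain ⟨v, hv, hv0⟩ := f.ker.ne_bot_iff.1 hker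
  refine ⟨fun n => if hn : n ∈ N then v ⟨n, hn⟩ else 0, fun n hn => ?_, fun h0 => hv0 ?_, ?_⟩
  · by_contra hnN
    have hnN' : n ∉ N := hnN
    simp [hnN'] at hn
  · funext n
    simpa using congrFun h0 n
  · intro i hi
    have h1 := congrFun (LinearMap.mem_ker.1 hv) ⟨i, hi⟩
    simp only [f, Matrix.toLin'_apply, Matrix.mulVec, dotProduct, Matrix.of_apply,
      Pi.zero_apply] at h1
    rw [← h1, ← Finset.sum_coe_sort N]
    refine Finset.sum_congr rfl fun n _ => ?_
    simp [mul_comm]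

namespace LocalizedWindow

variable {h : ℝ → ℂ} {σ ρ K : ℝ}

lemma exists_node_count_le (w : LocalizedWindow h σ ρ K) {ι : Type} {u : ι → ℝ} {δ : ℝ}
    (hδ : 0 < δ) (hu : SeparatedFamily δ u) {τ : ℝ} (hτ : 0 < τ) {A : ℝ≥0}
    (hA : ∀ c : ℤ → ℂ, c.support.Finite →
      ∑' n, ‖c n‖ₑ ^ 2 ≤ A * ∑' i, ‖∑' n : ℤ, c n * h (u i - τ * n)‖ₑ ^ 2) :
    ∃ r : ℝ, ∀ x y : ℝ, ∀ N : Finset ℤ, (∀ n ∈ N, τ * n ∈ Set.Icc (x + r) (y - r)) →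
      N.card ≤ {i | u i ∈ Set.Icc x y}.ncard := by
  have hσ := w.σ_pos
  have hK := w.K_pos
  obtain ⟨R₁, hR₁⟩ := exists_tsum_exp_neg_abs_le (half_pos hσ) hτ
  obtain ⟨R₂, hR₂⟩ := exists_tsum_exp_neg_abs_le (half_pos hσ) hδ
  obtain ⟨q, hq, hqA⟩ := exists_pos_ofReal_sq_mul_le_half (A * (R₁ * R₂))
  obtain ⟨r, hr⟩ : ∃ r : ℝ, K * Real.exp (-(σ / 2) * r) ≤ q := by
    refine ⟨-(2 / σ) * Real.log (q / K), ?_⟩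
    have e : -(σ / 2) * (-(2 / σ) * Real.log (q / K)) = Real.log (q / K) := by field_simp
    rw [e, Real.exp_log (by positivity)]
    exact le_of_eq (by field_simp)
  refine ⟨r, fun x y N hN => ?_⟩
  have hfin := hu.finite_preimage_Icc hδ x y
  rw [Set.ncard_eq_toFinset_card _ hfin]
  by_contra! hlt
  obtain ⟨c, hcN, hc0, hcI⟩ := exists_ne_zero_forall_sum_eq_zero N hfin.toFinset hlt
    (fun i (n : ℤ) => h (u i - τ * n))
  have hcs : c.support.Finite := N.finite_toSet.subset hcN
  have hcout : ∀ n, n ∉ N → c n = 0 := fun n hn => by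
    by_contra h0; exact hn (hcN h0)
  have hcfin : ∑' n, ‖c n‖ₑ ^ 2 ≠ ⊤ := by
    rw [tsum_eq_sum (s := N) (fun n hn => by simp [hcout n hn])]
    exact ENNReal.sum_ne_top.2 fun n _ => ENNReal.pow_ne_top enorm_ne_top
  have hnode : SeparatedFamily τ (fun n : ℤ => τ * (n : ℝ)) := by
    simpa using separatedFamily_progression hτ 0
  set E : ι → ℤ → ℝ≥0∞ := fun i n =>
    ENNReal.ofReal (Real.exp (-(σ / 2) * |u i - τ * n|)) with hE
  have hErow : ∀ i, ∑' n, E i n ≤ R₁ := fun i => by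
    simp only [hE, abs_sub_comm (u i)]
    exact hR₁ ℤ _ hnode (u i)
  have hEcol : ∀ n, ∑' i, E i n ≤ R₂ := fun n => hR₂ ι u hu _
  have hpt : ∀ i, ‖∑' n : ℤ, c n * h (u i - τ * n)‖ₑ ≤
      ∑' n, ENNReal.ofReal q * E i n * ‖c n‖ₑ := by
    intro i
    by_cases hi : u i ∈ Set.Icc x y
    · rw [tsum_eq_sum (s := N) (fun n hn => by simp [hcout n hn]), hcI i (by simpa using hi)]
      simp
    · refine enorm_tsum_le_tsum_enorm.trans (ENNReal.tsum_le_tsum fun n => ?_)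
      by_cases hn : n ∈ N
      · rw [enorm_mul, mul_comm]
        gcongr
        rw [← ofReal_norm, hE, ← ENNReal.ofReal_mul hq.le]
        refine ENNReal.ofReal_le_ofReal ((w.norm_le _).trans ?_)
        have hr' : r ≤ |u i - τ * n| := by
          obtain ⟨h1, h2⟩ := hN n hn
          rw [Set.mem_Icc, not_and_or, not_le, not_le] at hi
          rcases hi with hi | hi
          · exact le_trans (by linarith) (neg_le_abs _)
          · exact le_trans (by linarith) (le_abs_self _)
        calc K * Real.exp (-σ * |u i - τ * n|) ≤
            K * Real.exp (-(σ / 2) * r + -(σ / 2) * |u i - τ * n|) := by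
              gcongr; nlinarith
          _ = K * Real.exp (-(σ / 2) * r) * Real.exp (-(σ / 2) * |u i - τ * n|) := by
              rw [Real.exp_add]; ring
          _ ≤ _ := by gcongr
      · simp [hcout n hn]
  have hX : ∑' n, ‖c n‖ₑ ^ 2 ≤ 0 + 2⁻¹ * ∑' n, ‖c n‖ₑ ^ 2 := by
    have hqq := hqA q hq.le le_rfl
    calc ∑' n, ‖c n‖ₑ ^ 2 ≤ A * ∑' i, ‖∑' n : ℤ, c n * h (u i - τ * n)‖ₑ ^ 2 := hA c hcs
      _ ≤ A * ∑' i, (∑' n, ENNReal.ofReal q * E i n * ‖c n‖ₑ) ^ 2 := by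
          gcongr with i
          exact hpt i
      _ ≤ A * (ENNReal.ofReal q * R₁ * (ENNReal.ofReal q * R₂) * ∑' n, ‖c n‖ₑ ^ 2) := by
          gcongr
          refine ENNReal.tsum_sq_tsum_mul_le _ _ (fun i => ?_) (fun n => ?_)
          · rw [ENNReal.tsum_mul_left]; gcongr; exact hErow i
          · rw [ENNReal.tsum_mul_left]; gcongr; exact hEcol n
      _ = ENNReal.ofReal q ^ 2 * (A * (R₁ * R₂)) * ∑' n, ‖c n‖ₑ ^ 2 := by ring
      _ ≤ _ := by
          rw [zero_add]
          gcongr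
          push_cast at hqq
          exact hqq
  have h0 := ENNReal.le_two_mul_of_le_add_half hcfin hX
  rw [mul_zero, nonpos_iff_eq_zero, ENNReal.tsum_eq_zero] at h0
  refine hc0 (funext fun n => ?_)
  have := h0 n
  rwa [pow_eq_zero_iff two_ne_zero, enorm_eq_zero] at this

/-- The sampling inequality on a dense set of fibers forces density strictly larger than one. -/
theorem exists_one_lt_density (w : LocalizedWindow h σ ρ K) {ι : Type} {u : ι → ℝ} {δ : ℝ}
    (hδ : 0 < δ) (hu : SeparatedFamily δ u) {A : ℝ≥0}
    (hA : ∀ c : ℤ → ℂ, c.support.Finite → ∀ t ε : ℝ, 0 < ε → ∃ s ∈ Set.Ico t (t + ε),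
      ∑' n, ‖c n‖ₑ ^ 2 ≤ A * ∑' i, ‖∑' n : ℤ, c n * h (u i - s - n)‖ₑ ^ 2) :
    ∃ β L₀ : ℝ, 1 < β ∧ ∀ L, L₀ ≤ L → ∀ x : ℝ,
      β * L ≤ ({i | u i ∈ Set.Icc x (x + L)}.ncard : ℝ) := by
  obtain ⟨τ, A', hτ, hτ1, hA'⟩ := w.exists_contracted_lower_bound hδ hu hA
  obtain ⟨r, hr⟩ := w.exists_node_count_le hδ hu hτ hA'
  set β := (1 + τ⁻¹) / 2 with hβ
  have hinv : 1 < τ⁻¹ := (one_lt_inv₀ hτ).2 hτ1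
  have hgap : 0 < τ⁻¹ - β := by rw [hβ]; linarith
  refine ⟨β, (2 * r * τ⁻¹ + 1) / (τ⁻¹ - β), by rw [hβ]; linarith, fun L hL x => ?_⟩
  have hcount := hr x (x + L) (Finset.Icc ⌈(x + r) / τ⌉ ⌊(x + L - r) / τ⌋) (fun n hn => by
    rw [Finset.mem_Icc, Int.ceil_le, Int.le_floor, div_le_iff₀ hτ, le_div_iff₀ hτ] at hn
    constructor <;> linarith [hn.1, hn.2])
  have h1 : (x + L - r) / τ - (x + r) / τ - 1 ≤
      ((Finset.Icc ⌈(x + r) / τ⌉ ⌊(x + L - r) / τ⌋).card : ℝ) := by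
    rw [Int.card_Icc]
    have h2 := Int.ceil_lt_add_one ((x + r) / τ)
    have h3 := Int.lt_floor_add_one ((x + L - r) / τ)
    have h4 : ((⌊(x + L - r) / τ⌋ + 1 - ⌈(x + r) / τ⌉ : ℤ) : ℝ) ≤
        ((⌊(x + L - r) / τ⌋ + 1 - ⌈(x + r) / τ⌉).toNat : ℝ) := by
      exact_mod_cast Int.self_le_toNat _
    push_cast at h4
    linarith
  have h2 : (x + L - r) / τ - (x + r) / τ = (L - 2 * r) * τ⁻¹ := by field_simp; ring
  rw [div_le_iff₀ hgap] at hL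
  have h3 : ((Finset.Icc ⌈(x + r) / τ⌉ ⌊(x + L - r) / τ⌋).card : ℝ) ≤
    ({i | u i ∈ Set.Icc x (x + L)}.ncard : ℝ) := by exact_mod_cast hcount
  nlinarith

end LocalizedWindow

/-! ### Periodization of the coefficients -/

lemma lintegral_eq_lintegral_Ioc_tsum_int_add {φ : ℝ → ℝ≥0∞} (hφ : AEMeasurable φ) :
    ∫⁻ t, φ t = ∫⁻ t in Set.Ioc (0 : ℝ) 1, ∑' n : ℤ, φ (t + n) := by
  have hmp : ∀ n : ℤ, MeasurePreserving (fun t : ℝ => t + n) volume volume := fun n =>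
    measurePreserving_add_right volume (n : ℝ)
  have hme : ∀ n : ℤ, MeasurableEmbedding (fun t : ℝ => t + n) := fun n =>
    measurableEmbedding_addRight (n : ℝ)
  have hm : ∀ n : ℤ, AEMeasurable (fun t : ℝ => φ (t + n))
      (volume.restrict (Set.Ioc (0 : ℝ) 1)) := fun n =>
    (hφ.comp_quasiMeasurePreserving (hmp n).quasiMeasurePreserving).restrict
  rw [lintegral_tsum hm, ← setLIntegral_univ, ← iUnion_Ioc_add_intCast (0 : ℝ),
    lintegral_iUnion (fun n => measurableSet_Ioc) (Set.pairwise_disjoint_Ioc_add_intCast (0 : ℝ))]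
  congr 1 with n
  rw [← (hmp n).setLIntegral_comp_preimage_emb (hme n)]
  congr 2
  rw [Set.preimage_add_const_Ioc]
  ring_nf

/-- Modulated coefficients `∫ f(t) e^{2πikt} h(x - t) dt`. -/
def latticeCoef (h f : ℝ → ℂ) (x : ℝ) (k : ℤ) : ℂ :=
  ∫ t : ℝ, f t * (Complex.exp (2 * Real.pi * Complex.I * k * t) * h (x - t))

namespace LocalizedWindow

variable {h : ℝ → ℂ} {σ ρ K : ℝ}

lemma lintegral_sq_tsum_enorm_lt_top (w : LocalizedWindow h σ ρ K) {f : ℝ → ℂ}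
    (hf : MemLp f 2 volume) (x : ℝ) :
    ∫⁻ t in Set.Ioc (0 : ℝ) 1, (∑' n : ℤ, ‖f (t + n) * h (x - t - n)‖ₑ) ^ 2 < ⊤ := by
  obtain ⟨R, hR⟩ := w.exists_tsum_enorm_le one_pos
  have hRt : ∀ t : ℝ, ∑' n : ℤ, ‖h (x - t - n)‖ₑ ≤ R := fun t => by
    have := (hR ℤ _ (separatedFamily_progression one_pos (0 : ℝ)) (x - t)).2
    simpa using this
  have hf2 : ∫⁻ t, ‖f t‖ₑ ^ 2 < ⊤ := by
    have := (eLpNorm_lt_top_iff_lintegral_rpow_enorm_lt_top two_ne_zero ENNReal.ofNat_ne_top).1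
      hf.eLpNorm_lt_top
    simpa using this
  calc ∫⁻ t in Set.Ioc (0 : ℝ) 1, (∑' n : ℤ, ‖f (t + n) * h (x - t - n)‖ₑ) ^ 2
      ≤ ∫⁻ t in Set.Ioc (0 : ℝ) 1, (R : ℝ≥0∞) * R * ∑' n : ℤ, ‖f (t + n)‖ₑ ^ 2 := by
        refine lintegral_mono fun t => ?_
        have h1 := ENNReal.tsum_mul_sq_le (fun n : ℤ => ‖h (x - t - n)‖ₑ) (fun n => ‖f (t + n)‖ₑ)
        simp only [enorm_mul]
        calc (∑' n : ℤ, ‖f (t + n)‖ₑ * ‖h (x - t - n)‖ₑ) ^ 2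
            = (∑' n : ℤ, ‖h (x - t - n)‖ₑ * ‖f (t + n)‖ₑ) ^ 2 := by simp only [mul_comm]
          _ ≤ _ := h1
          _ ≤ R * ∑' n : ℤ, R * ‖f (t + n)‖ₑ ^ 2 := by
              gcongr with n
              · exact hRt t
              · exact (ENNReal.le_tsum n).trans (hRt t)
          _ = _ := by rw [ENNReal.tsum_mul_left, mul_assoc]
    _ = (R : ℝ≥0∞) * R * ∫⁻ t, ‖f t‖ₑ ^ 2 := by
        rw [lintegral_const_mul',
          ← lintegral_eq_lintegral_Ioc_tsum_int_add (φ := fun t => ‖f t‖ₑ ^ 2)]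
        · exact hf.aestronglyMeasurable.enorm.pow_const 2
        · exact ENNReal.mul_ne_top ENNReal.coe_ne_top ENNReal.coe_ne_top
    _ < ⊤ := ENNReal.mul_lt_top (ENNReal.mul_lt_top ENNReal.coe_lt_top ENNReal.coe_lt_top) hf2

lemma lintegral_tsum_enorm_lt_top (w : LocalizedWindow h σ ρ K) {f : ℝ → ℂ}
    (hf : MemLp f 2 volume) (x : ℝ) :
    ∫⁻ t in Set.Ioc (0 : ℝ) 1, (∑' n : ℤ, ‖f (t + n) * h (x - t - n)‖ₑ) < ⊤ := by
  calc ∫⁻ t in Set.Ioc (0 : ℝ) 1, (∑' n : ℤ, ‖f (t + n) * h (x - t - n)‖ₑ)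
      ≤ ∫⁻ t in Set.Ioc (0 : ℝ) 1, (1 + (∑' n : ℤ, ‖f (t + n) * h (x - t - n)‖ₑ) ^ 2) := by
        refine lintegral_mono fun t => ?_
        generalize (∑' n : ℤ, ‖f (t + n) * h (x - t - n)‖ₑ) = S
        rcases le_total S 1 with hS | hS
        · exact hS.trans le_self_add
        · exact (le_self_pow₀ hS two_ne_zero).trans le_add_self
    _ = 1 + ∫⁻ t in Set.Ioc (0 : ℝ) 1, (∑' n : ℤ, ‖f (t + n) * h (x - t - n)‖ₑ) ^ 2 := by
        rw [lintegral_add_left measurable_const]; simp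
    _ < ⊤ := ENNReal.add_lt_top.2 ⟨ENNReal.one_lt_top, w.lintegral_sq_tsum_enorm_lt_top hf x⟩

lemma aestronglyMeasurable_mul (w : LocalizedWindow h σ ρ K) {f : ℝ → ℂ}
    (hf : MemLp f 2 volume) (x : ℝ) (k : ℤ) :
    AEStronglyMeasurable
      (fun t : ℝ => f t * (Complex.exp (2 * Real.pi * Complex.I * k * t) * h (x - t))) := by
  refine hf.aestronglyMeasurable.mul (Continuous.aestronglyMeasurable ?_)
  have := w.continuous
  fun_prop

lemma enorm_modulation_mul (k : ℤ) (t : ℝ) (z : ℂ) :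
    ‖Complex.exp (2 * Real.pi * Complex.I * k * t) * z‖ₑ = ‖z‖ₑ := by
  rw [enorm_mul]
  have : ‖Complex.exp (2 * Real.pi * Complex.I * k * t)‖ = 1 := by
    rw [show (2 * Real.pi * Complex.I * k * t : ℂ) = ((2 * Real.pi * k * t : ℝ) : ℂ) * Complex.I by
      push_cast; ring, Complex.norm_exp_ofReal_mul_I]
  rw [← ofReal_norm (Complex.exp _), this]
  simp

lemma integrable_mul (w : LocalizedWindow h σ ρ K) {f : ℝ → ℂ}
    (hf : MemLp f 2 volume) (x : ℝ) (k : ℤ) :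
    Integrable (fun t : ℝ => f t * (Complex.exp (2 * Real.pi * Complex.I * k * t) * h (x - t))) := by
  refine ⟨w.aestronglyMeasurable_mul hf x k, ?_⟩
  rw [hasFiniteIntegral_iff_enorm]
  simp only [enorm_mul (f _), enorm_modulation_mul]
  rw [lintegral_eq_lintegral_Ioc_tsum_int_add]
  · convert w.lintegral_tsum_enorm_lt_top hf x using 4 with t
    ext n
    rw [enorm_mul, sub_sub]
  · exact hf.aestronglyMeasurable.enorm.mul
      (w.continuous.comp (by fun_prop)).aestronglyMeasurable.enorm

lemma memLp_periodization (w : LocalizedWindow h σ ρ K) {f : ℝ → ℂ}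
    (hf : MemLp f 2 volume) (x : ℝ) :
    MemLp (fun t : ℝ => ∑' n : ℤ, f (t + n) * h (x - t - n)) 2
      (volume.restrict (Set.Ioc (0 : ℝ) 1)) := by
  have hm : ∀ n : ℤ, AEStronglyMeasurable (fun t : ℝ => f (t + n) * h (x - t - n)) := fun n => by
    refine AEStronglyMeasurable.mul ?_ (w.continuous.comp (by fun_prop)).aestronglyMeasurable
    exact hf.aestronglyMeasurable.comp_quasiMeasurePreserving
      (measurePreserving_add_right volume (n : ℝ)).quasiMeasurePreserving
  refine ⟨(AEStronglyMeasurable.tsum hm).restrict, ?_⟩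
  rw [eLpNorm_lt_top_iff_lintegral_rpow_enorm_lt_top two_ne_zero ENNReal.ofNat_ne_top]
  simp only [ENNReal.toReal_ofNat, ENNReal.rpow_ofNat]
  refine lt_of_le_of_lt (lintegral_mono fun t => ?_) (w.lintegral_sq_tsum_enorm_lt_top hf x)
  gcongr
  exact enorm_tsum_le_tsum_enorm

lemma latticeCoef_eq_fourierCoeffOn (w : LocalizedWindow h σ ρ K) {f : ℝ → ℂ}
    (hf : MemLp f 2 volume) (x : ℝ) (k : ℤ) :
    latticeCoef h f x k = fourierCoeffOn (zero_lt_one : (0 : ℝ) < 1)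
      (fun t : ℝ => ∑' n : ℤ, f (t + n) * h (x - t - n)) (-k) := by
  have hshift : ∀ (t : ℝ) (n : ℤ), Complex.exp (2 * Real.pi * Complex.I * k * ((t + n : ℝ) : ℂ)) =
      Complex.exp (2 * Real.pi * Complex.I * k * t) := fun t n => by
    rw [show (2 * Real.pi * Complex.I * k * ((t + n : ℝ) : ℂ)) =
      2 * Real.pi * Complex.I * k * t + ((k * n : ℤ) : ℂ) * (2 * Real.pi * Complex.I) by
        push_cast; ring, Complex.exp_add, Complex.exp_int_mul_two_pi_mul_I, mul_one]
  rw [latticeCoef, ← (w.integrable_mul hf x k).hasSum_intervalIntegral_comp_add_int.tsum_eq,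
    fourierCoeffOn_eq_integral]
  simp only [intervalIntegral.integral_of_le zero_le_one, sub_zero, div_one, one_smul, neg_neg]
  rw [← integral_tsum]
  · refine setIntegral_congr_fun measurableSet_Ioc fun t _ => ?_
    simp only [hshift, smul_eq_mul]
    rw [← tsum_mul_left]
    congr 1 with n
    rw [fourier_coe_apply]
    rw [show (x - (t + n) : ℝ) = x - t - n by ring]
    push_cast
    rw [sub_zero, div_one]
    ring
  · intro n
    exact ((w.aestronglyMeasurable_mul hf x k).comp_quasiMeasurePreserving
      (measurePreserving_add_right volume (n : ℝ)).quasiMeasurePreserving).restrict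
  · rw [← lintegral_tsum]
    · refine ne_of_lt (lt_of_le_of_lt (le_of_eq ?_) (w.lintegral_tsum_enorm_lt_top hf x))
      refine setLIntegral_congr_fun measurableSet_Ioc fun t _ => ?_
      congr 1 with n
      rw [enorm_mul, enorm_modulation_mul, enorm_mul, show (x - (t + n) : ℝ) = x - t - n by ring]
    · intro n
      exact ((w.aestronglyMeasurable_mul hf x k).comp_quasiMeasurePreserving
        (measurePreserving_add_right volume (n : ℝ)).quasiMeasurePreserving).restrict.enorm

/-- Parseval's identity for the coefficients along a vertical lattice. -/
theorem tsum_enorm_sq_latticeCoef (w : LocalizedWindow h σ ρ K) {f : ℝ → ℂ}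
    (hf : MemLp f 2 volume) (x : ℝ) :
    ∑' k : ℤ, ‖latticeCoef h f x k‖ₑ ^ 2 =
      ∫⁻ t in Set.Ioc (0 : ℝ) 1, ‖∑' n : ℤ, f (t + n) * h (x - t - n)‖ₑ ^ 2 := by
  have hL := w.memLp_periodization hf x
  have hs := hasSum_sq_fourierCoeffOn (zero_lt_one : (0 : ℝ) < 1) hL
  rw [sub_zero, inv_one, one_smul, intervalIntegral.integral_of_le zero_le_one] at hs
  have key : ∀ z : ℂ, ‖z‖ₑ ^ 2 = ENNReal.ofReal (‖z‖ ^ 2) := fun z => by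
    rw [ENNReal.ofReal_pow (norm_nonneg _), ofReal_norm]
  simp only [w.latticeCoef_eq_fourierCoeffOn hf x, key]
  rw [← ofReal_integral_eq_lintegral_ofReal (hL.integrable_norm_pow two_ne_zero)
    (Eventually.of_forall fun _ => by positivity), ← hs.tsum_eq,
    ENNReal.ofReal_tsum_of_nonneg (fun _ => by positivity) hs.summable]
  exact (Equiv.neg ℤ).tsum_eq (fun k => ENNReal.ofReal (‖fourierCoeffOn (zero_lt_one : (0 : ℝ) < 1)
      (fun t : ℝ => ∑' n : ℤ, f (t + n) * h (x - t - n)) k‖ ^ 2))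

end LocalizedWindow

/-! ### Frame bounds and fiberwise sampling -/

lemma SeparatedFamily.countable {ι : Type} {δ : ℝ} {u : ι → ℝ} (hu : SeparatedFamily δ u)
    (hδ : 0 < δ) : Countable ι :=
  (hu.floor_injective hδ).countable

lemma MeasureTheory.MemLp.lintegral_enorm_sq_lt_top {f : ℝ → ℂ} (hf : MemLp f 2 volume) :
    ∫⁻ t, ‖f t‖ₑ ^ 2 < ⊤ := by
  have := (eLpNorm_lt_top_iff_lintegral_rpow_enorm_lt_top two_ne_zero ENNReal.ofNat_ne_top).1
    hf.eLpNorm_lt_top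
  simpa using this

lemma MeasureTheory.MemLp.lintegral_enorm_sq_eq {f : ℝ → ℂ} (hf : MemLp f 2 volume) :
    ∫⁻ t, ‖f t‖ₑ ^ 2 = ∫⁻ t in Set.Ioc (0 : ℝ) 1, ∑' n : ℤ, ‖f (t + n)‖ₑ ^ 2 :=
  lintegral_eq_lintegral_Ioc_tsum_int_add (φ := fun t => ‖f t‖ₑ ^ 2)
    (hf.aestronglyMeasurable.enorm.pow_const 2)

namespace LocalizedWindow

variable {h : ℝ → ℂ} {σ ρ K : ℝ} {ι : Type} {u : ι → ℝ} {δ : ℝ}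

lemma tsum_tsum_enorm_sq_latticeCoef (w : LocalizedWindow h σ ρ K) (hδ : 0 < δ)
    (hu : SeparatedFamily δ u) {f : ℝ → ℂ} (hf : MemLp f 2 volume) :
    ∑' i, ∑' k : ℤ, ‖latticeCoef h f (u i) k‖ₑ ^ 2 =
      ∫⁻ t in Set.Ioc (0 : ℝ) 1, ∑' i, ‖∑' n : ℤ, f (t + n) * h (u i - t - n)‖ₑ ^ 2 := by
  have := hu.countable hδ
  rw [lintegral_tsum fun i => (w.memLp_periodization hf (u i)).aestronglyMeasurable.enorm.pow_const 2]
  congr 1 with i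
  exact w.tsum_enorm_sq_latticeCoef hf (u i)

/-- The Bessel bound holds over every separated family. -/
lemma exists_bessel_bound (w : LocalizedWindow h σ ρ K) (hδ : 0 < δ)
    (hu : SeparatedFamily δ u) :
    ∃ B : ℝ≥0, ∀ f : ℝ → ℂ, MemLp f 2 volume →
      ∑' i, ∑' k : ℤ, ‖latticeCoef h f (u i) k‖ₑ ^ 2 ≤ B * ∫⁻ t, ‖f t‖ₑ ^ 2 := by
  obtain ⟨B, hB⟩ := w.exists_tsum_enorm_sq_le hδ one_pos
  refine ⟨B, fun f hf => ?_⟩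
  rw [w.tsum_tsum_enorm_sq_latticeCoef hδ hu hf, hf.lintegral_enorm_sq_eq,
    ← lintegral_const_mul' _ _ ENNReal.coe_ne_top]
  refine lintegral_mono fun t => ?_
  simpa using hB ι u hu t fun n => f (t + n)

/-- The lower frame bound passes to the fibers. -/
lemma exists_fiber_lower_bound (w : LocalizedWindow h σ ρ K) (hδ : 0 < δ)
    (hu : SeparatedFamily δ u) {A : ℝ≥0}
    (hA : ∀ f : ℝ → ℂ, MemLp f 2 volume →
      ∫⁻ t, ‖f t‖ₑ ^ 2 ≤ A * ∑' i, ∑' k : ℤ, ‖latticeCoef h f (u i) k‖ₑ ^ 2)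
    (c : ℤ → ℂ) (hc : c.support.Finite) (t₀ ε : ℝ) (hε : 0 < ε) :
    ∃ s ∈ Set.Ico t₀ (t₀ + ε),
      ∑' n, ‖c n‖ₑ ^ 2 ≤ A * ∑' i, ‖∑' n : ℤ, c n * h (u i - s - n)‖ₑ ^ 2 := by
  set m := ⌊t₀⌋ with hm
  set p := Int.fract t₀ with hp
  set q := p + min ε (1 - p) with hq
  have hp0 : 0 ≤ p := Int.fract_nonneg t₀
  have hp1 : p < 1 := Int.fract_lt_one t₀
  have hpm : t₀ = p + m := by rw [hp, hm, Int.fract_add_floor]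
  have hpq : p < q := lt_add_of_pos_right _ (lt_min hε (by linarith))
  have hq1 : q ≤ 1 := by have := min_le_right ε (1 - p); linarith
  have hqε : q ≤ p + ε := by have := min_le_left ε (1 - p); linarith
  set S := ∑' n, ‖c n‖ₑ ^ 2 with hS
  have hSfin : S ≠ ⊤ := by
    rw [hS, tsum_eq_sum (s := hc.toFinset) fun n hn => by
      have : c n = 0 := by simpa using hn
      simp [this]]
    exact ENNReal.sum_ne_top.2 fun n _ => by simp
  set f : ℝ → ℂ := fun t => if Int.fract t ∈ Set.Ioo p q then c (⌊t⌋ - m) else 0 with hfdef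
  have hfm : Measurable f := by
    refine Measurable.ite (measurable_fract measurableSet_Ioo) ?_ measurable_const
    exact (measurable_of_countable fun k : ℤ => c (k - m)).comp Int.measurable_floor
  have hft : ∀ t ∈ Set.Ioc (0 : ℝ) 1, ∀ n : ℤ,
      f (t + n) = if t ∈ Set.Ioo p q then c (n - m) else 0 := by
    intro t ht n
    rcases ht.2.lt_or_eq with h1 | h1
    · have h2 : ⌊t⌋ = 0 := Int.floor_eq_zero_iff.2 ⟨ht.1.le, h1⟩
      have h3 : Int.fract t = t := Int.fract_eq_self.2 ⟨ht.1.le, h1⟩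
      simp only [hfdef, Int.fract_add_intCast, Int.floor_add_intCast, h2, h3, zero_add]
    · subst h1
      have h2 : Int.fract ((1 : ℝ) + n) = 0 := by simp
      have h3 : ¬ ((0 : ℝ) ∈ Set.Ioo p q) := fun h => absurd h.1 (not_lt.2 hp0)
      have h4 : ¬ ((1 : ℝ) ∈ Set.Ioo p q) := fun h => absurd h.2 (not_lt.2 hq1)
      simp only [hfdef, h2, if_neg h3, if_neg h4]
  have hIoo : Set.Ioo p q ⊆ Set.Ioc (0 : ℝ) 1 := fun t ht =>
    ⟨hp0.trans_lt ht.1, (ht.2.trans_le hq1).le⟩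
  have hrestr : (volume.restrict (Set.Ioc (0 : ℝ) 1)).restrict (Set.Ioo p q) =
      volume.restrict (Set.Ioo p q) := by
    rw [Measure.restrict_restrict measurableSet_Ioo, Set.inter_eq_left.2 hIoo]
  have hnorm : ∫⁻ t, ‖f t‖ₑ ^ 2 = ∫⁻ t in Set.Ioo p q, S := by
    rw [lintegral_eq_lintegral_Ioc_tsum_int_add (φ := fun t => ‖f t‖ₑ ^ 2)
      (hfm.enorm.pow_const 2).aemeasurable, ← hrestr, ← lintegral_indicator measurableSet_Ioo]
    refine setLIntegral_congr_fun measurableSet_Ioc fun t ht => ?_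
    simp only [hft t ht]
    by_cases hmem : t ∈ Set.Ioo p q
    · simp only [if_pos hmem, Set.indicator_of_mem hmem]
      exact (Equiv.subRight m).tsum_eq fun n => ‖c n‖ₑ ^ 2
    · simp only [if_neg hmem, Set.indicator_of_notMem hmem]
      simp
  have hmem : MemLp f 2 volume := by
    refine ⟨hfm.aestronglyMeasurable, ?_⟩
    rw [eLpNorm_lt_top_iff_lintegral_rpow_enorm_lt_top two_ne_zero ENNReal.ofNat_ne_top]
    simp only [ENNReal.toReal_ofNat, ENNReal.rpow_ofNat]
    rw [hnorm, setLIntegral_const]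
    exact ENNReal.mul_lt_top hSfin.lt_top (by simp)
  set G : ℝ → ℝ≥0∞ := fun s => A * ∑' i, ‖∑' n : ℤ, c n * h (u i - (s + m) - n)‖ₑ ^ 2 with hG
  have hlow : ∫⁻ t in Set.Ioo p q, S ≤ ∫⁻ t in Set.Ioo p q, G t := by
    rw [← hnorm]
    refine (hA f hmem).trans (le_of_eq ?_)
    rw [w.tsum_tsum_enorm_sq_latticeCoef hδ hu hmem, ← lintegral_const_mul' _ _ ENNReal.coe_ne_top,
      ← hrestr, ← lintegral_indicator measurableSet_Ioo]
    refine setLIntegral_congr_fun measurableSet_Ioc fun t ht => ?_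
    simp only [hft t ht]
    by_cases hmem : t ∈ Set.Ioo p q
    · simp only [if_pos hmem, Set.indicator_of_mem hmem, hG]
      congr 3 with i
      congr 2
      rw [← (Equiv.subRight m).tsum_eq fun n => c n * h (u i - (t + m) - n)]
      congr 1 with n
      simp only [Equiv.subRight_apply]
      push_cast
      ring_nf
    · simp only [if_neg hmem, Set.indicator_of_notMem hmem]
      simp
  by_contra! hcon
  have hlt : ∀ t ∈ Set.Ioo p q, G t < S := fun t ht =>
    hcon (t + m) ⟨by linarith [ht.1], by linarith [ht.2]⟩
  refine absurd hlow (not_le.2 ?_)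
  refine setLIntegral_strict_mono measurableSet_Ioo (by simpa using hpq) measurable_const ?_
    (Eventually.of_forall hlt)
  refine ne_top_of_le_ne_top ?_ (setLIntegral_mono measurable_const fun t ht => (hlt t ht).le)
  rw [setLIntegral_const]
  exact ENNReal.mul_ne_top hSfin (by simp)

end LocalizedWindow

/-- Points with at least `M + 1` members in every interval of length `M` yield a lower frame
bound. -/
lemma SechWindow.exists_lower_bound {h : ℝ → ℂ} {C a b κ : ℂ} (w : SechWindow h C a b κ)
    {ι : Type} {u : ι → ℝ} {δ : ℝ} (hδ : 0 < δ) (hu : SeparatedFamily δ u) {M : ℕ} (hM : 1 ≤ M)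
    (hdens : ∀ y : ℝ, ∃ F : Finset ι, F.card = M + 1 ∧ ∀ i ∈ F, u i ∈ Set.Ico y (y + M)) :
    ∃ A : ℝ≥0, ∀ f : ℝ → ℂ, MemLp f 2 volume →
      ∫⁻ t, ‖f t‖ₑ ^ 2 ≤ A * ∑' i, ∑' k : ℤ, ‖latticeCoef h f (u i) k‖ₑ ^ 2 := by
  obtain ⟨σ, ρ, K, wl⟩ := w.exists_localized
  obtain ⟨A, hA⟩ := w.exists_tsum_enorm_sq_coeff_le hM hδ
  refine ⟨A, fun f hf => ?_⟩
  have hm : AEMeasurable (fun t : ℝ => ∑' n : ℤ, ‖f (t + n)‖ₑ ^ 2)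
      (volume.restrict (Set.Ioc (0 : ℝ) 1)) :=
    AEMeasurable.tsum fun n => ((hf.aestronglyMeasurable.comp_quasiMeasurePreserving
      (measurePreserving_add_right volume (n : ℝ)).quasiMeasurePreserving).restrict).enorm.pow_const 2
  have hfin := hf.lintegral_enorm_sq_lt_top
  rw [hf.lintegral_enorm_sq_eq] at hfin ⊢
  rw [wl.tsum_tsum_enorm_sq_latticeCoef hδ hu hf, ← lintegral_const_mul' _ _ ENNReal.coe_ne_top]
  refine lintegral_mono_ae ?_
  filter_upwards [ae_lt_top' hm hfin.ne] with t ht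
  exact hA ι u hu hdens t (fun n => f (t + n)) ht.ne

/-! ### The density criterion -/

lemma ncard_setOf_subtype_mem (Λ : Set ℝ) (s : Set ℝ) :
    {i : Λ | (i : ℝ) ∈ s}.ncard = (Λ ∩ s).ncard := by
  rw [← Set.ncard_image_of_injective _ Subtype.val_injective]
  congr 1
  ext x
  simp [and_comm]

lemma ncard_inter_Icc_le {Λ : Set ℝ} {δ : ℝ} (hδ : 0 < δ)
    (hΛ : ∀ x ∈ Λ, ∀ y ∈ Λ, x ≠ y → δ ≤ |x - y|) {r : ℝ} (hr : 0 ≤ r) :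
    ((Λ ∩ Set.Icc 0 r).ncard : ℝ) ≤ r / δ + 1 := by
  have h1 : (Λ ∩ Set.Icc 0 r).ncard ≤ (Set.Icc (0 : ℤ) ⌊r / δ⌋).ncard := by
    refine Set.ncard_le_ncard_of_injOn (fun x => ⌊x / δ⌋) ?_ ?_ (Set.finite_Icc _ _)
    · rintro x ⟨-, hx0, hxr⟩
      exact ⟨Int.floor_nonneg.2 (by positivity), Int.floor_le_floor (by gcongr)⟩
    · rintro x ⟨hx, -⟩ y ⟨hy, -⟩ hxy
      by_contra hne
      have h1 := Int.abs_sub_lt_one_of_floor_eq_floor hxy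
      rw [← sub_div, abs_div, abs_of_pos hδ, div_lt_one hδ] at h1
      linarith [hΛ x hx y hy hne]
  have h2 : (Set.Icc (0 : ℤ) ⌊r / δ⌋).ncard = (⌊r / δ⌋ + 1).toNat := by
    rw [← Finset.coe_Icc, Set.ncard_coe_finset, Int.card_Icc, sub_zero]
  rw [h2] at h1
  have h3 : 0 ≤ ⌊r / δ⌋ := Int.floor_nonneg.2 (by positivity)
  calc ((Λ ∩ Set.Icc 0 r).ncard : ℝ) ≤ ((⌊r / δ⌋ + 1).toNat : ℝ) := by exact_mod_cast h1
    _ = (⌊r / δ⌋ : ℝ) + 1 := by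
        rw [← Int.cast_natCast, Int.toNat_of_nonneg (by positivity)]; push_cast; rfl
    _ ≤ _ := by gcongr; exact Int.floor_le _

lemma exists_le_ncard_of_lt_lowerDensity {Λ : Set ℝ} {α : ℝ} (h : α < lowerDensity Λ) :
    ∃ β > α, ∃ r₀ : ℝ, ∀ r ≥ r₀, ∀ x, β * r ≤ ((Λ ∩ Set.Icc x (x + r)).ncard : ℝ) := by
  obtain ⟨β, h1, h2⟩ := exists_between h
  have hb : IsBoundedUnder (· ≥ ·) atTop
      (fun r : ℝ => ⨅ x : ℝ, ((Λ ∩ Set.Icc x (x + r)).ncard : ℝ) / r) :=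
    isBoundedUnder_of_eventually_ge (a := 0) ((eventually_ge_atTop 0).mono fun r hr =>
      Real.iInf_nonneg fun x => by positivity)
  have h3 := eventually_lt_of_lt_liminf h2 hb
  obtain ⟨r₀, hr₀⟩ := eventually_atTop.1 (h3.and (eventually_gt_atTop 0))
  refine ⟨β, h1, r₀, fun r hr x => ?_⟩
  obtain ⟨h4, h5⟩ := hr₀ r hr
  have h6 : ⨅ x : ℝ, ((Λ ∩ Set.Icc x (x + r)).ncard : ℝ) / r ≤
      ((Λ ∩ Set.Icc x (x + r)).ncard : ℝ) / r :=
    ciInf_le ⟨0, by rintro _ ⟨y, rfl⟩; positivity⟩ x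
  exact (le_div_iff₀ h5).1 (h4.le.trans h6)

lemma le_lowerDensity {Λ : Set ℝ} (hΛ : Separated Λ) {β r₀ : ℝ}
    (h : ∀ r ≥ r₀, ∀ x, β * r ≤ ((Λ ∩ Set.Icc x (x + r)).ncard : ℝ)) : β ≤ lowerDensity Λ := by
  obtain ⟨δ, hδ, hsep⟩ := hΛ
  refine le_liminf_of_le ?_ ?_
  · have hb : IsBoundedUnder (· ≤ ·) atTop
        (fun r : ℝ => ⨅ x : ℝ, ((Λ ∩ Set.Icc x (x + r)).ncard : ℝ) / r) := by
      refine isBoundedUnder_of_eventually_le (a := 1 / δ + 1)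
        ((eventually_ge_atTop 1).mono fun r hr => ?_)
      have hr0 : 0 < r := by linarith
      refine (ciInf_le ⟨0, by rintro _ ⟨y, rfl⟩; positivity⟩ 0).trans ?_
      rw [div_le_iff₀ hr0, zero_add]
      refine (ncard_inter_Icc_le hδ hsep hr0.le).trans ?_
      rw [add_mul, one_mul, div_mul_eq_mul_div, one_mul]
      linarith
    exact hb.isCoboundedUnder_ge
  · filter_upwards [eventually_ge_atTop r₀, eventually_gt_atTop 0] with r hr hr0
    exact le_ciInf fun x => (le_div_iff₀ hr0).2 (h r hr x)

lemma exists_block_finset_of_lt_lowerDensity {Λ : Set ℝ} {α : ℝ} (hα : 0 < α)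
    (h : α < lowerDensity Λ) :
    ∃ M : ℕ, 1 ≤ M ∧ ∀ y : ℝ, ∃ F : Finset Λ, F.card = M + 1 ∧
      ∀ i ∈ F, α * (i : ℝ) ∈ Set.Ico y (y + M) := by
  obtain ⟨β, hβ, r₀, hr₀⟩ := exists_le_ncard_of_lt_lowerDensity h
  have hc : 0 < β / α - 1 := by rw [sub_pos, one_lt_div hα]; exact hβ
  obtain ⟨M, hM⟩ := exists_nat_ge (max (α * (r₀ + 1)) (max 1 ((β + 1) / (β / α - 1))))
  have hM1 : α * (r₀ + 1) ≤ M := (le_max_left _ _).trans hM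
  have hM2 : (1 : ℝ) ≤ M := (le_max_left _ _).trans ((le_max_right _ _).trans hM)
  have hM3 : (β + 1) / (β / α - 1) ≤ M := (le_max_right _ _).trans ((le_max_right _ _).trans hM)
  refine ⟨M, by exact_mod_cast hM2, fun y => ?_⟩
  have h1 : M + 1 ≤ (Λ ∩ Set.Icc (y / α) (y / α + (M / α - 1))).ncard := by
    have h2 := hr₀ (M / α - 1) (by rw [ge_iff_le, le_sub_iff_add_le, le_div_iff₀ hα]; linarith) (y / α)
    rw [div_le_iff₀ hc] at hM3
    have h3 : ((M + 1 : ℕ) : ℝ) ≤ β * (M / α - 1) := by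
      push_cast
      have : β * (M / α - 1) = M * (β / α - 1) + M - β := by ring
      linarith
    exact_mod_cast h3.trans h2
  rw [← ncard_setOf_subtype_mem] at h1
  obtain ⟨t, ht, hcard⟩ := Set.exists_subset_card_eq h1
  have hfin : t.Finite := Set.finite_of_ncard_pos (by omega)
  refine ⟨hfin.toFinset, by rw [← Set.ncard_eq_toFinset_card t hfin, hcard], fun i hi => ?_⟩
  have hi' := ht (hfin.mem_toFinset.1 hi)
  obtain ⟨h4, h5⟩ := hi'
  constructor
  · rwa [div_le_iff₀' hα] at h4
  · have h6 : (i : ℝ) < (y + M) / α := by rw [add_div]; linarith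
    rwa [lt_div_iff₀' hα] at h6

/-- For hyperbolic-secant type windows the lower frame bound is governed by the lower density. -/
theorem SechWindow.exists_lower_bound_iff {h : ℝ → ℂ} {C a b κ : ℂ} (w : SechWindow h C a b κ)
    {Λ : Set ℝ} (hΛ : Separated Λ) {α : ℝ} (hα : 0 < α) :
    (∃ A : ℝ≥0, ∀ f : ℝ → ℂ, MemLp f 2 volume →
      ∫⁻ t, ‖f t‖ₑ ^ 2 ≤ A * ∑' i : Λ, ∑' k : ℤ, ‖latticeCoef h f (α * i) k‖ₑ ^ 2) ↔
      α < lowerDensity Λ := by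
  obtain ⟨δ, hδ, hsep⟩ := hΛ
  have hu : SeparatedFamily (α * δ) (fun i : Λ => α * (i : ℝ)) := fun i j hij => by
    rw [← mul_sub, abs_mul, abs_of_pos hα]
    have := hsep i i.2 j j.2 (Subtype.coe_injective.ne hij)
    gcongr
  have hαδ : 0 < α * δ := mul_pos hα hδ
  constructor
  · rintro ⟨A, hA⟩
    obtain ⟨σ, ρ, K, wl⟩ := w.exists_localized
    obtain ⟨β, L₀, hβ, hL⟩ := wl.exists_one_lt_density hαδ hu
      (wl.exists_fiber_lower_bound hαδ hu hA)
    refine lt_of_lt_of_le (lt_mul_of_one_lt_left hα hβ)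
      (le_lowerDensity ⟨δ, hδ, hsep⟩ (r₀ := L₀ / α) fun r hr x => ?_)
    have h1 := hL (α * r) ((div_le_iff₀' hα).1 hr) (α * x)
    rw [← ncard_setOf_subtype_mem, mul_assoc]
    convert h1 using 3
    · ext i
      simp only [Set.mem_ofPred_eq, Set.mem_Icc, ← mul_add, mul_le_mul_iff_right₀ hα]
  · intro h
    obtain ⟨M, hM, hF⟩ := exists_block_finset_of_lt_lowerDensity hα h
    exact w.exists_lower_bound hαδ hu hM hF

/-! ### Rescaling to a general modulation step -/

lemma lintegral_comp_const_mul {α : ℝ} (hα : 0 < α) (φ : ℝ → ℝ≥0∞) :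
    ∫⁻ t, φ (α * t) = ENNReal.ofReal α⁻¹ * ∫⁻ t, φ t := by
  have he : MeasurableEmbedding (fun t : ℝ => α * t) := measurableEmbedding_mulLeft₀ hα.ne'
  rw [← he.lintegral_map, Real.map_volume_mul_left hα.ne', lintegral_smul_measure,
    abs_of_pos (inv_pos.2 hα), smul_eq_mul]

lemma MeasureTheory.MemLp.comp_const_mul {f : ℝ → ℂ} (hf : MemLp f 2 volume) {α : ℝ}
    (hα : 0 < α) : MemLp (fun t => f (α * t)) 2 volume := by
  refine ⟨hf.aestronglyMeasurable.comp_quasiMeasurePreserving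
    (Measure.quasiMeasurePreserving_smul volume hα.ne'), ?_⟩
  rw [eLpNorm_lt_top_iff_lintegral_rpow_enorm_lt_top two_ne_zero ENNReal.ofNat_ne_top]
  simp only [ENNReal.toReal_ofNat, ENNReal.rpow_ofNat]
  rw [lintegral_comp_const_mul hα fun t => ‖f t‖ₑ ^ 2]
  exact ENNReal.mul_lt_top ENNReal.ofReal_lt_top hf.lintegral_enorm_sq_lt_top

/-- Modulated coefficients `∫ f(t) e^{2πikαt} h(x - t) dt`. -/
def gridCoef (α : ℝ) (h f : ℝ → ℂ) (x : ℝ) (k : ℤ) : ℂ :=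
  ∫ t : ℝ, f t * (Complex.exp (2 * Real.pi * Complex.I * k * (α * t : ℝ)) * h (x - t))

lemma gridCoef_comp_const_mul {α : ℝ} (hα : 0 < α) (h f : ℝ → ℂ) (x : ℝ) (k : ℤ) :
    gridCoef α h (fun t => f (α * t)) x k =
      (α⁻¹ : ℝ) • latticeCoef (fun y => h (α⁻¹ * y)) f (α * x) k := by
  rw [latticeCoef, gridCoef]
  have := Measure.integral_comp_mul_left (fun t : ℝ => f t *
    (Complex.exp (2 * Real.pi * Complex.I * k * t) * h (α⁻¹ * (α * x - t)))) α
  rw [abs_of_pos (inv_pos.2 hα)] at this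
  rw [← this]
  congr 1 with t
  rw [← mul_sub, inv_mul_cancel_left₀ hα.ne']

lemma SechWindow.comp_inv_mul {h : ℝ → ℂ} {C a b κ : ℂ} (w : SechWindow h C a b κ) {α : ℝ}
    (hα : 0 < α) : SechWindow (fun y => h (α⁻¹ * y)) C ((α⁻¹ : ℝ) * a) ((α⁻¹ : ℝ) * b) κ where
  re_a_pos := by rw [Complex.re_ofReal_mul]; exact mul_pos (inv_pos.2 hα) w.re_a_pos
  re_b_pos := by rw [Complex.re_ofReal_mul]; exact mul_pos (inv_pos.2 hα) w.re_b_pos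
  C_ne_zero := w.C_ne_zero
  κ_ne_zero := w.κ_ne_zero
  denom_ne_zero x := by
    have := w.denom_ne_zero (α⁻¹ * x)
    rwa [Complex.ofReal_mul, mul_left_comm a, ← mul_assoc, mul_left_comm (-b), ← mul_assoc,
      mul_neg] at this
  apply_eq x := by
    rw [w.apply_eq, Complex.ofReal_mul, mul_left_comm a, ← mul_assoc, mul_left_comm (-b),
      ← mul_assoc, mul_neg]

section

variable {h : ℝ → ℂ} {C a b κ : ℂ} {Λ : Set ℝ} {α : ℝ}

lemma tsum_enorm_sq_gridCoef_comp_const_mul (hα : 0 < α) (f : ℝ → ℂ) :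
    ∑' i : Λ, ∑' k : ℤ, ‖gridCoef α h (fun t => f (α * t)) i k‖ₑ ^ 2 =
      ENNReal.ofReal α⁻¹ ^ 2 *
        ∑' i : Λ, ∑' k : ℤ, ‖latticeCoef (fun y => h (α⁻¹ * y)) f (α * i) k‖ₑ ^ 2 := by
  simp only [gridCoef_comp_const_mul hα, enorm_smul, mul_pow, ENNReal.tsum_mul_left]
  rw [Real.enorm_of_nonneg (inv_pos.2 hα).le]

lemma forall_memLp_comp_const_mul_iff (hα : 0 < α) (P : (ℝ → ℂ) → Prop) :
    (∀ f : ℝ → ℂ, MemLp f 2 volume → P fun t => f (α * t)) ↔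
      ∀ f : ℝ → ℂ, MemLp f 2 volume → P f := by
  refine ⟨fun H f hf => ?_, fun H f hf => H _ (hf.comp_const_mul hα)⟩
  have := H _ (hf.comp_const_mul (inv_pos.2 hα))
  simpa only [inv_mul_cancel_left₀ hα.ne'] using this

lemma SechWindow.exists_gridCoef_bessel (w : SechWindow h C a b κ) (hΛ : Separated Λ)
    (hα : 0 < α) :
    ∃ B : ℝ≥0, ∀ f : ℝ → ℂ, MemLp f 2 volume →
      ∑' i : Λ, ∑' k : ℤ, ‖gridCoef α h f i k‖ₑ ^ 2 ≤ B * ∫⁻ t, ‖f t‖ₑ ^ 2 := by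
  obtain ⟨δ, hδ, hsep⟩ := hΛ
  have hu : SeparatedFamily (α * δ) (fun i : Λ => α * (i : ℝ)) := fun i j hij => by
    rw [← mul_sub, abs_mul, abs_of_pos hα]
    have := hsep i i.2 j j.2 (Subtype.coe_injective.ne hij)
    gcongr
  obtain ⟨σ, ρ, K, wl⟩ := (w.comp_inv_mul hα).exists_localized
  obtain ⟨B, hB⟩ := wl.exists_bessel_bound (mul_pos hα hδ) hu
  refine ⟨α⁻¹.toNNReal * B, (forall_memLp_comp_const_mul_iff hα _).1 fun f hf => ?_⟩
  rw [tsum_enorm_sq_gridCoef_comp_const_mul hα, lintegral_comp_const_mul hα fun t => ‖f t‖ₑ ^ 2]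
  calc _ ≤ ENNReal.ofReal α⁻¹ ^ 2 * (B * ∫⁻ t, ‖f t‖ₑ ^ 2) := by gcongr; exact hB f hf
    _ = _ := by push_cast; rw [ENNReal.ofReal]; ring

lemma SechWindow.exists_gridCoef_lower_bound_iff (w : SechWindow h C a b κ) (hΛ : Separated Λ)
    (hα : 0 < α) :
    (∃ A : ℝ≥0, ∀ f : ℝ → ℂ, MemLp f 2 volume →
      ∫⁻ t, ‖f t‖ₑ ^ 2 ≤ A * ∑' i : Λ, ∑' k : ℤ, ‖gridCoef α h f i k‖ₑ ^ 2) ↔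
      α < lowerDensity Λ := by
  rw [← (w.comp_inv_mul hα).exists_lower_bound_iff hΛ hα]
  have h0 : ENNReal.ofReal α⁻¹ ≠ 0 := by simpa using hα
  have key : ∀ (A : ℝ≥0), (∀ f : ℝ → ℂ, MemLp f 2 volume →
      ∫⁻ t, ‖f t‖ₑ ^ 2 ≤ A * ∑' i : Λ, ∑' k : ℤ, ‖gridCoef α h f i k‖ₑ ^ 2) ↔
      (∀ f : ℝ → ℂ, MemLp f 2 volume → ∫⁻ t, ‖f t‖ₑ ^ 2 ≤
        (α⁻¹.toNNReal * A : ℝ≥0) *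
          ∑' i : Λ, ∑' k : ℤ, ‖latticeCoef (fun y => h (α⁻¹ * y)) f (α * i) k‖ₑ ^ 2) := by
    intro A
    rw [← forall_memLp_comp_const_mul_iff hα]
    refine forall₂_congr fun f hf => ?_
    rw [tsum_enorm_sq_gridCoef_comp_const_mul hα, lintegral_comp_const_mul hα fun t => ‖f t‖ₑ ^ 2]
    rw [← ENNReal.mul_le_mul_iff_right h0 ENNReal.ofReal_ne_top (b := ∫⁻ t, ‖f t‖ₑ ^ 2)]
    push_cast
    rw [← ENNReal.ofReal]
    ring_nf
  constructor
  · rintro ⟨A, hA⟩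
    exact ⟨_, (key A).1 hA⟩
  · rintro ⟨A, hA⟩
    refine ⟨α.toNNReal * A, (key _).2 ?_⟩
    rwa [← mul_assoc, ← Real.toNNReal_mul (inv_pos.2 hα).le, inv_mul_cancel₀ hα.ne',
      Real.toNNReal_one, one_mul]

end

/-! ### Gabor frames in terms of extended nonnegative sums -/

lemma toReal_tsum_enorm_sq {ι : Type} (c : ι → ℂ) :
    (∑' i, ‖c i‖ₑ ^ 2).toReal = ∑' i, ‖c i‖ ^ 2 := by
  rw [ENNReal.tsum_toReal_eq fun i => by simp]
  simp

lemma MeasureTheory.MemLp.toReal_lintegral_enorm_sq {f : ℝ → ℂ} (hf : MemLp f 2 volume) :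
    (∫⁻ t, ‖f t‖ₑ ^ 2).toReal = ∫ t, ‖f t‖ ^ 2 := by
  rw [integral_eq_lintegral_of_nonneg_ae (f := fun t => ‖f t‖ ^ 2)
    (Eventually.of_forall fun _ => by positivity) (hf.aestronglyMeasurable.norm.pow 2)]
  congr 2 with t
  rw [ENNReal.ofReal_pow (norm_nonneg _), ofReal_norm]

/-- Given the Bessel bound, the frame property amounts to a lower bound. -/
lemma isGaborFrame_iff {g : ℝ → ℂ} {S : Set (ℝ × ℝ)} {Q : (ℝ → ℂ) → ℝ≥0∞}
    (hQ : ∀ f, MemLp f 2 volume → ∑' p : S, ‖gaborCoef g f p‖ₑ ^ 2 = Q f)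
    (hB : ∃ B : ℝ≥0, ∀ f, MemLp f 2 volume → Q f ≤ B * ∫⁻ t, ‖f t‖ₑ ^ 2) :
    IsGaborFrame g S ↔
      ∃ A : ℝ≥0, ∀ f, MemLp f 2 volume → ∫⁻ t, ‖f t‖ₑ ^ 2 ≤ A * Q f := by
  obtain ⟨B, hB⟩ := hB
  have hQr : ∀ f, MemLp f 2 volume → ∑' p : S, ‖gaborCoef g f p‖ ^ 2 = (Q f).toReal :=
    fun f hf => by rw [← hQ f hf, toReal_tsum_enorm_sq]
  have hfin : ∀ f, MemLp f 2 volume → Q f ≠ ⊤ := fun f hf =>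
    ne_top_of_le_ne_top (ENNReal.mul_ne_top ENNReal.coe_ne_top
      hf.lintegral_enorm_sq_lt_top.ne) (hB f hf)
  constructor
  · rintro ⟨A, _, hA, -, H⟩
    refine ⟨A⁻¹.toNNReal, fun f hf => ?_⟩
    have h1 := (H f hf).1
    rw [hQr f hf, ← hf.toReal_lintegral_enorm_sq] at h1
    rw [← ENNReal.toReal_le_toReal hf.lintegral_enorm_sq_lt_top.ne
      (ENNReal.mul_ne_top ENNReal.coe_ne_top (hfin f hf)), ENNReal.toReal_mul,
      ENNReal.coe_toReal, Real.coe_toNNReal _ (inv_pos.2 hA).le]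
    rwa [le_inv_mul_iff₀ hA]
  · rintro ⟨A, hA⟩
    refine ⟨((A : ℝ) + 1)⁻¹, B + 1, by positivity, by positivity, fun f hf => ?_⟩
    rw [hQr f hf, ← hf.toReal_lintegral_enorm_sq]
    have h1 := ENNReal.toReal_mono (ENNReal.mul_ne_top ENNReal.coe_ne_top (hfin f hf)) (hA f hf)
    have h2 := ENNReal.toReal_mono (ENNReal.mul_ne_top ENNReal.coe_ne_top
      hf.lintegral_enorm_sq_lt_top.ne) (hB f hf)
    rw [ENNReal.toReal_mul, ENNReal.coe_toReal] at h1 h2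
    have h3 := ENNReal.toReal_nonneg (a := Q f)
    have h4 := ENNReal.toReal_nonneg (a := ∫⁻ t, ‖f t‖ₑ ^ 2)
    constructor
    · rw [inv_mul_le_iff₀ (by positivity)]
      linarith
    · linarith

lemma tsum_setOf_fst_mem_snd_grid {Λ : Set ℝ} {α : ℝ} (hα : 0 < α) (φ : ℝ × ℝ → ℝ≥0∞) :
    ∑' p : {p : ℝ × ℝ | p.1 ∈ Λ ∧ ∃ k : ℤ, p.2 = α * k}, φ p =
      ∑' i : Λ, ∑' k : ℤ, φ (i, α * k) := by
  have hinj : Function.Injective fun q : Λ × ℤ => ((q.1 : ℝ), α * (q.2 : ℝ)) := by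
    rintro ⟨i, k⟩ ⟨j, l⟩ h
    simp only [Prod.mk.injEq] at h ⊢
    exact ⟨Subtype.ext h.1, by exact_mod_cast mul_left_cancel₀ hα.ne' h.2⟩
  have hrange : {p : ℝ × ℝ | p.1 ∈ Λ ∧ ∃ k : ℤ, p.2 = α * k} =
      Set.range fun q : Λ × ℤ => ((q.1 : ℝ), α * (q.2 : ℝ)) := by
    ext ⟨x, y⟩
    simp [eq_comm]
  rw [tsum_congr_set_coe φ hrange, tsum_range φ hinj, ENNReal.tsum_prod']

lemma tsum_setOf_fst_grid_snd_mem {Λ : Set ℝ} {α : ℝ} (hα : 0 < α) (φ : ℝ × ℝ → ℝ≥0∞) :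
    ∑' p : {p : ℝ × ℝ | (∃ k : ℤ, p.1 = α * k) ∧ p.2 ∈ Λ}, φ p =
      ∑' i : Λ, ∑' k : ℤ, φ (α * k, i) := by
  have hinj : Function.Injective fun q : Λ × ℤ => (α * (q.2 : ℝ), (q.1 : ℝ)) := by
    rintro ⟨i, k⟩ ⟨j, l⟩ h
    simp only [Prod.mk.injEq] at h ⊢
    exact ⟨Subtype.ext h.2, by exact_mod_cast mul_left_cancel₀ hα.ne' h.1⟩
  have hrange : {p : ℝ × ℝ | (∃ k : ℤ, p.1 = α * k) ∧ p.2 ∈ Λ} =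
      Set.range fun q : Λ × ℤ => (α * (q.2 : ℝ), (q.1 : ℝ)) := by
    ext ⟨x, y⟩
    simp [eq_comm, and_comm]
  rw [tsum_congr_set_coe φ hrange, tsum_range φ hinj, ENNReal.tsum_prod']

lemma conj_modulation_mul (x y : ℝ) (z : ℂ) :
    (starRingEnd ℂ) (Complex.exp (-2 * Real.pi * Complex.I * x * y) * z) =
      Complex.exp (2 * Real.pi * Complex.I * x * y) * (starRingEnd ℂ) z := by
  rw [map_mul, ← Complex.exp_conj]
  simp [Complex.conj_ofNat]

lemma gaborCoef_grid_snd (g f : ℝ → ℂ) (α x : ℝ) (k : ℤ) :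
    gaborCoef g f (x, α * k) = gridCoef α (fun y => (starRingEnd ℂ) (g y)) f x k := by
  rw [gaborCoef, gridCoef]
  congr 1 with t
  rw [conj_modulation_mul]
  push_cast
  ring_nf

lemma exp_add_exp_neg_ne_zero {a b : ℂ} (ha : 0 < a.re) (hb : 0 < b.re) (x : ℝ) :
    Complex.exp (a * x) + Complex.exp (-b * x) ≠ 0 := by
  intro h
  have h1 : Complex.exp (a * x) = -Complex.exp (-b * x) := eq_neg_of_add_eq_zero_left h
  have h2 := congrArg norm h1
  rw [norm_neg, norm_exp_mul_ofReal, norm_exp_mul_ofReal, Real.exp_eq_exp] at h2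
  have h3 : (a.re + b.re) * x = 0 := by rw [Complex.neg_re] at h2; linarith
  have h4 : x = 0 := (mul_eq_zero.1 h3).resolve_left (by positivity)
  subst h4
  norm_num at h

lemma sechWindow_conj {a b : ℂ} (ha : 0 < a.re) (hb : 0 < b.re) {g : ℝ → ℂ}
    (hg : ∀ x : ℝ, g x = 1 / (Complex.exp (a * x) + Complex.exp (-b * x))) :
    SechWindow (fun y => (starRingEnd ℂ) (g y)) 1 ((starRingEnd ℂ) a) ((starRingEnd ℂ) b) 1 where
  re_a_pos := by simpa using ha
  re_b_pos := by simpa using hb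
  C_ne_zero := one_ne_zero
  κ_ne_zero := one_ne_zero
  denom_ne_zero x := by
    rw [one_mul]
    exact exp_add_exp_neg_ne_zero (by simpa using ha) (by simpa using hb) x
  apply_eq x := by
    rw [hg, map_div₀, map_add, ← Complex.exp_conj, ← Complex.exp_conj]
    simp

/-- The density theorem for the system with modulations in `α ℤ`. -/
lemma isGaborFrame_fst_mem_snd_grid_iff {a b : ℂ} (ha : 0 < a.re) (hb : 0 < b.re) {g : ℝ → ℂ}
    (hg : ∀ x : ℝ, g x = 1 / (Complex.exp (a * x) + Complex.exp (-b * x)))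
    {α : ℝ} (hα : 0 < α) {Λ : Set ℝ} (hΛ : Separated Λ) :
    IsGaborFrame g {p : ℝ × ℝ | p.1 ∈ Λ ∧ ∃ k : ℤ, p.2 = α * k} ↔ α < lowerDensity Λ := by
  have w := sechWindow_conj ha hb hg
  rw [← w.exists_gridCoef_lower_bound_iff hΛ hα]
  refine isGaborFrame_iff (fun f _ => ?_) (w.exists_gridCoef_bessel hΛ hα)
  rw [tsum_setOf_fst_mem_snd_grid hα fun p => ‖gaborCoef g f p‖ₑ ^ 2]
  simp only [gaborCoef_grid_snd]

/-! ### The Fourier transform of the window -/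

lemma sum_range_alternating (T : ℕ → ℂ) (M : ℕ) :
    ∑ m ∈ Finset.range (2 * M), (-1) ^ (m + 1) * T (m + 1) =
      2 * ∑ n ∈ Finset.range M, T (2 * (n + 1)) - ∑ m ∈ Finset.range (2 * M), T (m + 1) := by
  induction M with
  | zero => simp
  | succ M ih =>
    rw [show 2 * (M + 1) = 2 * M + 1 + 1 by ring, Finset.sum_range_succ, Finset.sum_range_succ, ih,
      Finset.sum_range_succ, Finset.sum_range_succ _ (2 * M + 1), Finset.sum_range_succ _ (2 * M)]
    have h1 : ((-1 : ℂ)) ^ (2 * M + 1) = -1 := by rw [pow_succ, pow_mul]; simp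
    have h2 : ((-1 : ℂ)) ^ (2 * M + 1 + 1) = 1 := by rw [pow_succ, h1]; simp
    rw [h1, h2, show 2 * (M + 1) = 2 * M + 1 + 1 by ring]
    ring

lemma sum_range_alternating_pair {s : ℂ} (hs : s ∈ integerComplement) (N : ℕ) :
    ∑ k ∈ Finset.range (N + 1), (-1 : ℂ) ^ k * (1 / (k + s) + 1 / (k + (1 - s))) =
      1 / s + ∑ m ∈ Finset.range N, (-1) ^ (m + 1) *
        (1 / (s - ((m + 1 : ℕ) : ℂ)) + 1 / (s + ((m + 1 : ℕ) : ℂ))) +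
      (-1) ^ N * (1 / ((N : ℂ) + (1 - s))) := by
  induction N with
  | zero => simp
  | succ N ih =>
    rw [Finset.sum_range_succ, ih, Finset.sum_range_succ _ N]
    have h1 : s - ((N + 1 : ℕ) : ℂ) ≠ 0 := by
      have := integerComplement_add_ne_zero hs (-((N + 1 : ℕ) : ℤ))
      push_cast at this ⊢
      rwa [sub_eq_add_neg]
    have h2 : 1 / ((N : ℂ) + (1 - s)) = -(1 / (s - ((N + 1 : ℕ) : ℂ))) := by
      rw [← one_div_neg_eq_neg_one_div]
      congr 1
      push_cast
      ring
    rw [h2, add_comm s]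
    push_cast
    ring

lemma cot_half_sub_cot {x : ℂ} (hx : Complex.sin x ≠ 0) :
    Complex.cot (x / 2) - Complex.cot x = 1 / Complex.sin x := by
  have h2 : x = 2 * (x / 2) := by ring
  set y := x / 2 with hy
  rw [h2, Complex.sin_two_mul] at hx
  have hs : Complex.sin y ≠ 0 := fun h => hx (by simp [h])
  have hc : Complex.cos y ≠ 0 := fun h => hx (by simp [h])
  rw [h2, Complex.cot, Complex.cot, Complex.sin_two_mul, Complex.cos_two_mul]
  field_simp
  ring

/-- Partial fraction expansion of the cosecant. -/
lemma tendsto_alternating_sum_pi_div_sin {s : ℂ} (hs : s ∈ integerComplement) :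
    Tendsto (fun M : ℕ => ∑ k ∈ Finset.range (2 * M + 1),
      (-1 : ℂ) ^ k * (1 / (k + s) + 1 / (k + (1 - s)))) atTop
      (𝓝 (Real.pi / Complex.sin (Real.pi * s))) := by
  have hs2 : s / 2 ∈ integerComplement := by
    rintro ⟨n, hn⟩
    exact hs ⟨2 * n, by push_cast; rw [hn]; ring⟩
  have hsin : Complex.sin (Real.pi * s) ≠ 0 := by
    rw [Complex.sin_ne_zero_iff]
    intro k hk
    rw [mul_comm] at hk
    exact hs ⟨k, (mul_right_cancel₀ (by exact_mod_cast Real.pi_ne_zero) hk).symm⟩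
  have h1 := tendsto_logDeriv_euler_cot_sub hs
  have h2 := tendsto_logDeriv_euler_cot_sub hs2
  have h3 := h1.comp (tendsto_id.const_mul_atTop' (r := 2) two_pos)
  have h4 : Tendsto (fun M : ℕ => (-1 : ℂ) ^ (2 * M) * (1 / (((2 * M : ℕ) : ℂ) + (1 - s)))) atTop
      (𝓝 0) := by
    simp only [pow_mul, neg_one_sq, one_pow, one_mul, one_div]
    refine tendsto_inv₀_cobounded.comp (tendsto_norm_atTop_iff_cobounded.1 ?_)
    have : Tendsto (fun M : ℕ => (M : ℝ) - ‖1 - s‖) atTop atTop :=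
      tendsto_atTop_add_const_right _ _ tendsto_natCast_atTop_atTop
    refine tendsto_atTop_mono (fun M => ?_) this
    have h5 := norm_sub_le_norm_add (((2 * M : ℕ) : ℂ)) (1 - s)
    rw [Complex.norm_natCast] at h5
    push_cast at h5 ⊢
    linarith [(Nat.cast_nonneg M : (0 : ℝ) ≤ M)]
  have h5 := ((tendsto_const_nhds (x := 1 / s)).add (h2.sub h3)).add h4
  convert h5 using 1
  · ext M
    rw [sum_range_alternating_pair hs, sum_range_alternating
      (fun m => 1 / (s - (m : ℂ)) + 1 / (s + (m : ℂ)))]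
    congr 2
    simp only [Function.comp, cotTerm, id]
    congr 1
    · rw [Finset.mul_sum]
      refine Finset.sum_congr rfl fun n _ => ?_
      have e1 : s / 2 - ((n : ℂ) + 1) = (s - ((2 * (n + 1) : ℕ) : ℂ)) / 2 := by push_cast; ring
      have e2 : s / 2 + ((n : ℂ) + 1) = (s + ((2 * (n + 1) : ℕ) : ℂ)) / 2 := by push_cast; ring
      rw [e1, e2, one_div_div, one_div_div]
      ring
    · refine Finset.sum_congr rfl fun n _ => ?_
      push_cast
      rfl
  · congr 1
    have := cot_half_sub_cot hsin
    rw [div_eq_mul_one_div, ← this, mul_div_assoc]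
    rw [one_div_div]
    ring

namespace LocalizedWindow

variable {h : ℝ → ℂ} {σ ρ K : ℝ}

lemma integrable (w : LocalizedWindow h σ ρ K) : Integrable h := by
  have h1 : Integrable fun x : ℝ => Real.exp (-σ * |x|) := by
    rw [← integrableOn_univ, ← Set.Iic_union_Ioi (a := (0 : ℝ))]
    refine IntegrableOn.union ?_ ?_
    · refine (integrableOn_exp_mul_Iic w.σ_pos 0).congr_fun (fun x hx => ?_) measurableSet_Iic
      simp only [abs_of_nonpos (Set.mem_Iic.1 hx), neg_mul_neg]
    · refine (integrableOn_exp_mul_Ioi (neg_neg_of_pos w.σ_pos) 0).congr_fun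
        (fun x hx => ?_) measurableSet_Ioi
      simp only [abs_of_pos (Set.mem_Ioi.1 hx)]
  exact (h1.const_mul K).mono' w.continuous.aestronglyMeasurable (Eventually.of_forall w.norm_le)

lemma norm_le_const (w : LocalizedWindow h σ ρ K) (x : ℝ) : ‖h x‖ ≤ K := by
  refine (w.norm_le x).trans (mul_le_of_le_one_right w.K_pos.le (Real.exp_le_one_iff.2 ?_))
  have := mul_nonneg w.σ_pos.le (abs_nonneg x)
  linarith

lemma memLp_two (w : LocalizedWindow h σ ρ K) : MemLp h 2 volume := by
  rw [memLp_two_iff_integrable_sq_norm w.continuous.aestronglyMeasurable]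
  refine (w.integrable.norm.const_mul K).mono' (w.continuous.norm.pow 2).aestronglyMeasurable
    (Eventually.of_forall fun x => ?_)
  rw [Real.norm_of_nonneg (by positivity), sq]
  exact mul_le_mul_of_nonneg_right (w.norm_le_const x) (norm_nonneg _)

end LocalizedWindow

lemma tendsto_sum_integral_Ioi {A B c : ℂ} (hA : 0 < A.re) (hB : 0 < B.re) (hc : c.re = 0)
    {h : ℝ → ℂ} (hh : ∀ v : ℝ, h v = 1 / (Complex.exp (A * v) + Complex.exp (-B * v)))
    (hi : Integrable h) {K : ℝ} (hK : ∀ v, ‖h v‖ ≤ K) :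
    Tendsto (fun N : ℕ => ∑ k ∈ Finset.range N, (-1 : ℂ) ^ k * (1 / (A + c + k * (A + B)))) atTop
      (𝓝 (∫ v in Set.Ioi (0 : ℝ), Complex.exp (-c * v) * h v)) := by
  have hnc : ∀ v : ℝ, ‖Complex.exp (-c * v)‖ = 1 := fun v => by
    rw [norm_exp_mul_ofReal]; simp [hc]
  have hr : 0 < A.re + B.re := by positivity
  have hi' : Integrable (fun v : ℝ => Complex.exp (-c * v) * h v) := by
    refine hi.bdd_mul (c := 1) (Continuous.aestronglyMeasurable (by fun_prop))
      (Eventually.of_forall fun v => (hnc v).le)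
  have hre : ∀ k : ℕ, (-(A + c + k * (A + B))).re < 0 := fun k => by
    have : (-(A + c + k * (A + B))).re = -(A.re + k * (A.re + B.re)) := by simp [hc]
    rw [this]
    have : 0 ≤ (k : ℝ) * (A.re + B.re) := by positivity
    linarith
  have hterm : ∀ k : ℕ, ∫ v in Set.Ioi (0 : ℝ), Complex.exp (-(A + c + k * (A + B)) * v) =
      1 / (A + c + k * (A + B)) := fun k => by
    rw [integral_exp_mul_complex_Ioi (hre k), Complex.ofReal_zero, mul_zero, Complex.exp_zero,
      neg_div_neg_eq]
  have hpt : ∀ (N : ℕ) (v : ℝ), ∑ k ∈ Finset.range N, (-1 : ℂ) ^ k *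
      Complex.exp (-(A + c + k * (A + B)) * v) - Complex.exp (-c * v) * h v =
      -((-1) ^ N * Complex.exp (-(c + N * (A + B)) * v) * h v) := by
    intro N v
    have hD := exp_add_exp_neg_ne_zero hA hB v
    set q := Complex.exp (-(A + B) * v) with hq
    have hk : ∀ k : ℕ, (-1 : ℂ) ^ k * Complex.exp (-(A + c + k * (A + B)) * v) =
        Complex.exp (-c * v) * Complex.exp (-A * v) * (-q) ^ k := fun k => by
      rw [neg_pow q, hq, ← Complex.exp_nat_mul, ← Complex.exp_add, mul_left_comm, ← Complex.exp_add]
      congr 2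
      ring
    have hN : (-1 : ℂ) ^ N * Complex.exp (-(c + N * (A + B)) * v) =
        Complex.exp (-c * v) * (-q) ^ N := by
      rw [neg_pow q, hq, ← Complex.exp_nat_mul, mul_left_comm, ← Complex.exp_add]
      congr 2
      ring
    have hDq : Complex.exp (A * v) + Complex.exp (-B * v) = Complex.exp (A * v) * (1 + q) := by
      rw [mul_add, mul_one, hq, ← Complex.exp_add]
      congr 2
      ring
    have hgeom := geom_sum_mul (-q) N
    simp only [hk, hN]
    rw [← Finset.mul_sum, hh, hDq]
    rw [hDq] at hD
    have hq1 : 1 + q ≠ 0 := right_ne_zero_of_mul hD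
    have hAe : Complex.exp (-A * v) = (Complex.exp (A * v))⁻¹ := by
      rw [← Complex.exp_neg]; congr 1; ring
    rw [hAe]
    have he := Complex.exp_ne_zero (A * v)
    field_simp
    linear_combination -hgeom
  have hbound : ∀ N : ℕ, 0 < N →
      ‖∑ k ∈ Finset.range N, (-1 : ℂ) ^ k * (1 / (A + c + k * (A + B))) -
        ∫ v in Set.Ioi (0 : ℝ), Complex.exp (-c * v) * h v‖ ≤ K / (A.re + B.re) * (1 / N) := by
    intro N hN
    have hN' : (0 : ℝ) < N := by exact_mod_cast hN
    have e1 : ∑ k ∈ Finset.range N, (-1 : ℂ) ^ k * (1 / (A + c + k * (A + B))) -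
        ∫ v in Set.Ioi (0 : ℝ), Complex.exp (-c * v) * h v =
        ∫ v in Set.Ioi (0 : ℝ), -((-1) ^ N * Complex.exp (-(c + N * (A + B)) * v) * h v) := by
      simp only [← hterm, ← integral_const_mul, ← hpt]
      rw [integral_sub _ hi'.integrableOn, integral_finsetSum]
      · exact fun k _ => (integrableOn_exp_mul_complex_Ioi (hre k) 0).const_mul _
      · exact integrable_finsetSum _ fun k _ =>
          (integrableOn_exp_mul_complex_Ioi (hre k) 0).const_mul _
    have hneg : -(N * (A.re + B.re)) < 0 := by
      have : 0 < N * (A.re + B.re) := by positivity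
      linarith
    rw [e1]
    refine (norm_integral_le_of_norm_le (g := fun v : ℝ =>
      K * Real.exp (-(N * (A.re + B.re)) * v)) ?_ (Eventually.of_forall fun v => ?_)).trans ?_
    · exact (integrableOn_exp_mul_Ioi hneg 0).const_mul K
    · rw [norm_neg, norm_mul, norm_mul, norm_pow, norm_neg, norm_one, one_pow, one_mul,
        norm_exp_mul_ofReal, mul_comm K]
      have : (-(c + N * (A + B))).re = -(N * (A.re + B.re)) := by simp [hc]
      rw [this]
      gcongr
      exact hK v
    · rw [integral_const_mul, integral_exp_mul_Ioi hneg]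
      simp only [mul_zero, Real.exp_zero, neg_div_neg_eq]
      rw [div_mul_div_comm, mul_one, mul_one_div, mul_comm (N : ℝ)]
  rw [tendsto_iff_norm_sub_tendsto_zero]
  have hlim : Tendsto (fun N : ℕ => K / (A.re + B.re) * (1 / (N : ℝ))) atTop (𝓝 0) := by
    simpa using tendsto_one_div_atTop_nhds_zero_nat.const_mul (K / (A.re + B.re))
  exact squeeze_zero' (Eventually.of_forall fun _ => norm_nonneg _)
    ((eventually_gt_atTop 0).mono hbound) hlim

lemma div_mem_integerComplement {A B c : ℂ} (hA : 0 < A.re) (hB : 0 < B.re) (hc : c.re = 0) :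
    (B - c) / (A + B) ∈ integerComplement := by
  have hS : A + B ≠ 0 := fun h => by
    have := congrArg Complex.re h
    simp only [add_re, zero_re] at this
    linarith
  rintro ⟨n, hn⟩
  rw [eq_div_iff hS] at hn
  have h1 := congrArg Complex.re hn
  simp only [mul_re, intCast_re, intCast_im, zero_mul, sub_zero, add_re, sub_re, hc] at h1
  rcases le_or_gt n 0 with h | h
  · have : (n : ℝ) ≤ 0 := by exact_mod_cast h
    nlinarith
  · have : (1 : ℝ) ≤ n := by exact_mod_cast h
    nlinarith

/-- The Fourier transform of a window of secant type is a cosecant. -/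
lemma fourier_sech {A B : ℂ} (hA : 0 < A.re) (hB : 0 < B.re) {h : ℝ → ℂ}
    (hh : ∀ v : ℝ, h v = 1 / (Complex.exp (A * v) + Complex.exp (-B * v)))
    (hi : Integrable h) {K : ℝ} (hK : ∀ v, ‖h v‖ ≤ K) (ξ : ℝ) :
    𝓕 h ξ = 1 / (A + B) *
      (Real.pi / Complex.sin (Real.pi * ((B - 2 * Real.pi * Complex.I * ξ) / (A + B)))) := by
  set c : ℂ := 2 * Real.pi * Complex.I * ξ with hcdef
  have hc : c.re = 0 := by simp [hcdef]
  have hS : A + B ≠ 0 := fun h => by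
    have := congrArg Complex.re h
    simp only [add_re, zero_re] at this
    linarith
  have hs := div_mem_integerComplement hA hB hc
  set s := (B - c) / (A + B) with hsdef
  have hpos := tendsto_sum_integral_Ioi hA hB hc hh hi hK
  have hneg := tendsto_sum_integral_Ioi (c := -c) hB hA (by simp [hc]) (h := fun v => h (-v))
    (fun v => by rw [hh, add_comm]; push_cast; simp only [neg_mul, mul_neg, neg_neg])
    hi.comp_neg (fun v => hK (-v))
  have hsub : Tendsto (fun M : ℕ => 2 * M + 1) atTop atTop :=
    tendsto_atTop_mono (fun M => by simp only [id]; lia) tendsto_id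
  have hsum := (hneg.add hpos).comp hsub
  have hlim := (tendsto_alternating_sum_pi_div_sin hs).const_mul (1 / (A + B))
  have hterm : ∀ k : ℕ, 1 / (A + B) * (1 / (k + s) + 1 / (k + (1 - s))) =
      1 / (B + -c + k * (B + A)) + 1 / (A + c + k * (A + B)) := by
    intro k
    have e1 : B + -c + k * (B + A) = (A + B) * (k + s) := by
      rw [hsdef]; field_simp; ring
    have e2 : A + c + k * (A + B) = (A + B) * (k + (1 - s)) := by
      rw [hsdef]; field_simp; ring
    rw [e1, e2, mul_add, one_div_mul_one_div_rev, one_div_mul_one_div_rev, mul_comm (A + B),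
      mul_comm (A + B)]
  have heq := tendsto_nhds_unique hsum (hlim.congr fun M => by
    simp only [Function.comp]
    rw [Finset.mul_sum, ← Finset.sum_add_distrib]
    exact Finset.sum_congr rfl fun k _ => by
      rw [mul_left_comm, hterm, mul_add])
  rw [← heq, Real.fourier_real_eq_integral_exp_smul]
  have hfun : (fun v : ℝ => Complex.exp (((-2 * Real.pi * v * ξ : ℝ) : ℂ) * Complex.I) • h v) =
      fun v : ℝ => Complex.exp (-c * v) * h v := by
    ext v
    rw [smul_eq_mul, hcdef]
    congr 2
    push_cast
    ring
  have hi' : Integrable (fun v : ℝ => Complex.exp (-c * v) * h v) := by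
    refine hi.bdd_mul (c := 1) (Continuous.aestronglyMeasurable (by fun_prop))
      (Eventually.of_forall fun v => ?_)
    rw [norm_exp_mul_ofReal]
    simp [hc]
  rw [hfun, ← integral_add_compl measurableSet_Iic hi', Set.compl_Iic]
  congr 1
  rw [← neg_zero, ← integral_comp_neg_Ioi]
  simp

lemma sechWindow_fourier {A B : ℂ} {h : ℝ → ℂ} (w : SechWindow h 1 A B 1) :
    ∃ C a κ, SechWindow (𝓕 h) C a a κ := by
  have hA := w.re_a_pos
  have hB := w.re_b_pos
  obtain ⟨σ, ρ, K, hw⟩ := w.exists_localized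
  have hS : A + B ≠ 0 := fun h => by
    have := congrArg Complex.re h
    simp only [add_re, zero_re] at this
    linarith
  have hh : ∀ v : ℝ, h v = 1 / (Complex.exp (A * v) + Complex.exp (-B * v)) := fun v => by
    rw [w.apply_eq, one_mul]
  have hF := fourier_sech hA hB hh hw.integrable hw.norm_le_const
  set E := Complex.exp (Real.pi * B / (A + B) * Complex.I) with hE
  set a := 2 * (Real.pi : ℂ) ^ 2 / (A + B) with ha
  have hE0 : E ≠ 0 := Complex.exp_ne_zero _
  have hpi : (Real.pi : ℂ) ≠ 0 := by exact_mod_cast Real.pi_ne_zero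
  have hsin : ∀ ξ : ℝ, Complex.sin (Real.pi * ((B - 2 * Real.pi * Complex.I * ξ) / (A + B))) =
      -(Complex.I * E / 2) * (Complex.exp (a * ξ) + -(E⁻¹ ^ 2) * Complex.exp (-a * ξ)) := by
    intro ξ
    set z := Real.pi * ((B - 2 * Real.pi * Complex.I * ξ) / (A + B)) with hz
    have e1 : Complex.exp (z * Complex.I) = E * Complex.exp (a * ξ) := by
      rw [hE, ha, ← Complex.exp_add]
      congr 1
      rw [hz]
      field_simp
      linear_combination (-2 * (Real.pi : ℂ) * ξ) * Complex.I_sq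
    have e2 : Complex.exp (-z * Complex.I) = E⁻¹ * Complex.exp (-a * ξ) := by
      rw [neg_mul, Complex.exp_neg, e1, mul_inv, neg_mul, Complex.exp_neg]
    rw [Complex.sin, e1, e2]
    field_simp
    ring
  have hne : ∀ ξ : ℝ, Complex.exp (a * ξ) + -(E⁻¹ ^ 2) * Complex.exp (-a * ξ) ≠ 0 := by
    intro ξ h0
    have h1 := hsin ξ
    rw [h0, mul_zero, Complex.sin_eq_zero_iff] at h1
    obtain ⟨k, hk⟩ := h1
    rw [mul_comm] at hk
    exact div_mem_integerComplement hA hB (c := 2 * Real.pi * Complex.I * ξ) (by simp)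
      ⟨k, (mul_right_cancel₀ hpi (hk.symm.trans rfl)).symm ▸ rfl⟩
  have hare : 0 < a.re := by
    have e : a = ((2 * Real.pi ^ 2 : ℝ) : ℂ) / (A + B) := by rw [ha]; push_cast; rfl
    rw [e, div_eq_mul_inv, Complex.re_ofReal_mul, Complex.inv_re]
    have h1 : 0 < (A + B).re := by rw [add_re]; positivity
    have h2 : 0 < normSq (A + B) := normSq_pos.2 hS
    have := Real.pi_pos
    positivity
  refine ⟨2 * Real.pi * Complex.I / ((A + B) * E), a, -(E⁻¹ ^ 2), hare, hare, ?_, ?_, hne, ?_⟩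
  · simp [hE0, hS, hpi]
  · simp [hE0]
  · intro ξ
    rw [hF, hsin]
    have h1 := hne ξ
    have hI := Complex.I_ne_zero
    generalize Complex.exp (a * ξ) + -(E⁻¹ ^ 2) * Complex.exp (-a * ξ) = D at h1 ⊢
    field_simp
    linear_combination -Complex.I_sq

/-- The multiplication formula for the Fourier transform on `L²`. -/
lemma integral_fourier_mul_eq {ψ : ℝ → ℂ} (hψ : Integrable ψ) (hψ2 : MemLp ψ 2 volume)
    (hψF : MemLp (𝓕 ψ) 2 volume) (F : Lp ℂ 2 (volume : Measure ℝ)) :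
    ∫ t, (𝓕 F : Lp ℂ 2 (volume : Measure ℝ)) t * ψ t = ∫ t, F t * 𝓕 ψ t := by
  have hpair : ∀ {χ : ℝ → ℂ} (hχ : MemLp χ 2 volume) (G : Lp ℂ 2 (volume : Measure ℝ)),
      ∫ t, G t * χ t = inner ℂ (hχ.star.toLp (star χ)) G := by
    intro χ hχ G
    rw [L2.inner_def]
    refine integral_congr_ae ?_
    filter_upwards [hχ.star.coeFn_toLp] with t ht
    rw [ht]
    simp [mul_comm]
  rw [hpair hψ2, hpair hψF]
  refine DenseRange.induction_on (SchwartzMap.denseRange_toLpCLM (E := ℝ) (F := ℂ) (p := 2)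
    ENNReal.ofNat_ne_top) F
    ?_ fun f => ?_
  · refine isClosed_eq ?_ (continuous_const.inner continuous_id)
    exact continuous_const.inner (Lp.fourierTransformₗᵢ ℝ ℂ).continuous
  · rw [← hpair hψ2, ← hpair hψF]
    simp only [SchwartzMap.toLpCLM_apply]
    rw [SchwartzMap.toLp_fourier_eq]
    have h1 := VectorFourier.integral_fourierIntegral_smul_eq_flip (L := innerₗ ℝ)
      Real.continuous_fourierChar continuous_inner (f.integrable (μ := volume)) hψ
    have h2 : ∫ t, 𝓕 (f : ℝ → ℂ) t * ψ t = ∫ t, f t * 𝓕 ψ t := by simpa using! h1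
    refine (integral_congr_ae ?_).trans (h2.trans (integral_congr_ae ?_))
    · filter_upwards [(𝓕 f).coeFn_toLp 2 volume] with t ht
      rw [ht, SchwartzMap.fourier_coe]
    · filter_upwards [f.coeFn_toLp 2 volume] with t ht
      rw [ht]

lemma fourier_modulation_reflection (h : ℝ → ℂ) (x y ξ : ℝ) :
    𝓕 (fun t : ℝ => Complex.exp (2 * Real.pi * Complex.I * y * t) * h (x - t)) ξ =
      Complex.exp (-2 * Real.pi * Complex.I * x * (ξ - y)) * 𝓕 h (y - ξ) := by
  rw [Real.fourier_real_eq_integral_exp_smul, Real.fourier_real_eq_integral_exp_smul,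
    ← integral_const_mul, ← integral_sub_left_eq_self _ volume x]
  congr 1 with v
  rw [sub_sub_cancel, smul_eq_mul, smul_eq_mul, ← mul_assoc, ← mul_assoc, ← Complex.exp_add,
    ← Complex.exp_add]
  congr 2
  push_cast
  ring

lemma MeasureTheory.MemLp.exp_mul_comp_sub {h : ℝ → ℂ} {p : ℝ≥0∞}
    (hh : MemLp h p volume) (c : ℝ → ℂ) (hc : Continuous c) (hre : ∀ t, (c t).re = 0) (x : ℝ) :
    MemLp (fun t : ℝ => Complex.exp (c t) * h (x - t)) p volume := by
  have h1 : MemLp (fun t => h (x - t)) p volume :=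
    hh.comp_measurePreserving (Measure.measurePreserving_sub_left volume x)
  refine h1.of_le ((Complex.continuous_exp.comp hc).aestronglyMeasurable.mul
    h1.aestronglyMeasurable) (Eventually.of_forall fun t => ?_)
  rw [norm_mul, Complex.norm_exp, hre, Real.exp_zero, one_mul]

/-- The Fourier transform turns translations in `α ℤ` into modulations in `α ℤ`. -/
lemma gaborCoef_fourier {a b : ℂ} (ha : 0 < a.re) (hb : 0 < b.re) {g : ℝ → ℂ}
    (hg : ∀ x : ℝ, g x = 1 / (Complex.exp (a * x) + Complex.exp (-b * x)))
    (α y : ℝ) (k : ℤ) (F : Lp ℂ 2 (volume : Measure ℝ)) :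
    ‖gaborCoef g (𝓕 F : Lp ℂ 2 (volume : Measure ℝ)) (α * k, y)‖ₑ =
      ‖gridCoef α (𝓕 fun t => (starRingEnd ℂ) (g t)) F y (-k)‖ₑ := by
  have w := sechWindow_conj ha hb hg
  obtain ⟨C', a', κ', w'⟩ := sechWindow_fourier w
  obtain ⟨_, _, _, hw⟩ := w.exists_localized
  obtain ⟨_, _, _, hw'⟩ := w'.exists_localized
  set h : ℝ → ℂ := fun t => (starRingEnd ℂ) (g t) with hh
  set ψ : ℝ → ℂ := fun t => Complex.exp (2 * Real.pi * Complex.I * y * t) * h (α * k - t) with hψ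
  have hψp : ∀ {p : ℝ≥0∞}, MemLp h p volume → MemLp ψ p volume := fun hp =>
    hp.exp_mul_comp_sub _ (by fun_prop) (fun t => by simp) _
  have hψF : 𝓕 ψ = fun ξ : ℝ =>
      Complex.exp (-2 * Real.pi * Complex.I * (α * k : ℝ) * (ξ - y)) * 𝓕 h (y - ξ) :=
    funext fun ξ => fourier_modulation_reflection h (α * k) y ξ
  have hmul := integral_fourier_mul_eq (memLp_one_iff_integrable.1
    (hψp (memLp_one_iff_integrable.2 hw.integrable))) (hψp hw.memLp_two)
    (hψF ▸ hw'.memLp_two.exp_mul_comp_sub _ (by fun_prop)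
      (fun t => by rw [← Complex.ofReal_sub]; simp) _) F
  have hcoef : gaborCoef g (𝓕 F : Lp ℂ 2 (volume : Measure ℝ)) (α * k, y) =
      Complex.exp ((2 * Real.pi * α * k * y : ℝ) * Complex.I) * gridCoef α (𝓕 h) F y (-k) := by
    rw [gridCoef, ← integral_const_mul, gaborCoef]
    simp only [conj_modulation_mul]
    refine hmul.trans ?_
    rw [hψF]
    congr 1 with ξ
    rw [mul_left_comm (Complex.exp ((2 * Real.pi * α * k * y : ℝ) * Complex.I)),
      ← mul_assoc (Complex.exp _) (Complex.exp _), ← Complex.exp_add]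
    congr 3
    push_cast
    ring_nf
  rw [hcoef, enorm_mul, ← ofReal_norm, Complex.norm_exp_ofReal_mul_I, ENNReal.ofReal_one, one_mul]

lemma lintegral_enorm_sq_fourier (F : Lp ℂ 2 (volume : Measure ℝ)) :
    ∫⁻ t, ‖(𝓕 F : Lp ℂ 2 (volume : Measure ℝ)) t‖ₑ ^ 2 = ∫⁻ t, ‖F t‖ₑ ^ 2 := by
  have h1 : ∀ G : Lp ℂ 2 (volume : Measure ℝ), ‖G‖ₑ ^ (2 : ℝ) = ∫⁻ t, ‖G t‖ₑ ^ 2 := fun G => by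
    simpa [Lp.enorm_def] using
      eLpNorm_nnreal_pow_eq_lintegral (f := G) (μ := volume) (p := 2) two_ne_zero
  rw [← h1, ← h1, ← ofReal_norm, Lp.norm_fourier_eq, ofReal_norm]

/-- The density theorem for the system with translations in `α ℤ`. -/
lemma isGaborFrame_fst_grid_snd_mem_iff {a b : ℂ} (ha : 0 < a.re) (hb : 0 < b.re) {g : ℝ → ℂ}
    (hg : ∀ x : ℝ, g x = 1 / (Complex.exp (a * x) + Complex.exp (-b * x)))
    {α : ℝ} (hα : 0 < α) {Λ : Set ℝ} (hΛ : Separated Λ) :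
    IsGaborFrame g {p : ℝ × ℝ | (∃ k : ℤ, p.1 = α * k) ∧ p.2 ∈ Λ} ↔ α < lowerDensity Λ := by
  obtain ⟨C', a', κ', w⟩ := sechWindow_fourier (sechWindow_conj ha hb hg)
  set h : ℝ → ℂ := 𝓕 fun t => (starRingEnd ℂ) (g t) with hh
  have hQF : ∀ F : Lp ℂ 2 (volume : Measure ℝ), ∑' i : Λ, ∑' k : ℤ,
      ‖gaborCoef g (𝓕 F : Lp ℂ 2 (volume : Measure ℝ)) (α * k, i)‖ₑ ^ 2 =
      ∑' i : Λ, ∑' k : ℤ, ‖gridCoef α h F i k‖ₑ ^ 2 := by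
    intro F
    simp only [gaborCoef_fourier ha hb hg]
    exact tsum_congr fun i => (Equiv.neg ℤ).tsum_eq fun k => ‖gridCoef α h F i k‖ₑ ^ 2
  have hgab : ∀ {f f' : ℝ → ℂ}, f =ᵐ[volume] f' → gaborCoef g f = gaborCoef g f' := by
    intro f f' hff
    ext p
    exact integral_congr_ae (by filter_upwards [hff] with t ht; rw [ht])
  have hgrid : ∀ {f f' : ℝ → ℂ}, f =ᵐ[volume] f' → gridCoef α h f = gridCoef α h f' := by
    intro f f' hff
    ext x k
    exact integral_congr_ae (by filter_upwards [hff] with t ht; rw [ht])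
  have hlint : ∀ {f f' : ℝ → ℂ}, f =ᵐ[volume] f' →
      ∫⁻ t, ‖f t‖ₑ ^ 2 = ∫⁻ t, ‖f' t‖ₑ ^ 2 := fun hff =>
    lintegral_congr_ae (by filter_upwards [hff] with t ht; rw [ht])
  have hforth : ∀ f : ℝ → ℂ, MemLp f 2 volume → ∃ f', MemLp f' 2 volume ∧
      ∫⁻ t, ‖f' t‖ₑ ^ 2 = ∫⁻ t, ‖f t‖ₑ ^ 2 ∧
      ∑' i : Λ, ∑' k : ℤ, ‖gaborCoef g f (α * k, i)‖ₑ ^ 2 =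
        ∑' i : Λ, ∑' k : ℤ, ‖gridCoef α h f' i k‖ₑ ^ 2 := by
    intro f hf
    set F : Lp ℂ 2 (volume : Measure ℝ) := 𝓕⁻ (hf.toLp f) with hF
    have hFf : 𝓕 F = hf.toLp f := FourierTransform.fourier_fourierInv_eq _
    refine ⟨F, Lp.memLp F, ?_, ?_⟩
    · rw [← lintegral_enorm_sq_fourier, hFf, hlint hf.coeFn_toLp]
    · rw [← hQF, hFf, hgab hf.coeFn_toLp]
  have hback : ∀ f : ℝ → ℂ, MemLp f 2 volume → ∃ f', MemLp f' 2 volume ∧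
      ∫⁻ t, ‖f' t‖ₑ ^ 2 = ∫⁻ t, ‖f t‖ₑ ^ 2 ∧
      ∑' i : Λ, ∑' k : ℤ, ‖gaborCoef g f' (α * k, i)‖ₑ ^ 2 =
        ∑' i : Λ, ∑' k : ℤ, ‖gridCoef α h f i k‖ₑ ^ 2 := by
    intro f hf
    refine ⟨(𝓕 (hf.toLp f) : Lp ℂ 2 (volume : Measure ℝ)), Lp.memLp _, ?_, ?_⟩
    · rw [lintegral_enorm_sq_fourier, hlint hf.coeFn_toLp]
    · rw [hQF, hgrid hf.coeFn_toLp]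
  have hbessel : ∃ B : ℝ≥0, ∀ f, MemLp f 2 volume →
      ∑' i : Λ, ∑' k : ℤ, ‖gaborCoef g f (α * k, i)‖ₑ ^ 2 ≤ B * ∫⁻ t, ‖f t‖ₑ ^ 2 := by
    obtain ⟨B, hB⟩ := w.exists_gridCoef_bessel hΛ hα
    refine ⟨B, fun f hf => ?_⟩
    obtain ⟨f', hf', h1, h2⟩ := hforth f hf
    rw [h2, ← h1]
    exact hB f' hf'
  rw [isGaborFrame_iff (fun f _ =>
    tsum_setOf_fst_grid_snd_mem hα fun p => ‖gaborCoef g f p‖ₑ ^ 2) hbessel,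
    ← w.exists_gridCoef_lower_bound_iff hΛ hα]
  refine exists_congr fun A => ⟨fun H f hf => ?_, fun H f hf => ?_⟩
  · obtain ⟨f', hf', h1, h2⟩ := hback f hf
    rw [← h1, ← h2]
    exact H f' hf'
  · obtain ⟨f', hf', h1, h2⟩ := hforth f hf
    rw [← h1, h2]
    exact H f' hf'

end GaborDensity

/-- For a hyperbolic secant type window and a separated `Λ ⊆ ℝ`, the Gabor
systems `G(g, Λ × αℤ)` and `G(g, αℤ × Λ)` are frames iff `D⁻(Λ) > α`. -/
theorem statement0 (a b : ℂ) (ha : 0 < a.re) (hb : 0 < b.re)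
    (g : ℝ → ℂ) (hg : ∀ x : ℝ, g x = 1 / (Complex.exp (a * x) + Complex.exp (-b * x)))
    (α : ℝ) (hα : 0 < α) (Λ : Set ℝ) (hΛ : Separated Λ) :
    (IsGaborFrame g {p : ℝ × ℝ | p.1 ∈ Λ ∧ ∃ k : ℤ, p.2 = α * k} ↔
      IsGaborFrame g {p : ℝ × ℝ | (∃ k : ℤ, p.1 = α * k) ∧ p.2 ∈ Λ}) ∧
    (IsGaborFrame g {p : ℝ × ℝ | p.1 ∈ Λ ∧ ∃ k : ℤ, p.2 = α * k} ↔
      α < lowerDensity Λ) := by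
  have h₁ := isGaborFrame_fst_mem_snd_grid_iff ha hb hg hα hΛ
  have h₂ := isGaborFrame_fst_grid_snd_mem_iff ha hb hg hα hΛ
  exact ⟨h₁.trans h₂.symm, h₁⟩

end
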